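/- Suppose δ is a Vopěnka cardinal. Then there is a function f : δ → V_δ such that whenever κ < δ is <δ-supercompact, f ↾ κ : κ → V_κ is a Laver function for κ: for any x ∈ V_δ and any λ < δ with x ∈ H_λ, there is a λ-supercompactness embedding j : V → M with crit(j) = κ and j(f)(κ) = x. Moreover, f can be chosen so that f(α) = 0 whenever α is <δ-supercompact or α is not measurable. -/

import Mathlib

/-!
A framework for formalizing large-cardinal notions from
"Woodin for strong compactness cardinals" over the Mathlib model `ZFSet`
of ZFC.  The ambient set-theoretic universe `V` is the type `ZFSet`;
classes are sets `Set ZFSet`; everything is relativised to a "universe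
class" `W : Set ZFSet` (the ambient universe being `W = Set.univ`), so
that the same definitions can also be interpreted inside transitive set
models of ZFC (used to express the forcing/consistency results).
-/

namespace WSC

/-! ### First-order formulas in the language of set theory -/

/-- First-order formulas in the language `{∈}`, with `n` free (de Bruijn) variables. -/
inductive Fml : ℕ → Type where
  | mem {n} : Fin n → Fin n → Fml n
  | eq  {n} : Fin n → Fin n → Fml n
  | not {n} : Fml n → Fml n
  | and {n} : Fml n → Fml n → Fml n
  | ex  {n} : Fml (n + 1) → Fml n

namespace Fml

/-- Realization of a formula over the class `C`, with all quantifiers relativised to `C`. -/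
def Realize (C : Set ZFSet) : ∀ {n}, Fml n → (Fin n → ZFSet) → Prop
  | _, .mem i j, v => v i ∈ v j
  | _, .eq i j, v => v i = v j
  | _, .not φ, v => ¬ Realize C φ v
  | _, .and φ ψ, v => Realize C φ v ∧ Realize C ψ v
  | _, .ex φ, v => ∃ x ∈ C, Realize C φ (Fin.snoc v x)

def or {n} (φ ψ : Fml n) : Fml n := .not (.and (.not φ) (.not ψ))
def imp {n} (φ ψ : Fml n) : Fml n := Fml.or (.not φ) ψ
def iff {n} (φ ψ : Fml n) : Fml n := .and (imp φ ψ) (imp ψ φ)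
def all {n} (φ : Fml (n + 1)) : Fml n := .not (.ex (.not φ))

/-- Universal closure. -/
def alls : ∀ {n}, Fml n → Fml 0
  | 0, φ => φ
  | _ + 1, φ => alls (all φ)

/-- Renaming of variables. -/
def rename : ∀ {n m}, (Fin n → Fin m) → Fml n → Fml m
  | _, _, f, .mem i j => .mem (f i) (f j)
  | _, _, f, .eq i j => .eq (f i) (f j)
  | _, _, f, .not φ => .not (rename f φ)
  | _, _, f, .and φ ψ => .and (rename f φ) (rename f ψ)
  | _, _, f, .ex φ => .ex (rename (Fin.snoc (fun i => (f i).castSucc) (Fin.last _)) φ)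

end Fml

/-- A sentence `φ` holds in the class `C`. -/
def Sat (C : Set ZFSet) (φ : Fml 0) : Prop := Fml.Realize C φ (fun i => i.elim0)

/-! ### The ZFC axioms -/

def extAx : Fml 0 :=
  Fml.all (Fml.all (Fml.imp (Fml.all (Fml.iff (.mem 2 0) (.mem 2 1))) (.eq 0 1)))

def pairAx : Fml 0 := Fml.all (Fml.all (Fml.ex (Fml.and (.mem 0 2) (.mem 1 2))))

def unionAx : Fml 0 :=
  Fml.all (Fml.ex (Fml.all (Fml.all
    (Fml.imp (Fml.and (.mem 2 3) (.mem 3 0)) (.mem 2 1)))))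

def powerAx : Fml 0 :=
  Fml.all (Fml.ex (Fml.all
    (Fml.imp (Fml.all (Fml.imp (.mem 3 2) (.mem 3 0))) (.mem 2 1))))

def infAx : Fml 0 :=
  Fml.ex (Fml.and
    (Fml.ex (Fml.and (.mem 1 0) (Fml.all (Fml.not (.mem 2 1)))))
    (Fml.all (Fml.imp (.mem 1 0)
      (Fml.ex (Fml.and (.mem 2 0)
        (Fml.all (Fml.iff (.mem 3 2) (Fml.or (.mem 3 1) (.eq 3 1)))))))))

def foundAx : Fml 0 :=
  Fml.all (Fml.imp (Fml.ex (.mem 1 0))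
    (Fml.ex (Fml.and (.mem 1 0) (Fml.all (Fml.imp (.mem 2 1) (Fml.not (.mem 2 0)))))))

def choiceAx : Fml 0 :=
  Fml.all (Fml.imp
    (Fml.and
      (Fml.all (Fml.imp (.mem 1 0) (Fml.ex (.mem 2 1))))
      (Fml.all (Fml.all (Fml.imp
        (Fml.and (.mem 1 0) (Fml.and (.mem 2 0) (Fml.ex (Fml.and (.mem 3 1) (.mem 3 2)))))
        (.eq 1 2)))))
    (Fml.ex (Fml.all (Fml.imp (.mem 2 0)
      (Fml.ex (Fml.and (Fml.and (.mem 3 2) (.mem 3 1))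
        (Fml.all (Fml.imp (Fml.and (.mem 4 2) (.mem 4 1)) (.eq 4 3)))))))))

/-- An instance of the separation schema, for a formula `φ` with parameters
`0, …, n-1` and distinguished variable `n`. -/
def sepAx (n : ℕ) (φ : Fml (n + 1)) : Fml 0 :=
  Fml.alls ((Fml.ex (Fml.all (Fml.iff
    (Fml.mem (⟨n + 2, by omega⟩ : Fin (n + 3)) ⟨n + 1, by omega⟩)
    (Fml.and (Fml.mem (⟨n + 2, by omega⟩ : Fin (n + 3)) ⟨n, by omega⟩)
      (Fml.rename (fun i => if h : (i : ℕ) < n then (⟨i, by omega⟩ : Fin (n + 3))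
        else ⟨n + 2, by omega⟩) φ))))) : Fml (n + 1))

/-- An instance of the collection schema, for a formula `φ` with parameters
`0, …, n-1` and distinguished variables `n` (input) and `n+1` (output). -/
def collAx (n : ℕ) (φ : Fml (n + 2)) : Fml 0 :=
  let φ' : Fml (n + 4) := Fml.rename (fun i => if h : (i : ℕ) < n then (⟨i, by omega⟩ : Fin (n + 4))
    else ⟨(i : ℕ) + 2, by have := i.isLt; omega⟩) φ
  Fml.alls ((Fml.ex (Fml.all
    (Fml.imp (Fml.mem (⟨n + 2, by omega⟩ : Fin (n + 3)) ⟨n, by omega⟩)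
      (Fml.imp (Fml.ex φ')
        (Fml.ex (Fml.and (Fml.mem (⟨n + 3, by omega⟩ : Fin (n + 4)) ⟨n + 1, by omega⟩) φ')))))) : Fml (n + 1))

/-- The ZFC axioms. -/
def ZFCax : Set (Fml 0) :=
  {extAx, pairAx, unionAx, powerAx, infAx, foundAx, choiceAx} ∪
    (⋃ n, Set.range (sepAx n)) ∪ (⋃ n, Set.range (collAx n))

/-- A transitive set model of ZFC. -/
def IsZFModel (m : ZFSet) : Prop := m.IsTransitive ∧ ∀ φ ∈ ZFCax, Sat m.toSet φ

/-- A countable transitive model of ZFC. -/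
def IsCtm (m : ZFSet) : Prop := IsZFModel m ∧ m.toSet.Countable

/-! ### Basic set-theoretic notions -/

/-- `x` is a (von Neumann) ordinal: a transitive set of transitive sets. -/
def IsOrd (x : ZFSet) : Prop := x.IsTransitive ∧ ∀ y ∈ x, ZFSet.IsTransitive y

/-- `x ≤ y` for ordinals. -/
def oLe (x y : ZFSet) : Prop := x ∈ y ∨ x = y

/-- `f` is a function with domain `d` (coded as a set of Kuratowski pairs). -/
def IsFuncOn (d f : ZFSet) : Prop :=
  (∀ p ∈ f, ∃ a b : ZFSet, a ∈ d ∧ p = a.pair b) ∧ ∀ a ∈ d, ∃! b : ZFSet, a.pair b ∈ f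

/-- All values of the (partial) function `f` lie in `b`. -/
def MapsInto (f b : ZFSet) : Prop := ∀ x y : ZFSet, x.pair y ∈ f → y ∈ b

/-- The function `f` is injective. -/
def InjFun (f : ZFSet) : Prop := ∀ x x' y : ZFSet, x.pair y ∈ f → x'.pair y ∈ f → x = x'

/-- `|a| ≤ |b|`, witnessed by an injection belonging to the universe class `W`. -/
def SetLeIn (W : Set ZFSet) (a b : ZFSet) : Prop :=
  ∃ f ∈ W, IsFuncOn a f ∧ MapsInto f b ∧ InjFun f

/-- `κ` is a cardinal (relative to the universe class `W`). -/
def IsCardIn (W : Set ZFSet) (κ : ZFSet) : Prop :=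
  IsOrd κ ∧ ∀ α ∈ κ, ¬ SetLeIn W κ α

/-- `M` is a transitive class. -/
def TransClass (M : Set ZFSet) : Prop := ∀ x ∈ M, ∀ y : ZFSet, y ∈ x → y ∈ M

/-- An elementary embedding `j : (W, ∈) → (M, ∈)` between two classes. -/
structure ElemEmb (W M : Set ZFSet) where
  toFun : ZFSet → ZFSet
  maps : ∀ x ∈ W, toFun x ∈ M
  elem : ∀ {n : ℕ} (φ : Fml n) (v : Fin n → ZFSet), (∀ i, v i ∈ W) →
    (Fml.Realize W φ v ↔ Fml.Realize M φ (fun i => toFun (v i)))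

/-- `κ` is the critical point of `j`: the least ordinal moved. -/
def IsCrit {W M : Set ZFSet} (j : ElemEmb W M) (κ : ZFSet) : Prop :=
  IsOrd κ ∧ j.toFun κ ≠ κ ∧ ∀ α ∈ κ, j.toFun α = α

/-! ### The rank hierarchy -/

/-- `x ∈ V_lam`. -/
def VMem (lam x : ZFSet) : Prop := x.rank < lam.rank

/-- `V_lam ⊆ M` (with `V_lam` computed in the universe class `W`). -/
def VInclIn (W M : Set ZFSet) (lam : ZFSet) : Prop := ∀ x ∈ W, VMem lam x → x ∈ M

/-- `A ⊆ V_δ`. -/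
def SubV (A δ : ZFSet) : Prop := ∀ x ∈ A, VMem δ x

/-- `A ∩ V_lam = B ∩ V_lam`. -/
def AgreeBelowIn (W : Set ZFSet) (lam A B : ZFSet) : Prop :=
  ∀ x ∈ W, VMem lam x → (x ∈ A ↔ x ∈ B)

/-- `A ∩ lam = B ∩ lam` (for sets of ordinals). -/
def AgreeMem (lam A B : ZFSet) : Prop := ∀ ξ ∈ lam, (ξ ∈ A ↔ ξ ∈ B)

/-! ### Covering properties -/

/-- `M ⊨ |s| < t`: in `M` there is an injection of `s` into some ordinal `β ∈ t`. -/
def CardLtIn (M : Set ZFSet) (s t : ZFSet) : Prop :=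
  ∃ β f : ZFSet, β ∈ t ∧ f ∈ M ∧ IsFuncOn s f ∧ MapsInto f β ∧ InjFun f

/-- `j` satisfies the weak `lam`-covering property (with target class `M`):
there is `s ∈ M` with `j '' lam ⊆ s` and `M ⊨ |s| < j κ`. -/
def WCovers (M : Set ZFSet) (j : ZFSet → ZFSet) (κ lam : ZFSet) : Prop :=
  ∃ s ∈ M, (∀ α ∈ lam, j α ∈ s) ∧ CardLtIn M s (j κ)

/-- `j` satisfies the (full) `lam`-covering property: every `X ∈ W` with
`X ⊆ M` and `|X| ≤ lam` is covered by some `s ∈ M` with `M ⊨ |s| < j κ`. -/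
def CoversIn (W M : Set ZFSet) (j : ZFSet → ZFSet) (κ lam : ZFSet) : Prop :=
  ∀ X ∈ W, X.toSet ⊆ M → SetLeIn W X lam → ∃ s ∈ M, X ⊆ s ∧ CardLtIn M s (j κ)

/-! ### Strongness -/

/-- `κ` is `lam`-strong. -/
def LamStrongIn (W : Set ZFSet) (κ lam : ZFSet) : Prop :=
  ∃ M : Set ZFSet, M ⊆ W ∧ TransClass M ∧ ∃ j : ElemEmb W M,
    IsCrit j κ ∧ lam ∈ j.toFun κ ∧ VInclIn W M lam

/-- `κ` is `lam`-strong for `A`. -/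
def LamStrongForIn (W : Set ZFSet) (κ lam A : ZFSet) : Prop :=
  ∃ M : Set ZFSet, M ⊆ W ∧ TransClass M ∧ ∃ j : ElemEmb W M,
    IsCrit j κ ∧ lam ∈ j.toFun κ ∧ VInclIn W M lam ∧ AgreeBelowIn W lam A (j.toFun A)

/-- `κ` is `<δ`-strong. -/
def LtStrongIn (W : Set ZFSet) (κ δ : ZFSet) : Prop :=
  ∀ lam : ZFSet, oLe κ lam → lam ∈ δ → LamStrongIn W κ lam

/-- `κ` is `<δ`-strong for `A`. -/
def LtStrongForIn (W : Set ZFSet) (κ δ A : ZFSet) : Prop :=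
  ∀ lam : ZFSet, oLe κ lam → lam ∈ δ → LamStrongForIn W κ lam A

/-! ### Strong compactness -/

/-- `κ` is `lam`-strongly compact (there is an embedding with critical point `κ`,
`j κ > lam`, satisfying the weak `lam`-covering property). -/
def LamSCIn (W : Set ZFSet) (κ lam : ZFSet) : Prop :=
  ∃ M : Set ZFSet, M ⊆ W ∧ TransClass M ∧ ∃ j : ElemEmb W M,
    IsCrit j κ ∧ lam ∈ j.toFun κ ∧ WCovers M j.toFun κ lam

/-- `κ` is `lam`-strongly compact for the set of ordinals `A`: there is a
`lam`-strong compactness embedding `j` (one with the full `lam`-covering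
property) with critical point `κ` and `A ∩ lam = j A ∩ lam`. -/
def LamSCForIn (W : Set ZFSet) (κ lam A : ZFSet) : Prop :=
  ∃ M : Set ZFSet, M ⊆ W ∧ TransClass M ∧ ∃ j : ElemEmb W M,
    IsCrit j κ ∧ lam ∈ j.toFun κ ∧ CoversIn W M j.toFun κ lam ∧ AgreeMem lam A (j.toFun A)

/-- `κ` is `<δ`-strongly compact. -/
def LtSCIn (W : Set ZFSet) (κ δ : ZFSet) : Prop :=
  ∀ lam : ZFSet, oLe κ lam → lam ∈ δ → LamSCIn W κ lam

/-- `κ` is `<δ`-strongly compact for `A`. -/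
def LtSCForIn (W : Set ZFSet) (κ δ A : ZFSet) : Prop :=
  ∀ lam : ZFSet, oLe κ lam → lam ∈ δ → LamSCForIn W κ lam A

/-! ### Supercompactness -/

/-- `M` is closed under `lam`-sequences (from the universe class `W`). -/
def SeqClosedIn (W M : Set ZFSet) (lam : ZFSet) : Prop :=
  ∀ f ∈ W, IsFuncOn lam f → (∀ x y : ZFSet, x.pair y ∈ f → y ∈ M) → f ∈ M

/-- `κ` is `lam`-supercompact. -/
def LamSupercompactIn (W : Set ZFSet) (κ lam : ZFSet) : Prop :=
  ∃ M : Set ZFSet, M ⊆ W ∧ TransClass M ∧ ∃ j : ElemEmb W M,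
    IsCrit j κ ∧ lam ∈ j.toFun κ ∧ SeqClosedIn W M lam

/-- `κ` is `lam`-supercompact for `A`. -/
def LamSupercompactForIn (W : Set ZFSet) (κ lam A : ZFSet) : Prop :=
  ∃ M : Set ZFSet, M ⊆ W ∧ TransClass M ∧ ∃ j : ElemEmb W M,
    IsCrit j κ ∧ lam ∈ j.toFun κ ∧ SeqClosedIn W M lam ∧ AgreeBelowIn W lam A (j.toFun A)

/-- `κ` is `<δ`-supercompact. -/
def LtSupercompactIn (W : Set ZFSet) (κ δ : ZFSet) : Prop :=
  ∀ lam : ZFSet, oLe κ lam → lam ∈ δ → LamSupercompactIn W κ lam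

/-- `κ` is `<δ`-supercompact for `A`. -/
def LtSupercompactForIn (W : Set ZFSet) (κ δ A : ZFSet) : Prop :=
  ∀ lam : ZFSet, oLe κ lam → lam ∈ δ → LamSupercompactForIn W κ lam A

/-! ### The global large-cardinal notions -/

/-- `δ` is a Woodin cardinal. -/
def WoodinIn (W : Set ZFSet) (δ : ZFSet) : Prop :=
  IsCardIn W δ ∧ ∀ A ∈ W, SubV A δ → ∃ κ, κ ∈ δ ∧ LtStrongForIn W κ δ A

/-- `δ` is a Woodin for strong compactness cardinal. -/
def WoodinSCIn (W : Set ZFSet) (δ : ZFSet) : Prop :=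
  IsCardIn W δ ∧ ∀ A ∈ W, A ⊆ δ → ∃ κ, κ ∈ δ ∧ LtSCForIn W κ δ A

/-- `δ` is a Vopěnka cardinal. -/
def VopenkaIn (W : Set ZFSet) (δ : ZFSet) : Prop :=
  IsCardIn W δ ∧ ∀ A ∈ W, SubV A δ → ∃ κ, κ ∈ δ ∧ LtSupercompactForIn W κ δ A

/-- `δ` is Woodin and a limit of `<δ`-supercompact cardinals. -/
def WoodinLimSupercompactIn (W : Set ZFSet) (δ : ZFSet) : Prop :=
  WoodinIn W δ ∧ ∀ α ∈ δ, ∃ κ : ZFSet, α ∈ κ ∧ κ ∈ δ ∧ LtSupercompactIn W κ δ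

/-! ### Inaccessibility -/

/-- `δ` is a regular ordinal: the range of any function from a smaller
ordinal into `δ` is bounded. -/
def RegularIn (W : Set ZFSet) (δ : ZFSet) : Prop :=
  IsOrd δ ∧ ∀ α ∈ δ, ∀ f ∈ W, IsFuncOn α f → MapsInto f δ →
    ∃ β ∈ δ, ∀ x y : ZFSet, x.pair y ∈ f → y ∈ β

/-- The power set of `x` relative to `W`. -/
def powersetIn (W : Set ZFSet) (x : ZFSet) : ZFSet := ZFSet.sep (fun z => z ∈ W) x.powerset

/-- `δ` is a strong limit cardinal. -/
def StrongLimitIn (W : Set ZFSet) (δ : ZFSet) : Prop :=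
  IsCardIn W δ ∧ ∀ α ∈ δ, ∃ β ∈ δ, SetLeIn W (powersetIn W α) β

/-- `δ` is inaccessible: an uncountable regular strong limit cardinal. -/
def InaccessibleIn (W : Set ZFSet) (δ : ZFSet) : Prop :=
  ZFSet.omega ∈ δ ∧ IsCardIn W δ ∧ RegularIn W δ ∧ StrongLimitIn W δ

/-! ### Ultrafilters and measurability -/

/-- Relative complement `a \ b`. -/
def zdiff (a b : ZFSet) : ZFSet := ZFSet.sep (fun x => x ∉ b) a

/-- Intersection `a ∩ b`. -/
def zinter (a b : ZFSet) : ZFSet := ZFSet.sep (fun x => x ∈ b) a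

/-- `U` is a nonprincipal `α`-complete ultrafilter on `α`. -/
def IsUfOnIn (W : Set ZFSet) (α U : ZFSet) : Prop :=
  (∀ x ∈ U, x ⊆ α) ∧ α ∈ U ∧ (∅ : ZFSet) ∉ U ∧
  (∀ x ∈ U, ∀ y : ZFSet, y ∈ W → y ⊆ α → x ⊆ y → y ∈ U) ∧
  (∀ x ∈ W, x ⊆ α → (x ∈ U ∨ zdiff α x ∈ U)) ∧
  (∀ β ∈ α, ∀ g ∈ W, IsFuncOn β g → MapsInto g U →
    ZFSet.sep (fun ξ => ∀ p q : ZFSet, p.pair q ∈ g → ξ ∈ q) α ∈ U) ∧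
  (∀ ξ ∈ α, ZFSet.sep (fun x => x = ξ) α ∉ U)

/-- `U` is a normal ultrafilter on `α`: a nonprincipal `α`-complete
ultrafilter closed under diagonal intersections. -/
def IsNormalUfOnIn (W : Set ZFSet) (α U : ZFSet) : Prop :=
  IsUfOnIn W α U ∧
    ∀ g ∈ W, IsFuncOn α g → MapsInto g U →
      ZFSet.sep (fun ξ => ∀ p q : ZFSet, p.pair q ∈ g → p ∈ ξ → ξ ∈ q) α ∈ U

/-- `α` is a measurable cardinal. -/
def MeasurableIn (W : Set ZFSet) (α : ZFSet) : Prop := ∃ U ∈ W, IsUfOnIn W α U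

/-! ### Functions `f : δ → δ` and closure points -/

/-- `f` codes a function from `δ` to `δ`. -/
def FuncSelf (δ f : ZFSet) : Prop := IsFuncOn δ f ∧ MapsInto f δ

/-- `κ` is a closure point of `f`, i.e. `f '' κ ⊆ κ`. -/
def ClosurePt (f κ : ZFSet) : Prop := ∀ x y : ZFSet, x.pair y ∈ f → x ∈ κ → y ∈ κ

/-! ### GCH -/

/-- GCH: for every infinite cardinal `κ`, any family of subsets of `κ` has
size at most `κ` or size at least that of the full power set of `κ`. -/
def GCHIn (W : Set ZFSet) : Prop :=
  ∀ κ ∈ W, IsCardIn W κ → oLe ZFSet.omega κ →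
    ∀ X ∈ W, (∀ z ∈ X, z ⊆ κ) → (SetLeIn W X κ ∨ SetLeIn W (powersetIn W κ) X)

/-! ### Forcing -/

/-- `(P, R)` is a forcing notion (a preordered set, `x.pair y ∈ R` meaning
`x ≤ y`, i.e. `x` is stronger than `y`). -/
def IsPoset (P R : ZFSet) : Prop :=
  (∀ p ∈ P, p.pair p ∈ R) ∧
  (∀ p q r : ZFSet, p.pair q ∈ R → q.pair r ∈ R → p.pair r ∈ R) ∧
  (∀ x y : ZFSet, x.pair y ∈ R → x ∈ P ∧ y ∈ P)

/-- `G` is an `m`-generic filter on the forcing notion `(P, R) ∈ m`. -/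
def IsGenericFilter (m P R G : ZFSet) : Prop :=
  G ⊆ P ∧
  (∀ p ∈ G, ∀ q ∈ P, p.pair q ∈ R → q ∈ G) ∧
  (∀ p ∈ G, ∀ q ∈ G, ∃ r ∈ G, r.pair p ∈ R ∧ r.pair q ∈ R) ∧
  (∀ D ∈ m, (D ⊆ P ∧ ∀ p ∈ P, ∃ q ∈ D, q.pair p ∈ R) → ∃ q, q ∈ G ∧ q ∈ D)

/-- `n = m[G]` : `n` is a transitive ZFC-model extending `m` and containing
`G`, and is the least such. -/
def IsGenericExt (m G n : ZFSet) : Prop :=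
  IsZFModel n ∧ m ⊆ n ∧ G ∈ n ∧
    ∀ n' : ZFSet, IsZFModel n' → m ⊆ n' → G ∈ n' → n ⊆ n'

/-- `n` is a (set-)forcing extension of the transitive model `m`. -/
def IsForcingExt (m n : ZFSet) : Prop :=
  ∃ P R G : ZFSet, P ∈ m ∧ R ∈ m ∧ IsPoset P R ∧
    IsGenericFilter m P R G ∧ IsGenericExt m G n

/-! ### Ambient (full-universe) abbreviations -/

abbrev LamStrong (κ lam : ZFSet) : Prop := LamStrongIn Set.univ κ lam
abbrev LamStrongFor (κ lam A : ZFSet) : Prop := LamStrongForIn Set.univ κ lam A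
abbrev LtStrong (κ δ : ZFSet) : Prop := LtStrongIn Set.univ κ δ
abbrev LtStrongFor (κ δ A : ZFSet) : Prop := LtStrongForIn Set.univ κ δ A
abbrev LamSC (κ lam : ZFSet) : Prop := LamSCIn Set.univ κ lam
abbrev LamSCFor (κ lam A : ZFSet) : Prop := LamSCForIn Set.univ κ lam A
abbrev LtSC (κ δ : ZFSet) : Prop := LtSCIn Set.univ κ δ
abbrev LtSCFor (κ δ A : ZFSet) : Prop := LtSCForIn Set.univ κ δ A
abbrev LamSupercompact (κ lam : ZFSet) : Prop := LamSupercompactIn Set.univ κ lam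
abbrev LtSupercompact (κ δ : ZFSet) : Prop := LtSupercompactIn Set.univ κ δ
abbrev Woodin (δ : ZFSet) : Prop := WoodinIn Set.univ δ
abbrev WoodinSC (δ : ZFSet) : Prop := WoodinSCIn Set.univ δ
abbrev Vopenka (δ : ZFSet) : Prop := VopenkaIn Set.univ δ
abbrev IsCard (κ : ZFSet) : Prop := IsCardIn Set.univ κ
abbrev Inaccessible (δ : ZFSet) : Prop := InaccessibleIn Set.univ δ
abbrev Covers (M : Set ZFSet) (j : ZFSet → ZFSet) (κ lam : ZFSet) : Prop :=
  CoversIn Set.univ M j κ lam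
abbrev VIncl (M : Set ZFSet) (lam : ZFSet) : Prop := VInclIn Set.univ M lam
abbrev AgreeBelow (lam A B : ZFSet) : Prop := AgreeBelowIn Set.univ lam A B
abbrev SeqClosed (M : Set ZFSet) (lam : ZFSet) : Prop := SeqClosedIn Set.univ M lam

/-- `x ∈ H_lam` : `x` has hereditary cardinality `< lam`, i.e. `x` is included
in a transitive set of size `< lam`. -/
def InH (lam x : ZFSet) : Prop :=
  ∃ t : ZFSet, x ⊆ t ∧ t.IsTransitive ∧ ∃ α ∈ lam, SetLeIn Set.univ t α

section HelpB
universe u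
open ZFSet Filter
open scoped ZFSet

/-- `e` relates `a` to `z`. -/
def EE (e a z : ZFSet.{u}) : Prop := ZFSet.pair a z ∈ e

/-- `e` is a partial `∈`-embedding from `K` into `T` with transitive domain. -/
structure Emb (K T e : ZFSet.{u}) : Prop where
  sub : ∀ p ∈ e, ∃ a ∈ K, ∃ z ∈ T, p = ZFSet.pair a z
  fn : ∀ {a z z'}, EE e a z → EE e a z' → z = z'
  inj : ∀ {a a' z}, EE e a z → EE e a' z → a = a'
  mem : ∀ {a a' z z'}, EE e a z → EE e a' z' → (a ∈ a' ↔ z ∈ z')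
  dom : ∀ {a a' z}, EE e a z → a' ∈ a → ∃ z', EE e a' z'

theorem Emb.left {K T e a z : ZFSet.{u}} (h : Emb K T e) (ha : EE e a z) : a ∈ K := by
  obtain ⟨a', ha', z', hz', hp⟩ := h.sub _ ha
  rw [ZFSet.pair_inj] at hp
  rw [hp.1]; exact ha'

theorem Emb.right {K T e a z : ZFSet.{u}} (h : Emb K T e) (ha : EE e a z) : z ∈ T := by
  obtain ⟨a', ha', z', hz', hp⟩ := h.sub _ ha
  rw [ZFSet.pair_inj] at hp
  rw [hp.2]; exact hz'

theorem Emb.mem_iff {K T e c C x : ZFSet.{u}} (h : Emb K T e) (hc : EE e c C) :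
    x ∈ c ↔ ∃ x' ∈ C, EE e x x' := by
  constructor
  · intro hx
    obtain ⟨x', hx'⟩ := h.dom hc hx
    exact ⟨x', (h.mem hx' hc).1 hx, hx'⟩
  · rintro ⟨x', hx', hE⟩
    exact (h.mem hE hc).2 hx'

/-- `U` is a normal fine measure on partial embeddings. -/
structure Good (K T : ZFSet.{u}) (U : Ultrafilter ZFSet.{u}) : Prop where
  emb : ∀ᶠ e in (U : Filter ZFSet.{u}), Emb K T e
  fine : ∀ z ∈ T, ∀ᶠ e in (U : Filter ZFSet.{u}), ∃ a, EE e a z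
  fix : ∀ x ∈ K, ∀ᶠ e in (U : Filter ZFSet.{u}), EE e x x
  normal : ∀ F : ZFSet.{u} → ZFSet.{u}, (∀ᶠ e in (U : Filter ZFSet.{u}), ∃ z, EE e (F e) z) →
    ∃ z ∈ T, ∀ᶠ e in (U : Filter ZFSet.{u}), EE e (F e) z

theorem Good.ex {K T : ZFSet.{u}} {U : Ultrafilter ZFSet.{u}} (h : Good K T U)
    {Q : ZFSet.{u} → ZFSet.{u} → ZFSet.{u} → Prop}
    (hQ : ∀ᶠ e in (U : Filter ZFSet.{u}), ∃ a z, EE e a z ∧ Q e a z) :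
    ∃ z ∈ T, ∀ᶠ e in (U : Filter ZFSet.{u}), ∃ a, EE e a z ∧ Q e a z := by
  classical
  let F : ZFSet.{u} → ZFSet.{u} := fun e =>
    if H : ∃ a z, EE e a z ∧ Q e a z then H.choose else ∅
  have hF : ∀ᶠ e in (U : Filter ZFSet.{u}), ∃ z, EE e (F e) z ∧ Q e (F e) z := by
    filter_upwards [hQ] with e he
    simp only [F, dif_pos he]
    exact he.choose_spec
  obtain ⟨z, hz, hE⟩ := h.normal F (hF.mono fun e ⟨z, hz, _⟩ => ⟨z, hz⟩)
  refine ⟨z, hz, ?_⟩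
  filter_upwards [hF, hE, h.emb] with e ⟨z', h1, h2⟩ h3 h4
  have : z' = z := h4.fn h1 h3
  subst this
  exact ⟨_, h1, h2⟩

theorem Good.unif {K T : ZFSet.{u}} {U : Ultrafilter ZFSet.{u}} (h : Good K T U)
    {Q : ZFSet.{u} → ZFSet.{u} → ZFSet.{u} → Prop}
    (hQ : ∀ z ∈ T, ∀ᶠ e in (U : Filter ZFSet.{u}), ∀ a, EE e a z → Q e a z) :
    ∀ᶠ e in (U : Filter ZFSet.{u}), ∀ a z, EE e a z → Q e a z := by
  by_contra hc
  rw [← Ultrafilter.eventually_not] at hc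
  obtain ⟨z, hz, hE⟩ := h.ex (Q := fun e a z => ¬ Q e a z) (by
    filter_upwards [hc] with e he
    push Not at he
    exact he)
  obtain ⟨e, h1, a, h2, h3⟩ := ((hQ z hz).and hE).exists
  exact h3 (h1 a h2)

theorem Good.unif2 {K T : ZFSet.{u}} {U : Ultrafilter ZFSet.{u}} (h : Good K T U)
    {Q : ZFSet.{u} → ZFSet.{u} → ZFSet.{u} → ZFSet.{u} → ZFSet.{u} → Prop}
    (hQ : ∀ z ∈ T, ∀ w ∈ T, ∀ᶠ e in (U : Filter ZFSet.{u}), ∀ a b, EE e a z → EE e b w → Q e a z b w) :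
    ∀ᶠ e in (U : Filter ZFSet.{u}), ∀ a z, EE e a z → ∀ b w, EE e b w → Q e a z b w := by
  apply h.unif (Q := fun e a z => ∀ b w, EE e b w → Q e a z b w)
  intro z hz
  have := h.unif (Q := fun e b w => ∀ a, EE e a z → Q e a z b w) (by
    intro w hw
    filter_upwards [hQ z hz w hw] with e he b hb a ha
    exact he a b ha hb)
  filter_upwards [this] with e he a ha b w hb
  exact he b w hb a ha

/-- Transfinite levels: closure properties of `V_ζ`, `ζ` limit. -/
structure Lim (T : ZFSet.{u}) : Prop where
  trans : T.IsTransitive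
  rk : ∀ {z x : ZFSet.{u}}, z ∈ T → x.rank ≤ z.rank → x ∈ T
  upair : ∀ {z w : ZFSet.{u}}, z ∈ T → w ∈ T → ({z, w} : ZFSet.{u}) ∈ T
  pow : ∀ {z : ZFSet.{u}}, z ∈ T → ZFSet.powerset z ∈ T

theorem Lim.sub {T z x : ZFSet.{u}} (h : Lim T) (hz : z ∈ T) (hx : x ⊆ z) : x ∈ T :=
  h.rk hz (rank_mono hx)

theorem Lim.pair {T z w : ZFSet.{u}} (h : Lim T) (hz : z ∈ T) (hw : w ∈ T) :
    ZFSet.pair z w ∈ T := by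
  have h1 : ({z} : ZFSet.{u}) ∈ T := by
    have := h.upair hz hz
    rwa [ZFSet.pair_eq_singleton] at this
  exact h.upair h1 (h.upair hz hw)

theorem Lim.union {T z w : ZFSet.{u}} (h : Lim T) (hz : z ∈ T) (hw : w ∈ T) :
    z ∪ w ∈ T := by
  rcases le_total z.rank w.rank with h1 | h1
  · exact h.rk hw (by rw [rank_union]; exact max_le h1 le_rfl)
  · exact h.rk hz (by rw [rank_union]; exact max_le le_rfl h1)

theorem Lim.prod {T z w : ZFSet.{u}} (h : Lim T) (hz : z ∈ T) (hw : w ∈ T) :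
    ZFSet.prod z w ∈ T := by
  have : ZFSet.powerset (ZFSet.powerset (z ∪ w)) ∈ T := h.pow (h.pow (h.union hz hw))
  apply h.sub this
  intro p hp
  unfold ZFSet.prod ZFSet.pairSep at hp
  exact (ZFSet.mem_sep.1 hp).1

theorem Lim.V {T z : ZFSet.{u}} (h : Lim T) (hz : z ∈ T) : V_ (z.rank) ∈ T :=
  h.rk hz (by rw [rank_vonNeumann])

theorem lim_vonNeumann (o : Ordinal.{u}) (ho : Order.IsSuccLimit o) : Lim (V_ o) where
  trans := isTransitive_vonNeumann o
  rk := by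
    intro z x hz hx
    rw [mem_vonNeumann] at *
    exact hx.trans_lt hz
  upair := by
    intro z w hz hw
    rw [mem_vonNeumann] at *
    rw [rank_pair]
    simp only [Order.succ_eq_add_one]
    have := ho.succ_lt hz
    have := ho.succ_lt hw
    simp_all
  pow := by
    intro z hz
    rw [mem_vonNeumann] at *
    rw [rank_powerset]
    exact ho.succ_lt hz

variable {K T : ZFSet.{u}} {U : Ultrafilter ZFSet.{u}}

/-- Representation of subsets. -/
theorem Good.rep (h : Good K T U) (hT : Lim T) {y : ZFSet.{u}} (hy : y ∈ T) (x : ZFSet.{u} → ZFSet.{u})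
    (hx : ∀ᶠ e in (U : Filter ZFSet.{u}), ∀ b ∈ x e, ∃ z ∈ y, EE e b z) :
    ∃ X, X ⊆ y ∧ ∀ᶠ e in (U : Filter ZFSet.{u}), EE e (x e) X := by
  let X := ZFSet.sep (fun z => ∀ᶠ e in (U : Filter ZFSet.{u}), ∃ b, EE e b z ∧ b ∈ x e) y
  have hX : X ⊆ y := fun z hz => (ZFSet.mem_sep.1 hz).1
  refine ⟨X, hX, ?_⟩
  have key := h.unif (Q := fun e b z => z ∈ y → (z ∈ X ↔ b ∈ x e)) (by
    intro z hz
    by_cases hzy : z ∈ y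
    swap
    · exact Eventually.of_forall fun e a _ h => absurd h hzy
    by_cases hzX : z ∈ X
    · filter_upwards [(ZFSet.mem_sep.1 hzX).2, h.emb] with e ⟨b, hb, hb'⟩ he a ha _
      rw [he.inj ha hb]
      simp [hzX, hb']
    · have : ¬ ∀ᶠ e in (U : Filter ZFSet.{u}), ∃ b, EE e b z ∧ b ∈ x e :=
        fun hh => hzX (ZFSet.mem_sep.2 ⟨hzy, hh⟩)
      rw [← Ultrafilter.eventually_not] at this
      filter_upwards [this] with e he a ha _
      simp only [hzX, false_iff]
      exact fun hh => he ⟨a, ha, hh⟩)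
  filter_upwards [key, h.fine X (hT.sub hy hX), h.emb, hx] with e h1 ⟨c, hc⟩ h3 h4
  have : c = x e := by
    ext b
    rw [h3.mem_iff hc]
    constructor
    · rintro ⟨z, hz, hb⟩
      exact (h1 b z hb (hX hz)).1 hz
    · intro hb
      obtain ⟨z, hz, hbz⟩ := h4 b hb
      exact ⟨z, (h1 b z hbz hz).2 hb, hbz⟩
  rwa [← this]

/-- Almost sure properties of embeddings. -/
structure Nice (K T e : ZFSet.{u}) : Prop where
  emb : Emb K T e
  upair : ∀ {a b z w}, EE e a z → EE e b w → EE e {a, b} {z, w}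
  pair : ∀ {a b z w}, EE e a z → EE e b w → EE e (ZFSet.pair a b) (ZFSet.pair z w)
  sub : ∀ {a x z}, EE e a z → x ⊆ a → ∃ X, EE e x X
  inter : ∀ {a b z w}, EE e a z → EE e b w → EE e (a ∩ b) (z ∩ w)
  diff : ∀ {a b z w}, EE e a z → EE e b w → EE e (a \ b) (z \ w)
  sub_iff : ∀ {a b z w}, EE e a z → EE e b w → (a ⊆ b ↔ z ⊆ w)
  pair_inv : ∀ {x z w}, EE e x (ZFSet.pair z w) → ∃ a b, EE e a z ∧ EE e b w ∧ x = ZFSet.pair a b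
  fixK : ∀ {x w}, EE e x w → w ∈ K → x = w
  prod : ∀ {a b z w}, EE e a z → EE e b w → EE e (ZFSet.prod a b) (ZFSet.prod z w)
  pow : ∀ {a z}, EE e a z → EE e (ZFSet.powerset a) (ZFSet.powerset z)
  V : ∀ {a z}, EE e a z → EE e (V_ a.rank) (V_ z.rank)

theorem mem_V_rank_iff {x a : ZFSet.{u}} : x ∈ V_ a.rank ↔ ∃ a' ∈ a, x ⊆ V_ a'.rank := by
  rw [mem_vonNeumann, lt_rank_iff]
  simp only [subset_vonNeumann]

theorem Good.nice (h : Good K T U) (hT : Lim T) :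
    ∀ᶠ e in (U : Filter ZFSet.{u}), Nice K T e := by
  have UP := h.unif2 (Q := fun e a z b w => EE e {a, b} {z, w}) (by
    intro z hz w hw
    filter_upwards [h.emb, h.fine _ (hT.upair hz hw)] with e he ⟨c, hc⟩ a b ha hb
    have : c = {a, b} := by
      ext x
      rw [he.mem_iff hc]
      constructor
      · rintro ⟨x', hx', hE⟩
        rw [ZFSet.mem_pair] at hx' ⊢
        rcases hx' with rfl | rfl
        · exact Or.inl (he.inj hE ha)
        · exact Or.inr (he.inj hE hb)
      · intro hx
        rw [ZFSet.mem_pair] at hx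
        rcases hx with rfl | rfl
        · exact ⟨z, by simp, ha⟩
        · exact ⟨w, by simp, hb⟩
    rwa [this] at hc)
  have P : ∀ᶠ e in (U : Filter ZFSet.{u}), ∀ a z, EE e a z → ∀ b w, EE e b w →
      EE e (ZFSet.pair a b) (ZFSet.pair z w) := by
    filter_upwards [UP] with e he a z ha b w hb
    have h1 := he _ _ ha _ _ ha
    rw [ZFSet.pair_eq_singleton, ZFSet.pair_eq_singleton] at h1
    exact he _ _ h1 _ _ (he _ _ ha _ _ hb)
  have SB := h.unif (Q := fun e a z => ∀ x, x ⊆ a → ∃ X, EE e x X) (by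
    intro y hy
    by_contra hc
    rw [← Ultrafilter.eventually_not] at hc
    classical
    let x : ZFSet.{u} → ZFSet.{u} := fun e =>
      if H : ∃ x a, EE e a y ∧ x ⊆ a ∧ ∀ X, ¬ EE e x X then H.choose else ∅
    have hx : ∀ᶠ e in (U : Filter ZFSet.{u}), ∃ a, EE e a y ∧ x e ⊆ a ∧ ∀ X, ¬ EE e (x e) X := by
      filter_upwards [hc] with e he
      have H : ∃ x a, EE e a y ∧ x ⊆ a ∧ ∀ X, ¬ EE e x X := by
        push Not at he
        obtain ⟨a, h1, x, h2, h3⟩ := he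
        exact ⟨x, a, h1, h2, h3⟩
      simp only [x, dif_pos H]
      exact H.choose_spec
    obtain ⟨X, _, hX⟩ := h.rep hT hy x (by
      filter_upwards [hx, h.emb] with e ⟨a, ha, hxa, _⟩ he b hb
      exact (he.mem_iff ha).1 (hxa hb))
    obtain ⟨e, ⟨a, _, _, h1⟩, h2⟩ := (hx.and hX).exists
    exact h1 _ h2)
  have IN := h.unif2 (Q := fun e a z b w => EE e (a ∩ b) (z ∩ w)) (by
    intro z hz w hw
    have : z ∩ w ∈ T := hT.sub hz (fun x hx => (ZFSet.mem_inter.1 hx).1)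
    filter_upwards [h.emb, h.fine _ this] with e he ⟨c, hc⟩ a b ha hb
    have : c = a ∩ b := by
      ext x
      rw [he.mem_iff hc, ZFSet.mem_inter, he.mem_iff ha, he.mem_iff hb]
      constructor
      · rintro ⟨x', hx', hE⟩
        rw [ZFSet.mem_inter] at hx'
        exact ⟨⟨x', hx'.1, hE⟩, ⟨x', hx'.2, hE⟩⟩
      · rintro ⟨⟨x', hx', hE⟩, ⟨x'', hx'', hE'⟩⟩
        have := he.fn hE hE'
        subst this
        exact ⟨x', ZFSet.mem_inter.2 ⟨hx', hx''⟩, hE⟩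
    rwa [this] at hc)
  have DF := h.unif2 (Q := fun e a z b w => EE e (a \ b) (z \ w)) (by
    intro z hz w hw
    have : z \ w ∈ T := hT.sub hz (fun x hx => (ZFSet.mem_sdiff.1 hx).1)
    filter_upwards [h.emb, h.fine _ this] with e he ⟨c, hc⟩ a b ha hb
    have : c = a \ b := by
      ext x
      rw [he.mem_iff hc, ZFSet.mem_sdiff, he.mem_iff ha, he.mem_iff hb]
      constructor
      · rintro ⟨x', hx', hE⟩
        rw [ZFSet.mem_sdiff] at hx'
        refine ⟨⟨x', hx'.1, hE⟩, ?_⟩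
        rintro ⟨x'', hx'', hE'⟩
        have := he.fn hE hE'
        subst this
        exact hx'.2 hx''
      · rintro ⟨⟨x', hx', hE⟩, hn⟩
        exact ⟨x', ZFSet.mem_sdiff.2 ⟨hx', fun hh => hn ⟨x', hh, hE⟩⟩, hE⟩
    rwa [this] at hc)
  have SI := h.unif2 (Q := fun e a z b w => (a ⊆ b ↔ z ⊆ w)) (by
    intro z hz w hw
    by_cases hzw : z ⊆ w
    · filter_upwards [h.emb] with e he a b ha hb
      simp only [hzw, iff_true]
      intro x hx
      rw [he.mem_iff ha] at hx
      obtain ⟨x', hx', hE⟩ := hx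
      exact (he.mem_iff hb).2 ⟨x', hzw hx', hE⟩
    · have : ∃ v ∈ z, v ∉ w := by
        by_contra hcon
        push Not at hcon
        exact hzw fun v hv => hcon v hv
      obtain ⟨v, hv, hvw⟩ := this
      filter_upwards [h.emb, h.fine v (hT.trans _ hz hv)] with e he ⟨c, hc⟩ a b ha hb
      simp only [hzw, iff_false]
      intro hab
      exact hvw ((he.mem hc hb).1 (hab ((he.mem hc ha).2 hv))))
  have PI := h.unif (Q := fun e x Z => ∀ z w, Z = ZFSet.pair z w →
      ∃ a b, EE e a z ∧ EE e b w ∧ x = ZFSet.pair a b) (by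
    intro Z hZ
    by_cases hp : ∃ z w, Z = ZFSet.pair z w
    · obtain ⟨z, w, rfl⟩ := hp
      have hzw : ({z, w} : ZFSet.{u}) ∈ T := hT.trans _ hZ (by simp [ZFSet.pair])
      have hz : z ∈ T := hT.trans _ hzw (by simp)
      have hw : w ∈ T := hT.trans _ hzw (by simp)
      filter_upwards [h.emb, h.fine z hz, h.fine w hw, P] with e he ⟨a, ha⟩ ⟨b, hb⟩ hP x hx z' w' hzw'
      rw [ZFSet.pair_inj] at hzw'
      obtain ⟨rfl, rfl⟩ := hzw'
      exact ⟨a, b, ha, hb, he.inj hx (hP _ _ ha _ _ hb)⟩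
    · exact Eventually.of_forall fun e x hx z w hh => absurd ⟨z, w, hh⟩ hp)
  have FK := h.unif (Q := fun e x w => w ∈ K → x = w) (by
    intro w hw
    by_cases hwK : w ∈ K
    · filter_upwards [h.emb, h.fix w hwK] with e he hf a ha _
      exact he.inj ha hf
    · exact Eventually.of_forall fun e x hx hh => absurd hh hwK)
  have PR := h.unif2 (Q := fun e a z b w => EE e (ZFSet.prod a b) (ZFSet.prod z w)) (by
    intro z hz w hw
    filter_upwards [h.emb, h.fine _ (hT.prod hz hw), P, PI] with e he ⟨c, hc⟩ hP hPI a b ha hb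
    have : c = ZFSet.prod a b := by
      ext x
      rw [he.mem_iff hc, ZFSet.mem_prod]
      constructor
      · rintro ⟨x', hx', hE⟩
        rw [ZFSet.mem_prod] at hx'
        obtain ⟨z', hz', w', hw', rfl⟩ := hx'
        obtain ⟨a', b', ha', hb', rfl⟩ := hPI _ _ hE _ _ rfl
        exact ⟨a', (he.mem ha' ha).2 hz', b', (he.mem hb' hb).2 hw', rfl⟩
      · rintro ⟨a', ha', b', hb', rfl⟩
        obtain ⟨z', hz', hE⟩ := (he.mem_iff ha).1 ha'
        obtain ⟨w', hw', hE'⟩ := (he.mem_iff hb).1 hb'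
        exact ⟨_, ZFSet.pair_mem_prod.2 ⟨hz', hw'⟩, hP _ _ hE _ _ hE'⟩
    rwa [this] at hc)
  have PW := h.unif (Q := fun e a z => EE e (ZFSet.powerset a) (ZFSet.powerset z)) (by
    intro z hz
    filter_upwards [h.emb, h.fine _ (hT.pow hz), SB, SI] with e he ⟨c, hc⟩ hSB hSI a ha
    have : c = ZFSet.powerset a := by
      ext x
      rw [he.mem_iff hc, ZFSet.mem_powerset]
      constructor
      · rintro ⟨x', hx', hE⟩
        exact (hSI _ _ hE _ _ ha).2 (ZFSet.mem_powerset.1 hx')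
      · intro hx
        obtain ⟨X, hX⟩ := hSB _ _ ha x hx
        exact ⟨X, ZFSet.mem_powerset.2 ((hSI _ _ hX _ _ ha).1 hx), hX⟩
    rwa [this] at hc)
  have VV' : ∀ z : ZFSet.{u}, z ∈ T → ∀ᶠ e in (U : Filter ZFSet.{u}), ∀ a, EE e a z →
      EE e (V_ a.rank) (V_ z.rank) := by
    intro z
    induction z using ZFSet.inductionOn with
    | _ z ih =>
    intro hz
    have IH := h.unif (Q := fun e a' z' => z' ∈ z → EE e (V_ a'.rank) (V_ z'.rank)) (by
      intro z' hz'
      by_cases hzz : z' ∈ z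
      · filter_upwards [ih z' hzz hz'] with e he a ha _
        exact he a ha
      · exact Eventually.of_forall fun e x hx hh => absurd hh hzz)
    have PRE := h.unif (Q := fun e x X => X ∈ V_ z.rank → ∃ z' ∈ z, X ⊆ V_ z'.rank ∧ ∃ a', EE e a' z') (by
      intro X _
      by_cases hXV : X ∈ V_ z.rank
      · obtain ⟨z', hz', hXz⟩ := mem_V_rank_iff.1 hXV
        filter_upwards [h.fine z' (hT.trans _ hz hz')] with e he a ha _
        exact ⟨z', hz', hXz, he⟩
      · exact Eventually.of_forall fun e x hx hh => absurd hh hXV)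
    filter_upwards [h.emb, h.fine _ (hT.V hz), SB, SI, IH, PRE] with e he ⟨c, hc⟩ hSB hSI hIH hPRE a ha
    have : c = V_ a.rank := by
      ext x
      rw [he.mem_iff hc, mem_V_rank_iff]
      constructor
      · rintro ⟨X, hX, hE⟩
        obtain ⟨z', hz', hXz, hPX⟩ := hPRE _ _ hE hX
        obtain ⟨a'', ha''⟩ := hPX
        exact ⟨a'', (he.mem ha'' ha).2 hz', (hSI _ _ hE _ _ (hIH _ _ ha'' hz')).2 hXz⟩
      · rintro ⟨a', ha', hx⟩
        obtain ⟨z', hz', hE⟩ := (he.mem_iff ha).1 ha'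
        have hV := hIH _ _ hE hz'
        obtain ⟨X, hX⟩ := hSB _ _ hV x hx
        exact ⟨X, mem_V_rank_iff.2 ⟨z', hz', (hSI _ _ hX _ _ hV).1 hx⟩, hX⟩
    rwa [this] at hc
  have VV := h.unif (Q := fun e a z => EE e (V_ a.rank) (V_ z.rank)) VV'
  filter_upwards [h.emb, UP, P, SB, IN, DF, SI, PI, FK, PR, PW, VV] with e h1 h2 h3 h4 h5 h6 h7 h8 h9 h10 h11 h12
  exact ⟨h1, fun ha hb => h2 _ _ ha _ _ hb, fun ha hb => h3 _ _ ha _ _ hb, fun ha hx => h4 _ _ ha _ hx,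
    fun ha hb => h5 _ _ ha _ _ hb, fun ha hb => h6 _ _ ha _ _ hb, fun ha hb => h7 _ _ ha _ _ hb,
    fun ha => h8 _ _ ha _ _ rfl, fun ha => h9 _ _ ha, fun ha hb => h10 _ _ ha _ _ hb,
    fun ha => h11 _ _ ha, fun ha => h12 _ _ ha⟩

end HelpB

section HelpC
universe u
open ZFSet Filter
open scoped ZFSet

variable {K T : ZFSet.{u}} {U : Ultrafilter ZFSet.{u}}

/-- A good measure exists. -/
def PP (α v : ZFSet.{u}) : Prop := ∃ U, Good (V_ α.rank) v U

/-- A good measure concentrating on `R` exists. -/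
def Nf (κ s y : ZFSet.{u}) (R : ZFSet.{u} → ZFSet.{u} → Prop) : Prop :=
  ∃ U : Ultrafilter ZFSet.{u}, Good (V_ κ.rank) s U ∧
    ∀ᶠ d in (U : Filter ZFSet.{u}), ∃ a b, EE d a κ ∧ EE d b y ∧ R a b

/-- Restriction of an embedding. -/
noncomputable def restr (K s e : ZFSet.{u}) : ZFSet.{u} := ZFSet.sep (fun p => p ∈ e) (ZFSet.prod K s)

theorem EE_restr {K s e a z : ZFSet.{u}} : EE (restr K s e) a z ↔ (a ∈ K ∧ z ∈ s) ∧ EE e a z := by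
  unfold EE restr
  rw [ZFSet.mem_sep, ZFSet.pair_mem_prod]

theorem Good.proj (h : Good K T U) {s : ZFSet.{u}} (hs : s.IsTransitive) (hsT : s ⊆ T) (hK : K ⊆ s) :
    Good K s (U.map (restr K s)) := by
  constructor
  · rw [Ultrafilter.coe_map, eventually_map]
    filter_upwards [h.emb] with e he
    constructor
    · intro p hp
      unfold restr at hp
      rw [ZFSet.mem_sep, ZFSet.mem_prod] at hp
      exact hp.1
    · intro a z z' h1 h2
      exact he.fn (EE_restr.1 h1).2 (EE_restr.1 h2).2
    · intro a z z' h1 h2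
      exact he.inj (EE_restr.1 h1).2 (EE_restr.1 h2).2
    · intro a a' z z' h1 h2
      exact he.mem (EE_restr.1 h1).2 (EE_restr.1 h2).2
    · intro a a' z h1 h2
      have h3 := EE_restr.1 h1
      obtain ⟨z', hz'⟩ := he.dom h3.2 h2
      exact ⟨z', EE_restr.2 ⟨⟨he.left hz', hs _ h3.1.2 ((he.mem hz' h3.2).1 h2)⟩, hz'⟩⟩
  · intro z hz
    rw [Ultrafilter.coe_map, eventually_map]
    filter_upwards [h.emb, h.fine z (hsT hz)] with e he ⟨a, ha⟩
    exact ⟨a, EE_restr.2 ⟨⟨he.left ha, hz⟩, ha⟩⟩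
  · intro x hx
    rw [Ultrafilter.coe_map, eventually_map]
    filter_upwards [h.fix x hx] with e he
    exact EE_restr.2 ⟨⟨hx, hK hx⟩, he⟩
  · intro F hF
    rw [Ultrafilter.coe_map, eventually_map] at hF
    obtain ⟨z, hz, hE⟩ := h.normal (fun e => F (restr K s e)) (hF.mono fun e ⟨z, hz⟩ =>
      ⟨z, (EE_restr.1 hz).2⟩)
    have : ∀ᶠ e in (U : Filter ZFSet.{u}), EE (restr K s e) (F (restr K s e)) z := by
      filter_upwards [h.emb, hF, hE] with e he ⟨z', hz'⟩ hE
      have := he.fn (EE_restr.1 hz').2 hE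
      rwa [this] at hz'
    refine ⟨z, ?_, by rwa [Ultrafilter.coe_map, eventually_map]⟩
    obtain ⟨e, he⟩ := this.exists
    exact (EE_restr.1 he).1.2

theorem PP.proj {α v s : ZFSet.{u}} (h : PP α v) (hs : s.IsTransitive) (hsv : s ⊆ v)
    (hα : V_ α.rank ∈ s) : PP α s := by
  obtain ⟨U, hU⟩ := h
  exact ⟨_, hU.proj hs hsv (fun x hx => hs _ hα hx)⟩

theorem Nf.proj' {α v s y : ZFSet.{u}} {R} (U : Ultrafilter ZFSet.{u}) (hU : Good (V_ α.rank) v U)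
    (hR : ∀ᶠ d in (U : Filter ZFSet.{u}), ∃ a b, EE d a α ∧ EE d b y ∧ R a b)
    (hs : s.IsTransitive) (hsv : s ⊆ v)
    (hV : V_ α.rank ∈ s) (hα : α ∈ s) (hy : y ∈ s) : Nf α s y R := by
  refine ⟨_, hU.proj hs hsv (fun x hx => hs _ hV hx), ?_⟩
  rw [Ultrafilter.coe_map, eventually_map]
  filter_upwards [hR, hU.emb] with d ⟨a, b, h1, h2, h3⟩ he
  exact ⟨a, b, EE_restr.2 ⟨⟨he.left h1, hα⟩, h1⟩, EE_restr.2 ⟨⟨he.left h2, hy⟩, h2⟩, h3⟩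

theorem Nf.proj {α v s y : ZFSet.{u}} {R} (h : Nf α v y R) (hs : s.IsTransitive) (hsv : s ⊆ v)
    (hV : V_ α.rank ∈ s) (hα : α ∈ s) (hy : y ∈ s) : Nf α s y R := by
  obtain ⟨U, hU, hR⟩ := h
  exact Nf.proj' U hU hR hs hsv hV hα hy

/-- Composition. -/
noncomputable def comp (K s e d : ZFSet.{u}) : ZFSet.{u} :=
  ZFSet.sep (fun p => ∃ x z w, p = ZFSet.pair x w ∧ EE d x z ∧ EE e z w) (ZFSet.prod K s)

theorem EE_comp {K s e d x w : ZFSet.{u}} :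
    EE (comp K s e d) x w ↔ (x ∈ K ∧ w ∈ s) ∧ ∃ z, EE d x z ∧ EE e z w := by
  unfold EE comp
  rw [ZFSet.mem_sep, ZFSet.pair_mem_prod]
  refine and_congr_right fun _ => ?_
  constructor
  · rintro ⟨x', z, w', hp, h1, h2⟩
    rw [ZFSet.pair_inj] at hp
    obtain ⟨rfl, rfl⟩ := hp
    exact ⟨z, h1, h2⟩
  · rintro ⟨z, h1, h2⟩
    exact ⟨x, z, w, rfl, h1, h2⟩

theorem refl_back {κ s y : ZFSet.{u}} {R} {W : Ultrafilter ZFSet.{u}} (hW : Good (V_ κ.rank) T W)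
    (hT : Lim T) (hsT : s ∈ T) (hκs : κ ∈ s) (hys : y ∈ s) (hKs : V_ κ.rank ⊆ s)
    (h : ∀ᶠ e in (W : Filter ZFSet.{u}), ∃ k S b, EE e k κ ∧ EE e S s ∧ EE e b y ∧ Nf k S b R) :
    Nf κ s y R := by
  classical
  let Pe : ZFSet.{u} → Ultrafilter ZFSet.{u} → Prop := fun e u =>
    ∃ k S b, EE e k κ ∧ EE e S s ∧ EE e b y ∧ Good (V_ k.rank) S u ∧
      ∀ᶠ d in (u : Filter ZFSet.{u}), ∃ a b', EE d a k ∧ EE d b' b ∧ R a b'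
  let Uf : ZFSet.{u} → Ultrafilter ZFSet.{u} := fun e => if H : ∃ u, Pe e u then H.choose else pure ∅
  have hUf : ∀ᶠ e in (W : Filter ZFSet.{u}), Pe e (Uf e) := by
    filter_upwards [h] with e ⟨k, S, b, h1, h2, h3, u, h4, h5⟩
    have H : ∃ u, Pe e u := ⟨u, k, S, b, h1, h2, h3, h4, h5⟩
    simp only [Uf, dif_pos H]
    exact H.choose_spec
  have hκT : κ ∈ T := hT.trans _ hsT hκs
  set K := V_ κ.rank with hK
  have hKt : K.IsTransitive := isTransitive_vonNeumann _
  -- main almost sure facts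
  have main : ∀ᶠ e in (W : Filter ZFSet.{u}), Nice K T e ∧
      ∃ k S b, EE e k κ ∧ EE e S s ∧ EE e b y ∧ Good (V_ k.rank) S (Uf e) ∧
      (∀ᶠ d in (Uf e : Filter ZFSet.{u}), ∃ a b', EE d a k ∧ EE d b' b ∧ R a b') ∧
      (∀ᶠ d in (Uf e : Filter ZFSet.{u}), ∀ x z w, EE d x z → EE e z w → EE (comp K s e d) x w) ∧
      (∀ z ∈ S, ∃ w, EE e z w) ∧ EE e (V_ k.rank) K := by
    filter_upwards [hUf, hW.nice hT] with e ⟨k, S, b, h1, h2, h3, h4, h5⟩ hn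
    have hVk : EE e (V_ k.rank) K := hn.V h1
    refine ⟨hn, k, S, b, h1, h2, h3, h4, h5, ?_, ?_, hVk⟩
    · filter_upwards [h4.emb] with d hd x z w hxz hzw
      rw [EE_comp]
      refine ⟨⟨?_, ?_⟩, z, hxz, hzw⟩
      · exact hKt _ (hn.emb.left hVk) (hd.left hxz)
      · exact (hn.emb.mem hzw h2).1 (hd.right hxz)
    · intro z hz
      exact hn.emb.dom h2 hz
  let U := W.bind fun e => (Uf e).map (comp K s e)
  have hU : ∀ p : ZFSet.{u} → Prop, (∀ᶠ d in (U : Filter ZFSet.{u}), p d) ↔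
      ∀ᶠ e in (W : Filter ZFSet.{u}), ∀ᶠ d in (Uf e : Filter ZFSet.{u}), p (comp K s e d) := by
    intro p
    exact Iff.rfl
  refine ⟨U, ⟨?_, ?_, ?_, ?_⟩, ?_⟩
  · rw [hU]
    filter_upwards [main] with e ⟨hn, k, S, b, h1, h2, h3, h4, h5, h6, h7, h8⟩
    filter_upwards [h4.emb, h6] with d hd h6
    constructor
    · intro p hp
      unfold comp at hp
      rw [ZFSet.mem_sep, ZFSet.mem_prod] at hp
      exact hp.1
    · intro a z z' ha hb
      obtain ⟨_, v, h9, h10⟩ := EE_comp.1 ha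
      obtain ⟨_, v', h9', h10'⟩ := EE_comp.1 hb
      have := hd.fn h9 h9'
      subst this
      exact hn.emb.fn h10 h10'
    · intro a z z' ha hb
      obtain ⟨_, v, h9, h10⟩ := EE_comp.1 ha
      obtain ⟨_, v', h9', h10'⟩ := EE_comp.1 hb
      have := hn.emb.inj h10 h10'
      subst this
      exact hd.inj h9 h9'
    · intro a a' z z' ha hb
      obtain ⟨_, v, h9, h10⟩ := EE_comp.1 ha
      obtain ⟨_, v', h9', h10'⟩ := EE_comp.1 hb
      rw [hd.mem h9 h9', hn.emb.mem h10 h10']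
    · intro a a' z ha hb
      obtain ⟨_, v, h9, h10⟩ := EE_comp.1 ha
      obtain ⟨v', hv'⟩ := hd.dom h9 hb
      obtain ⟨w', hw'⟩ := h7 v' (hd.right hv')
      exact ⟨w', h6 _ _ _ hv' hw'⟩
  · intro w hw
    rw [hU]
    filter_upwards [main, hW.fine w (hT.trans _ hsT hw)] with e ⟨hn, k, S, b, h1, h2, h3, h4, h5, h6, h7, h8⟩ ⟨z, hz⟩
    filter_upwards [h4.fine z ((hn.emb.mem hz h2).2 hw), h6] with d ⟨x, hx⟩ h6
    exact ⟨x, h6 _ _ _ hx hz⟩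
  · intro x hx
    rw [hU]
    filter_upwards [main, hW.fix x hx] with e ⟨hn, k, S, b, h1, h2, h3, h4, h5, h6, h7, h8⟩ hxx
    filter_upwards [h4.fix x ((hn.emb.mem hxx h8).2 hx), h6] with d hd h6
    exact h6 _ _ _ hd hxx
  · intro F hF
    rw [hU] at hF
    have step : ∀ᶠ e in (W : Filter ZFSet.{u}), ∃ z w, EE e z w ∧ (w ∈ s ∧
        ∀ᶠ d in (Uf e : Filter ZFSet.{u}), EE (comp K s e d) (F (comp K s e d)) w) := by
      filter_upwards [main, hF] with e ⟨hn, k, S, b, h1, h2, h3, h4, h5, h6, h7, h8⟩ hF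
      obtain ⟨z, hz, hE⟩ := h4.normal (fun d => F (comp K s e d)) (by
        filter_upwards [hF] with d ⟨w, hw⟩
        obtain ⟨_, v, h9, h10⟩ := EE_comp.1 hw
        exact ⟨v, h9⟩)
      obtain ⟨w, hw⟩ := h7 z hz
      refine ⟨z, w, hw, (hn.emb.mem hw h2).1 hz, ?_⟩
      filter_upwards [hE, h6] with d hd h6
      exact h6 _ _ _ hd hw
    obtain ⟨w, _, hE⟩ := hW.ex (Q := fun e z w => w ∈ s ∧
        ∀ᶠ d in (Uf e : Filter ZFSet.{u}), EE (comp K s e d) (F (comp K s e d)) w) step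
    refine ⟨w, ?_, ?_⟩
    · obtain ⟨e, z, _, h, _⟩ := hE.exists
      exact h
    · rw [hU]
      filter_upwards [hE] with e ⟨z, _, _, h⟩
      exact h
  · rw [hU]
    filter_upwards [main] with e ⟨hn, k, S, b, h1, h2, h3, h4, h5, h6, h7, h8⟩
    filter_upwards [h5, h6] with d ⟨a, b', ha, hb, hR⟩ h6
    exact ⟨a, b', h6 _ _ _ ha h1, h6 _ _ _ hb h3, hR⟩

end HelpC

section HelpD
universe u
open ZFSet Filter
open scoped ZFSet

variable {K T : ZFSet.{u}} {U : Ultrafilter ZFSet.{u}}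

/-- Pull back an ultrafilter along `e`. -/
theorem exists_pullback {e D0 D : ZFSet.{u}} (hn : Nice K T e) (hD : EE e D0 D)
    (hU : ∀ᶠ d in (U : Filter ZFSet.{u}), d ∈ D) :
    ∃ Ue : Ultrafilter ZFSet.{u}, (∀ᶠ d in (Ue : Filter ZFSet.{u}), d ∈ D0) ∧
      ∀ A B, EE e A B → (∀ᶠ d in (U : Filter ZFSet.{u}), d ∈ B) →
        ∀ᶠ d in (Ue : Filter ZFSet.{u}), d ∈ A := by
  let S : Set ZFSet.{u} → ZFSet.{u} := fun A => ZFSet.sep (fun d => d ∈ A) D0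
  have hS : ∀ A, S A ⊆ D0 := fun A x hx => (ZFSet.mem_sep.1 hx).1
  have hSB : ∀ A, ∃ B, EE e (S A) B := fun A => hn.sub hD (hS A)
  let F : Filter ZFSet.{u} :=
    { sets := {A | ∃ B, EE e (S A) B ∧ ∀ᶠ d in (U : Filter ZFSet.{u}), d ∈ B}
      univ_sets := by
        refine ⟨D, ?_, hU⟩
        have : S Set.univ = D0 := by
          ext x; simp [S]
        rwa [this]
      sets_of_superset := by
        rintro A A' ⟨B, hB, hUB⟩ hAA
        obtain ⟨B', hB'⟩ := hSB A'
        refine ⟨B', hB', ?_⟩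
        have : B ⊆ B' := (hn.sub_iff hB hB').1 (by
          intro x hx
          simp only [S, ZFSet.mem_sep] at hx ⊢
          exact ⟨hx.1, hAA hx.2⟩)
        exact hUB.mono fun d hd => this hd
      inter_sets := by
        rintro A A' ⟨B, hB, hUB⟩ ⟨B', hB', hUB'⟩
        refine ⟨B ∩ B', ?_, ?_⟩
        · have : S (A ∩ A') = S A ∩ S A' := by
            ext x; simp [S]; tauto
          rw [this]
          exact hn.inter hB hB'
        · filter_upwards [hUB, hUB'] with d h1 h2
          exact ZFSet.mem_inter.2 ⟨h1, h2⟩ }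
  have hcompl : ∀ A : Set ZFSet.{u}, Aᶜ ∉ F ↔ A ∈ F := by
    intro A
    obtain ⟨B, hB⟩ := hSB A
    have h1 : EE e (S Aᶜ) (D \ B) := by
      have : S Aᶜ = D0 \ S A := by
        ext x; simp [S]; tauto
      rw [this]
      exact hn.diff hD hB
    have h2 : A ∈ F ↔ ∀ᶠ d in (U : Filter ZFSet.{u}), d ∈ B := by
      constructor
      · rintro ⟨B', hB', h⟩
        rwa [hn.emb.fn hB hB']
      · intro h; exact ⟨B, hB, h⟩
    have h3 : Aᶜ ∈ F ↔ ∀ᶠ d in (U : Filter ZFSet.{u}), d ∈ D \ B := by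
      constructor
      · rintro ⟨B', hB', h⟩
        rwa [hn.emb.fn h1 hB']
      · intro h; exact ⟨_, h1, h⟩
    rw [h2, h3, ← Ultrafilter.eventually_not]
    constructor
    · intro h
      filter_upwards [h, hU] with d h h'
      by_contra hc
      exact h (ZFSet.mem_sdiff.2 ⟨h', hc⟩)
    · intro h
      filter_upwards [h] with d h h'
      exact (ZFSet.mem_sdiff.1 h').2 h
  have mono : ∀ A B, EE e A B → (∀ᶠ d in (U : Filter ZFSet.{u}), d ∈ B) → {d | d ∈ A} ∈ F := by
    intro A B hAB h
    refine ⟨D ∩ B, ?_, ?_⟩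
    · have : S {d | d ∈ A} = D0 ∩ A := by
        ext x; simp [S]
      rw [this]
      exact hn.inter hD hAB
    · filter_upwards [h, hU] with d h1 h2
      exact ZFSet.mem_inter.2 ⟨h2, h1⟩
  refine ⟨Ultrafilter.ofComplNotMemIff F hcompl, mono _ _ hD hU, mono⟩

theorem refl_fwd {κ s y : ZFSet.{u}} {R} {W : Ultrafilter ZFSet.{u}} (hW : Good (V_ κ.rank) T W)
    (hT : Lim T) (hsT : s ∈ T) (hκs : κ ∈ s) (hys : y ∈ s)
    (h : Nf κ s y R) :
    ∀ᶠ e in (W : Filter ZFSet.{u}), ∀ k S b, EE e k κ → EE e S s → EE e b y → Nf k S b R := by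
  classical
  obtain ⟨U, hU, hUR⟩ := h
  have hκT : κ ∈ T := hT.trans _ hsT hκs
  have hKT : V_ κ.rank ∈ T := hT.V hκT
  set K := V_ κ.rank with hK
  have hKt : K.IsTransitive := isTransitive_vonNeumann _
  set D := ZFSet.powerset (ZFSet.prod K s) with hDdef
  have hDT : D ∈ T := hT.pow (hT.prod hKT hsT)
  have hUD : ∀ᶠ d in (U : Filter ZFSet.{u}), d ∈ D := by
    filter_upwards [hU.emb] with d hd
    rw [ZFSet.mem_powerset]
    intro p hp
    rw [ZFSet.mem_prod]
    exact hd.sub p hp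
  have hDp : ∀ d' ∈ D, ∀ x w, ZFSet.pair x w ∈ d' → x ∈ K ∧ w ∈ s := by
    intro d' hd' x w hp
    exact ZFSet.pair_mem_prod.1 (ZFSet.mem_powerset.1 hd' hp)
  have hD'T : ∀ {d'}, d' ∈ D → d' ∈ T := fun h => hT.trans _ hDT h
  -- choose the ultrafilters
  let Ps : ZFSet.{u} → Ultrafilter ZFSet.{u} → Prop := fun e Ue =>
      (∀ D0, EE e D0 D → ∀ᶠ d in (Ue : Filter ZFSet.{u}), d ∈ D0) ∧
      ∀ A B, EE e A B → (∀ᶠ d in (U : Filter ZFSet.{u}), d ∈ B) →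
        ∀ᶠ d in (Ue : Filter ZFSet.{u}), d ∈ A
  let Uf : ZFSet.{u} → Ultrafilter ZFSet.{u} := fun e => if H : ∃ u, Ps e u then H.choose else pure ∅
  have hUf : ∀ᶠ e in (W : Filter ZFSet.{u}), Ps e (Uf e) := by
    filter_upwards [hW.nice hT, hW.fine D hDT] with e hn ⟨D0, hD0⟩
    have H : ∃ u, Ps e u := by
      obtain ⟨Ue, h1, h2⟩ := exists_pullback hn hD0 hUD
      exact ⟨Ue, fun D0' h' => by rwa [hn.emb.inj h' hD0], h2⟩
    simp only [Uf, dif_pos H]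
    exact H.choose_spec
  -- transfer lemma
  have TR : ∀ Q : ZFSet.{u} → Prop, (∀ᶠ d in (U : Filter ZFSet.{u}), Q d) →
      ∀ᶠ e in (W : Filter ZFSet.{u}), ∀ᶠ d in (Uf e : Filter ZFSet.{u}), ∃ d' ∈ D, EE e d d' ∧ Q d' := by
    intro Q hQ
    have hB : ZFSet.sep Q D ∈ T := hT.sub hDT (fun x hx => (ZFSet.mem_sep.1 hx).1)
    filter_upwards [hUf, hW.fine _ hB, hW.emb] with e ⟨h1, h2⟩ ⟨A, hA⟩ he
    have := h2 A _ hA (by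
      filter_upwards [hQ, hUD] with d h3 h4
      exact ZFSet.mem_sep.2 ⟨h4, h3⟩)
    filter_upwards [this] with d hd
    obtain ⟨d', hd', hE⟩ := (he.mem_iff hA).1 hd
    rw [ZFSet.mem_sep] at hd'
    exact ⟨d', hd'.1, hE, hd'.2⟩
  -- basic facts
  have main : ∀ᶠ e in (W : Filter ZFSet.{u}), Nice K T e ∧ ∃ k S b D0, EE e k κ ∧ EE e S s ∧ EE e b y ∧
      EE e D0 D ∧ D0 = ZFSet.powerset (ZFSet.prod (V_ k.rank) S) ∧ EE e (V_ k.rank) K ∧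
      (∀ᶠ d in (Uf e : Filter ZFSet.{u}), d ∈ D0) ∧
      (∀ d ∈ D0, ∀ x z, EE d x z → x ∈ V_ k.rank ∧ z ∈ S) ∧
      (∀ x ∈ V_ k.rank, EE e x x) ∧
      (∀ z ∈ S, ∃ w, EE e z w) ∧
      (∀ d d' x z w, EE e d d' → EE e x x → EE e z w → (EE d x z ↔ EE d' x w)) := by
    filter_upwards [hUf, hW.nice hT, hW.fine κ hκT, hW.fine s hsT, hW.fine y (hT.trans _ hsT hys)] with
      e ⟨h1, h2⟩ hn ⟨k, hk⟩ ⟨S, hS⟩ ⟨b, hb⟩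
    have hV := hn.V hk
    have hD0 : EE e (ZFSet.powerset (ZFSet.prod (V_ k.rank) S)) D := hn.pow (hn.prod hV hS)
    refine ⟨hn, k, S, b, _, hk, hS, hb, hD0, rfl, hV, h1 _ hD0, ?_, ?_, ?_, ?_⟩
    · intro d hd x z hxz
      exact ZFSet.pair_mem_prod.1 (ZFSet.mem_powerset.1 hd hxz)
    · intro x hx
      obtain ⟨w, hw, hE⟩ := (hn.emb.mem_iff hV).1 hx
      have := hn.fixK hE hw
      rwa [← this] at hE
    · intro z hz
      exact hn.emb.dom hS hz
    · intro d d' x z w hd hx hz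
      exact hn.emb.mem (hn.pair hx hz) hd
  have KD : K ⊆ T := fun x hx => hT.trans _ hKT hx
  -- the almost sure statements needed
  have cFine := hW.unif (Q := fun e z w => w ∈ s → ∀ᶠ d in (Uf e : Filter ZFSet.{u}), ∃ a, EE d a z) (by
    intro w hwT
    by_cases hw : w ∈ s
    swap
    · exact Eventually.of_forall fun e x hx hh => absurd hh hw
    have F1 := hW.unif (Q := fun e d d' => d' ∈ D → (∃ a, EE d' a w) → ∃ a, EE d' a w ∧ EE e a a) (by
      intro d' hd'
      by_cases hc : d' ∈ D ∧ ∃ a, EE d' a w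
      swap
      · exact Eventually.of_forall fun e x hx hh hh' => absurd ⟨hh, hh'⟩ hc
      obtain ⟨hc, a, ha⟩ := hc
      filter_upwards [hW.fix a (hDp d' hc _ _ ha).1] with e he d hd _ _
      exact ⟨a, ha, he⟩)
    filter_upwards [TR _ (hU.fine w hw), F1, main] with e h1 h2 ⟨hn, k, S, b, D0, m1, m2, m3, m4, m5, m6, m7, m8, m9, m10, m11⟩ z hz _
    filter_upwards [h1] with d ⟨d', hd', hE, ha⟩
    obtain ⟨a, ha, haa⟩ := h2 d d' hE hd' ha
    exact ⟨a, (m11 d d' a z w hE haa hz).2 ha⟩)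
  have cFix := hW.unif (Q := fun e x x' => x = x' → x ∈ K → ∀ᶠ d in (Uf e : Filter ZFSet.{u}), EE d x x) (by
    intro x _
    by_cases hx : x ∈ K
    swap
    · filter_upwards with e x' hx' hh hh'
      rw [hh] at hh'; exact absurd hh' hx
    filter_upwards [TR _ (hU.fix x hx), main] with e h1 ⟨hn, k, S, b, D0, m1, m2, m3, m4, m5, m6, m7, m8, m9, m10, m11⟩ x' hx' hh hh'
    subst hh
    filter_upwards [h1] with d ⟨d', hd', hE, ha⟩
    exact (m11 d d' _ _ _ hE hx' hx').2 ha)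
  have cEmb : ∀ᶠ e in (W : Filter ZFSet.{u}), ∀ k S, EE e k κ → EE e S s →
      ∀ᶠ d in (Uf e : Filter ZFSet.{u}), Emb (V_ k.rank) S d := by
    have F2 := hW.unif2 (Q := fun e d d' x x' => d' ∈ D → x = x' → x ∈ K → (∃ w, EE d' x w) →
        ∃ z w, EE d' x w ∧ EE e z w) (by
      intro d' hd' x hx
      by_cases hc : d' ∈ D ∧ ∃ w, EE d' x w
      swap
      · filter_upwards with e d x' hx' hh hh' hh2q hh3q hh4
        subst hh2q
        exact absurd ⟨hh', hh4⟩ hc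
      obtain ⟨hc, w, hw⟩ := hc
      filter_upwards [hW.fine w (hT.trans _ hsT (hDp d' hc _ _ hw).2)] with e ⟨z, hz⟩ d x' _ _ _ hh _ _
      subst hh
      exact ⟨z, w, hw, hz⟩)
    filter_upwards [TR _ hU.emb, F2, main] with e h1 h2 ⟨hn, k, S, b, D0, m1, m2, m3, m4, m5, m6, m7, m8, m9, m10, m11⟩ k' S' hk' hS'
    have := hn.emb.inj hk' m1
    subst this
    have := hn.emb.inj hS' m2
    subst this
    filter_upwards [h1, m7] with d ⟨d', hd', hE, he⟩ hd
    have aux : ∀ {x z}, EE d x z → ∃ w, EE e z w ∧ EE d' x w ∧ EE e x x := by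
      intro x z hxz
      obtain ⟨w, hw⟩ := m10 z (m8 d hd x z hxz).2
      have hx := m9 x (m8 d hd x z hxz).1
      exact ⟨w, hw, (m11 d d' x z w hE hx hw).1 hxz, hx⟩
    constructor
    · intro p hp
      rw [m5, ZFSet.mem_powerset] at hd
      exact ZFSet.mem_prod.1 (hd hp)
    · intro a z z' ha ha'
      obtain ⟨w, h3, h4, h5⟩ := aux ha
      obtain ⟨w', h3', h4', h5'⟩ := aux ha'
      have := he.fn h4 h4'
      subst this
      exact hn.emb.inj h3 h3'
    · intro a a' z ha ha'
      obtain ⟨w, h3, h4, h5⟩ := aux ha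
      obtain ⟨w', h3', h4', h5'⟩ := aux ha'
      have := hn.emb.fn h3 h3'
      subst this
      exact he.inj h4 h4'
    · intro a a' z z' ha ha'
      obtain ⟨w, h3, h4, h5⟩ := aux ha
      obtain ⟨w', h3', h4', h5'⟩ := aux ha'
      rw [he.mem h4 h4', hn.emb.mem h3 h3']
    · intro a a' z ha haa
      obtain ⟨w, h3, h4, h5⟩ := aux ha
      have ha'V : a' ∈ V_ k'.rank := isTransitive_vonNeumann _ _ (m8 d hd a z ha).1 haa
      obtain ⟨w', hw'⟩ := he.dom h4 haa
      have h6 := m9 _ ha'V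
      obtain ⟨z1, w1, h7, h8⟩ := h2 d d' hE a' a' h6 hd' rfl (hn.emb.left h6) ⟨w', hw'⟩
      exact ⟨z1, (m11 d d' a' z1 w1 hE h6 h8).2 h7⟩
  have cR : ∀ᶠ e in (W : Filter ZFSet.{u}), ∀ k b, EE e k κ → EE e b y →
      ∀ᶠ d in (Uf e : Filter ZFSet.{u}), ∃ a b', EE d a k ∧ EE d b' b ∧ R a b' := by
    have F3 := hW.unif (Q := fun e d d' => d' ∈ D → (∃ a b, EE d' a κ ∧ EE d' b y ∧ R a b) →
        ∃ a b, EE d' a κ ∧ EE d' b y ∧ R a b ∧ EE e a a ∧ EE e b b) (by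
      intro d' hd'
      by_cases hc : d' ∈ D ∧ ∃ a b, EE d' a κ ∧ EE d' b y ∧ R a b
      swap
      · exact Eventually.of_forall fun e x hx hh hh' => absurd ⟨hh, hh'⟩ hc
      obtain ⟨hc, a, b, ha, hb, hR⟩ := hc
      filter_upwards [hW.fix a (hDp d' hc _ _ ha).1, hW.fix b (hDp d' hc _ _ hb).1] with e he he' d hd _ _
      exact ⟨a, b, ha, hb, hR, he, he'⟩)
    filter_upwards [TR _ hUR, F3, main] with e h1 h2 ⟨hn, k, S, b, D0, m1, m2, m3, m4, m5, m6, m7, m8, m9, m10, m11⟩ k' b' hk' hb'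
    filter_upwards [h1] with d ⟨d', hd', hE, he⟩
    obtain ⟨a, b1, h3, h4, h5, h6, h7⟩ := h2 d d' hE hd' he
    exact ⟨a, b1, (m11 d d' a k' κ hE h6 hk').2 h3, (m11 d d' b1 b' y hE h7 hb').2 h4, h5⟩
  have cNorm : ∀ᶠ e in (W : Filter ZFSet.{u}), ∀ S, EE e S s → ∀ F : ZFSet.{u} → ZFSet.{u},
      (∀ᶠ d in (Uf e : Filter ZFSet.{u}), ∃ z, EE d (F d) z) →
      ∃ z ∈ S, ∀ᶠ d in (Uf e : Filter ZFSet.{u}), EE d (F d) z := by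
    by_contra hcon
    rw [← Ultrafilter.eventually_not] at hcon
    let Bad : ZFSet.{u} → (ZFSet.{u} → ZFSet.{u}) → Prop := fun e F =>
      ∃ S, EE e S s ∧ (∀ᶠ d in (Uf e : Filter ZFSet.{u}), ∃ z, EE d (F d) z) ∧
        ∀ z ∈ S, ¬ ∀ᶠ d in (Uf e : Filter ZFSet.{u}), EE d (F d) z
    let F : ZFSet.{u} → (ZFSet.{u} → ZFSet.{u}) := fun e => if H : ∃ F, Bad e F then H.choose else id
    have hF : ∀ᶠ e in (W : Filter ZFSet.{u}), Bad e (F e) := by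
      filter_upwards [hcon] with e he
      push Not at he
      obtain ⟨S, hS, F', hF1, hF2⟩ := he
      have H : ∃ F, Bad e F := ⟨F', S, hS, hF1, fun z hz => by
        rw [← Ultrafilter.eventually_not]
        exact hF2 z hz⟩
      simp only [F, dif_pos H]
      exact H.choose_spec
    have mainF : ∀ᶠ e in (W : Filter ZFSet.{u}), ∃ c C, EE e c C ∧ (C ⊆ ZFSet.prod D K ∧
        ∀ d x, ZFSet.pair d x ∈ c ↔ (∀ D0, EE e D0 D → d ∈ D0) ∧ x = F e d ∧ EE e x x ∧ x ∈ K) := by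
      filter_upwards [main] with e ⟨hn, k, S, b, D0, m1, m2, m3, m4, m5, m6, m7, m8, m9, m10, m11⟩
      have hp := hn.prod m4 m6
      let c := ZFSet.sep (fun p => ∃ d, p = ZFSet.pair d (F e d)) (ZFSet.prod D0 (V_ k.rank))
      have hc : c ⊆ ZFSet.prod D0 (V_ k.rank) := fun x hx => (ZFSet.mem_sep.1 hx).1
      obtain ⟨C, hC⟩ := hn.sub hp hc
      refine ⟨c, C, hC, (hn.sub_iff hC hp).1 hc, ?_⟩
      intro d x
      simp only [c, ZFSet.mem_sep, ZFSet.pair_mem_prod]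
      constructor
      · rintro ⟨⟨h1, h2⟩, d1, h3⟩
        rw [ZFSet.pair_inj] at h3
        obtain ⟨rfl, rfl⟩ := h3
        refine ⟨fun D1 h => by rwa [hn.emb.inj h m4], rfl, m9 _ h2, ?_⟩
        exact hn.emb.left (m9 _ h2)
      · rintro ⟨h1, rfl, h2, h3⟩
        exact ⟨⟨h1 _ m4, (hn.emb.mem h2 m6).2 h3⟩, d, rfl⟩
    obtain ⟨Fs, _, hFs⟩ := hW.ex (Q := fun e c C => (C ⊆ ZFSet.prod D K ∧
        ∀ d x, ZFSet.pair d x ∈ c ↔ (∀ D0, EE e D0 D → d ∈ D0) ∧ x = F e d ∧ EE e x x ∧ x ∈ K)) mainF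
    have hFsub : Fs ⊆ ZFSet.prod D K := by
      obtain ⟨e, c, _, h, _⟩ := hFs.exists
      exact h
    have hex : ∀ᶠ d' in (U : Filter ZFSet.{u}), ∃ x, ZFSet.pair d' x ∈ Fs ∧ ∃ w, EE d' x w := by
      by_contra hcc
      rw [← Ultrafilter.eventually_not] at hcc
      obtain ⟨e, ⟨⟨h1, c, hc, _, hcF⟩, S1, h2, h3, h4⟩, hn, k, S, b, D0, m1, m2, m3, m4, m5, m6, m7, m8, m9, m10, m11⟩ :=
        (((TR _ hcc).and hFs).and hF |>.and main).exists
      obtain ⟨d, ⟨⟨d', hd', hE, hno⟩, z, hz⟩, hd⟩ := ((h1.and h3).and m7).exists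
      obtain ⟨hx, hzS⟩ := m8 d hd _ _ hz
      have hxx := m9 _ hx
      have hp : ZFSet.pair d (F e d) ∈ c :=
        (hcF _ _).2 ⟨fun D1 h => by rwa [hn.emb.inj h m4], rfl, hxx, hn.emb.left hxx⟩
      have hp' : ZFSet.pair d' (F e d) ∈ Fs := (hn.emb.mem (hn.pair hE hxx) hc).1 hp
      obtain ⟨w, hw⟩ := m10 z hzS
      exact hno ⟨_, hp', w, (m11 d d' _ z w hE hxx hw).1 hz⟩
    let G : ZFSet.{u} → ZFSet.{u} := fun d' =>
      if H : ∃ x, ZFSet.pair d' x ∈ Fs ∧ ∃ w, EE d' x w then H.choose else ∅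
    have hG : ∀ᶠ d' in (U : Filter ZFSet.{u}), ZFSet.pair d' (G d') ∈ Fs ∧ ∃ w, EE d' (G d') w := by
      filter_upwards [hex] with d' H
      simp only [G, dif_pos H]
      exact H.choose_spec
    obtain ⟨w, hw, hGw⟩ := hU.normal G (hG.mono fun _ h => h.2)
    have F4 := hW.unif (Q := fun e d d' => G d' ∈ K → EE e (G d') (G d')) (by
      intro d' hd'
      by_cases hc : G d' ∈ K
      swap
      · exact Eventually.of_forall fun e x hx hh => absurd hh hc
      filter_upwards [hW.fix _ hc] with e he d hd _
      exact he)
    obtain ⟨e, ⟨⟨h1, c, hc, _, hcF⟩, S1, h2, h3, h4⟩, ⟨hn, k, S, b, D0, m1, m2, m3, m4, m5, m6, m7, m8, m9, m10, m11⟩, h5, z, hz⟩ :=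
        (((TR _ (hG.and hGw)).and hFs).and hF |>.and (main.and (F4.and (hW.fine w (hT.trans _ hsT hw))))).exists
    refine h4 z ((hn.emb.mem hz h2).2 hw) ?_
    filter_upwards [h1] with d ⟨d', hd', hE, ⟨hp, _⟩, hGw⟩
    have hGK : G d' ∈ K := (ZFSet.pair_mem_prod.1 (hFsub hp)).2
    have hGG := h5 d d' hE hGK
    have hp' : ZFSet.pair d (G d') ∈ c := (hn.emb.mem (hn.pair hE hGG) hc).2 hp
    have := ((hcF _ _).1 hp').2.1
    rw [← this]
    exact (m11 d d' _ z w hE hGG hz).2 hGw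
  filter_upwards [main, cFine, cFix, cEmb, cR, cNorm] with e ⟨hn, k1, S1, b1, D0, m1, m2, m3, m4, m5, m6, m7, m8, m9, m10, m11⟩ h1 h2 h3 h4 h5 k S b hk hS hb
  have := hn.emb.inj hk m1
  subst this
  have := hn.emb.inj hS m2
  subst this
  refine ⟨Uf e, ⟨h3 k S hk hS, ?_, ?_, h5 S hS⟩, h4 k b hk hb⟩
  · intro z hz
    obtain ⟨w, hw⟩ := m10 z hz
    exact h1 z w hw ((hn.emb.mem hw hS).1 hz)
  · intro x hx
    have hxx := m9 x hx
    exact h2 x x hxx rfl (hn.emb.left hxx)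

/-- The next limit level. -/
noncomputable def nxt (y : ZFSet.{u}) : ZFSet.{u} := V_ (y.rank + Ordinal.omega0)

theorem lim_nxt (y : ZFSet.{u}) : Lim (nxt y) :=
  lim_vonNeumann _ (Ordinal.isSuccLimit_add _ Ordinal.isSuccLimit_omega0)

theorem mem_nxt_of_rank_le {x y : ZFSet.{u}} (h : x.rank ≤ y.rank) : x ∈ nxt y := by
  unfold nxt
  rw [mem_vonNeumann]
  exact h.trans_lt (lt_add_of_pos_right _ Ordinal.omega0_pos)

theorem Emb.trans_of {e b y : ZFSet.{u}} (he : Emb K T e) (hb : EE e b y) (hy : y.IsTransitive) :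
    b.IsTransitive := by
  intro x hx x' hx'
  obtain ⟨X, hX, hE⟩ := (he.mem_iff hb).1 hx
  obtain ⟨X', hX', hE'⟩ := (he.mem_iff hE).1 hx'
  exact (he.mem hE' hb).2 (hy _ hX hX')

theorem insert_self_mem_nxt (y : ZFSet.{u}) : insert y y ∈ nxt y := by
  unfold nxt
  rw [mem_vonNeumann, rank_insert]
  have h1 : y.rank < y.rank + Ordinal.omega0 := lt_add_of_pos_right _ Ordinal.omega0_pos
  exact max_lt ((Ordinal.isSuccLimit_add _ Ordinal.isSuccLimit_omega0).succ_lt h1) h1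

theorem insert_self_trans {y : ZFSet.{u}} (hy : y.IsTransitive) : (insert y y).IsTransitive := by
  intro x hx z hz
  rw [ZFSet.mem_insert_iff] at hx ⊢
  rcases hx with rfl | hx
  · exact Or.inr hz
  · exact Or.inr (hy _ hx hz)

theorem min_lemma (o : Ordinal.{u}) : ∀ α y : ZFSet.{u}, α.rank = o → y.IsTransitive → α ∈ y →
    V_ α.rank ∈ y → PP α (nxt y) → Nf α (insert y y) y (fun a b => ¬ PP a (nxt b)) := by
  induction o using WellFoundedLT.induction with
  | _ o ih =>
  intro α y ho hy hα hV hP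
  obtain ⟨W, hW⟩ := hP
  have hyn : y ∈ nxt y := mem_nxt_of_rank_le le_rfl
  have hαn : α ∈ nxt y := (lim_nxt y).trans _ hyn hα
  have hin : insert y y ⊆ nxt y := (lim_nxt y).trans _ (insert_self_mem_nxt y)
  have hyi : y ∈ insert y y := by simp
  have hit := insert_self_trans hy
  by_cases hc : ∀ᶠ e in (W : Filter ZFSet.{u}), ∃ a b, EE e a α ∧ EE e b y ∧ ¬ PP a (nxt b)
  · exact Nf.proj' W hW hc hit hin (hit _ hyi hV) (hit _ hyi hα) hyi
  · rw [← Ultrafilter.eventually_not] at hc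
    refine refl_back hW (lim_nxt y) (insert_self_mem_nxt y) (hit _ hyi hα) hyi
      (fun x hx => hit _ (hit _ hyi hV) hx) ?_
    filter_upwards [hc, hW.nice (lim_nxt y), hW.fine α hαn, hW.fine y hyn,
      hW.fine _ (insert_self_mem_nxt y)] with e h1 hn ⟨k, hk⟩ ⟨b, hb⟩ ⟨c, hcc⟩
    have hci : c = insert b b := by
      ext x
      rw [hn.emb.mem_iff hcc, ZFSet.mem_insert_iff]
      constructor
      · rintro ⟨X, hX, hE⟩
        rw [ZFSet.mem_insert_iff] at hX
        rcases hX with rfl | hX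
        · exact Or.inl (hn.emb.inj hE hb)
        · exact Or.inr ((hn.emb.mem hE hb).2 hX)
      · rintro (rfl | hx)
        · exact ⟨y, hyi, hb⟩
        · obtain ⟨X, hX, hE⟩ := (hn.emb.mem_iff hb).1 hx
          exact ⟨X, hit _ hyi hX, hE⟩
    refine ⟨k, c, b, hk, hcc, hb, ?_⟩
    rw [hci]
    have hkr : k.rank < o := by
      rw [← ho]
      exact mem_vonNeumann.1 (hn.emb.left hk)
    refine ih k.rank hkr k b rfl (hn.emb.trans_of hb hy) ((hn.emb.mem hk hb).2 hα)
      ((hn.emb.mem (hn.V hk) hb).2 hV) ?_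
    by_contra hPn
    exact h1 ⟨k, b, hk, hb, hPn⟩

end HelpD

section HelpE
universe u
open ZFSet Filter
open scoped ZFSet

/-- A failing pair. -/
def Fails (δo : Ordinal.{u}) (α t x : ZFSet.{u}) (R : ZFSet.{u} → ZFSet.{u} → Prop) : Prop :=
  t.IsTransitive ∧ α ∈ t ∧ V_ α.rank ∈ t ∧ x ∈ t ∧ t.rank < δo ∧ PP α t ∧ ¬ Nf α t x R

theorem Nf.congr {α t x : ZFSet.{u}} {R R' : ZFSet.{u} → ZFSet.{u} → Prop}
    (h : ∀ a b, a.rank < α.rank → R a b → R' a b) (hN : Nf α t x R) : Nf α t x R' := by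
  obtain ⟨U, hU, hR⟩ := hN
  refine ⟨U, hU, ?_⟩
  filter_upwards [hR, hU.emb] with d ⟨a, b, h1, h2, h3⟩ he
  exact ⟨a, b, h1, h2, h a b (mem_vonNeumann.1 (he.left h1)) h3⟩

theorem Fails.congr {δo : Ordinal.{u}} {α t x : ZFSet.{u}} {R R' : ZFSet.{u} → ZFSet.{u} → Prop}
    (h : ∀ a b, a.rank < α.rank → R a b → R' a b) (hN : Fails δo α t x R') : Fails δo α t x R := by
  obtain ⟨h1, h2, h3, h4, h5, h6, h7⟩ := hN
  exact ⟨h1, h2, h3, h4, h5, h6, fun hh => h7 (hh.congr h)⟩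

theorem exists_F (δo : Ordinal.{u}) (L : ZFSet.{u} → Prop) : ∃ F : ZFSet.{u} → ZFSet.{u},
    ∀ α, (¬ L α → (∃ t x, Fails δo α t x (fun a b => b = F a)) →
        ∃ t, Fails δo α t (F α) (fun a b => b = F a) ∧
          ∀ t' x', Fails δo α t' x' (fun a b => b = F a) → t.rank ≤ t'.rank) ∧
      (L α → F α = ∅) ∧ ((¬ ∃ t x, Fails δo α t x (fun a b => b = F a)) → F α = ∅) := by
  classical
  let RR : (α : ZFSet.{u}) → ((γ : ZFSet.{u}) → γ.rank < α.rank → ZFSet.{u}) →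
      ZFSet.{u} → ZFSet.{u} → Prop := fun α G a b => ∃ h : a.rank < α.rank, b = G a h
  let C : (α : ZFSet.{u}) → ((γ : ZFSet.{u}) → γ.rank < α.rank → ZFSet.{u}) → Prop := fun α G =>
    ¬ L α ∧ ∃ x t, Fails δo α t x (RR α G) ∧ ∀ t' x', Fails δo α t' x' (RR α G) → t.rank ≤ t'.rank
  let Φ : (α : ZFSet.{u}) → ((γ : ZFSet.{u}) → γ.rank < α.rank → ZFSet.{u}) → ZFSet.{u} := fun α G =>
    if H : C α G then H.2.choose else ∅
  have wf : WellFounded (fun a b : ZFSet.{u} => a.rank < b.rank) := InvImage.wf ZFSet.rank Ordinal.lt_wf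
  let F : ZFSet.{u} → ZFSet.{u} := wf.fix Φ
  have hF : ∀ α, F α = Φ α (fun γ _ => F γ) := fun α => wf.fix_eq Φ α
  refine ⟨F, fun α => ?_⟩
  have hR : ∀ t x, Fails δo α t x (RR α fun γ _ => F γ) ↔ Fails δo α t x (fun a b => b = F a) := by
    intro t x
    constructor
    · exact Fails.congr fun a b h1 h2 => ⟨h1, h2⟩
    · exact Fails.congr fun a b h1 h2 => h2.2
  have hRC : C α (fun γ _ => F γ) ↔ ¬ L α ∧ ∃ x t, Fails δo α t x (fun a b => b = F a) ∧
      ∀ t' x', Fails δo α t' x' (fun a b => b = F a) → t.rank ≤ t'.rank := by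
    simp only [C, hR]
  refine ⟨?_, ?_, ?_⟩
  · intro hL ⟨t, x, ht⟩
    have hS : ({o | ∃ t x, Fails δo α t x (fun a b => b = F a) ∧ t.rank = o} : Set Ordinal.{u}).Nonempty :=
      ⟨_, t, x, ht, rfl⟩
    obtain ⟨t1, x1, h1, h2⟩ := csInf_mem hS
    have H : C α (fun γ _ => F γ) := by
      rw [hRC]
      refine ⟨hL, x1, t1, h1, ?_⟩
      intro t' x' h'
      rw [h2]
      exact csInf_le' ⟨t', x', h', rfl⟩
    have hs := H.2.choose_spec
    obtain ⟨t2, h3, h4⟩ := hs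
    have : F α = H.2.choose := by
      rw [hF]; simp only [Φ, dif_pos H]
    rw [this]
    exact ⟨t2, (hR _ _).1 h3, fun t' x' h' => h4 t' x' ((hR _ _).2 h')⟩
  · intro hL
    rw [hF]
    have : ¬ C α (fun γ _ => F γ) := fun h => h.1 hL
    simp only [Φ, dif_neg this]
  · intro hn
    rw [hF]
    have : ¬ C α (fun γ _ => F γ) := by
      rw [hRC]
      rintro ⟨_, x, t, h, _⟩
      exact hn ⟨t, x, h⟩
    simp only [Φ, dif_neg this]

theorem laver_comb (δo : Ordinal.{u}) (hδ : ∀ o < δo, o + Ordinal.omega0 < δo) (L : ZFSet.{u} → Prop)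
    (hDer : ∀ κ, L κ → ∀ o < δo, κ.rank < o → PP κ (V_ o)) (h0 : 0 < δo) :
    ∃ F : ZFSet.{u} → ZFSet.{u}, (∀ α, (F α).rank < δo) ∧ (∀ α, L α → F α = ∅) ∧
      (∀ α, F α ≠ ∅ → ∃ t, t.IsTransitive ∧ α ∈ t ∧ V_ α.rank ∈ t ∧ PP α t) ∧
      ∀ κ, L κ → ∀ t x, t.IsTransitive → κ ∈ t → V_ κ.rank ∈ t → x ∈ t → t.rank < δo →
        Nf κ t x (fun a b => b = F a) := by
  obtain ⟨F, hF⟩ := exists_F δo L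
  have hF2 : ∀ α, F α ≠ ∅ → ∃ t, Fails δo α t (F α) (fun a b => b = F a) := by
    intro α hα
    by_cases hL : L α
    · exact absurd ((hF α).2.1 hL) hα
    by_cases hc : ∃ t x, Fails δo α t x (fun a b => b = F a)
    · obtain ⟨t, ht, _⟩ := (hF α).1 hL hc
      exact ⟨t, ht⟩
    · exact absurd ((hF α).2.2 hc) hα
  refine ⟨F, ?_, fun α => (hF α).2.1, ?_, ?_⟩
  · intro α
    by_cases hα : F α = ∅
    · rw [hα, rank_empty]; exact h0
    · obtain ⟨t, ht⟩ := hF2 α hα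
      exact (rank_lt_of_mem ht.2.2.2.1).trans ht.2.2.2.2.1
  · intro α hα
    obtain ⟨t, h1, h2, h3, h4, h5, h6, h7⟩ := hF2 α hα
    exact ⟨t, h1, h2, h3, h6⟩
  intro κ hLκ t0 x0 ht0 hκt0 hVt0 hx0 hrk
  by_contra hfail
  set R : ZFSet.{u} → ZFSet.{u} → Prop := fun a b => b = F a with hRdef
  set y := nxt t0 with hy
  have hyrank : y.rank = t0.rank + Ordinal.omega0 := by rw [hy]; unfold nxt; rw [rank_vonNeumann]
  have hyδ : y.rank < δo := by rw [hyrank]; exact hδ _ hrk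
  have hylim : Lim y := lim_nxt t0
  have ht0y : t0 ∈ y := mem_nxt_of_rank_le le_rfl
  have hκy : κ ∈ y := hylim.trans _ ht0y hκt0
  have hVy : V_ κ.rank ∈ y := hylim.trans _ ht0y hVt0
  have hκr : κ.rank < y.rank := rank_lt_of_mem hκy
  have hκδ : κ.rank < δo := hκr.trans hyδ
  have hPy : PP κ (nxt y) := hDer κ hLκ _ (hδ _ hyδ) (hκr.trans_le (le_add_of_nonneg_right zero_le))
  have hPt0 : PP κ t0 := by
    have : PP κ y := hDer κ hLκ _ (hδ _ hrk) (by rw [← hyrank]; exact hκr)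
    exact this.proj ht0 (hylim.trans _ ht0y) hVt0
  obtain ⟨W0, hW0, hW0R⟩ := min_lemma _ κ y rfl hylim.trans hκy hVy hPy
  have hKy : V_ κ.rank ⊆ y := hylim.trans _ hVy
  have hW : Good (V_ κ.rank) y (W0.map (restr (V_ κ.rank) y)) :=
    hW0.proj hylim.trans (fun x hx => ZFSet.mem_insert_iff.2 (Or.inr hx)) hKy
  have hnL : ∀ᶠ e in ((W0.map (restr (V_ κ.rank) y) : Ultrafilter ZFSet.{u}) : Filter ZFSet.{u}),
      ∀ k, EE e k κ → ¬ L k := by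
    rw [Ultrafilter.coe_map, eventually_map]
    filter_upwards [hW0.emb, hW0R] with e he ⟨a, b, h1, h2, h3⟩ k hk hLk
    have := he.inj (EE_restr.1 hk).2 h1
    subst this
    have hbr : b.rank < κ.rank := mem_vonNeumann.1 (he.left h2)
    have hkb : k ∈ b := (he.mem h1 h2).2 hκy
    exact h3 (hDer k hLk _ (hδ _ (hbr.trans hκδ))
      ((rank_lt_of_mem hkb).trans_le (le_add_of_nonneg_right zero_le)))
  revert hW hnL
  generalize W0.map (restr (V_ κ.rank) y) = W
  intro hW hnL
  have hNT : Nf κ t0 x0 (fun _ _ => True) := by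
    obtain ⟨U, hU⟩ := hPt0
    refine ⟨U, hU, ?_⟩
    filter_upwards [hU.fine κ hκt0, hU.fine x0 hx0] with d ⟨a, ha⟩ ⟨b, hb⟩
    exact ⟨a, b, ha, hb, trivial⟩
  have e1 := refl_fwd hW hylim ht0y hκt0 hx0 hNT
  have e2 : ∀ᶠ e in (W : Filter ZFSet.{u}), ¬ ∃ k S b, EE e k κ ∧ EE e S t0 ∧ EE e b x0 ∧ Nf k S b R := by
    rw [Ultrafilter.eventually_not]
    intro hh
    exact hfail (refl_back hW hylim ht0y hκt0 hx0 (ht0 _ hVt0) hh)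
  have e3 : ∀ᶠ e in (W : Filter ZFSet.{u}), ∃ a s, EE e a s ∧ ∃ k, EE e k κ ∧ Fails δo k a (F k) R := by
    filter_upwards [e1, e2, hnL, hW.nice hylim, hW.fine κ hκy, hW.fine t0 ht0y,
      hW.fine x0 (hylim.trans _ ht0y hx0)] with e h1 h2 h3 hn ⟨k, hk⟩ ⟨S, hS⟩ ⟨b, hb⟩
    have hfl : Fails δo k S b R := by
      refine ⟨hn.emb.trans_of hS ht0, (hn.emb.mem hk hS).2 hκt0, (hn.emb.mem (hn.V hk) hS).2 hVt0,
        (hn.emb.mem hb hS).2 hx0, ?_, ?_, ?_⟩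
      · exact (mem_vonNeumann.1 (hn.emb.left hS)).trans hκδ
      · obtain ⟨U, hU, _⟩ := h1 k S b hk hS hb
        exact ⟨U, hU⟩
      · intro hh
        exact h2 ⟨k, S, b, hk, hS, hb, hh⟩
    obtain ⟨t, ht, hmin⟩ := (hF k).1 (h3 k hk) ⟨S, b, hfl⟩
    have htS : t ⊆ V_ S.rank := subset_vonNeumann.2 (hmin _ _ hfl)
    obtain ⟨s, hs⟩ := hn.sub (hn.V hS) htS
    exact ⟨t, s, hs, k, hk, ht⟩
  obtain ⟨s, hsy, e4⟩ := hW.ex (Q := fun e a s => ∃ k, EE e k κ ∧ Fails δo k a (F k) R) e3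
  have e5 : ∀ᶠ e in (W : Filter ZFSet.{u}), ∃ b z, EE e b z ∧ ∃ k, EE e k κ ∧ b = F k := by
    filter_upwards [e4, hW.emb] with e ⟨a, ha, k, hk, hfl⟩ he
    obtain ⟨z, hz⟩ := he.dom ha hfl.2.2.2.1
    exact ⟨_, z, hz, k, hk, rfl⟩
  obtain ⟨x, hxy, e6⟩ := hW.ex (Q := fun e b z => ∃ k, EE e k κ ∧ b = F k) e5
  have e7 : ∀ᶠ e in (W : Filter ZFSet.{u}), Nice (V_ κ.rank) y e ∧ ∃ k a, EE e k κ ∧ EE e a s ∧ EE e (F k) x ∧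
      Fails δo k a (F k) R := by
    filter_upwards [e4, e6, hW.nice hylim] with e ⟨a, ha, k, hk, hfl⟩ ⟨b, hb, k', hk', hbk⟩ hn
    have := hn.emb.inj hk hk'
    subst this
    subst hbk
    exact ⟨hn, k, a, hk, ha, hb, hfl⟩
  have hst : s.IsTransitive := by
    intro X hX X' hX'
    have hXy := hylim.trans _ hsy hX
    obtain ⟨e, ⟨hn, k, a, hk, ha, hb, hfl⟩, ⟨c, hc⟩, c', hc'⟩ :=
      (e7.and ((hW.fine X hXy).and (hW.fine X' (hylim.trans _ hXy hX')))).exists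
    exact (hn.emb.mem hc' ha).1 (hfl.1 _ ((hn.emb.mem hc ha).2 hX) ((hn.emb.mem hc' hc).2 hX'))
  have hκs : κ ∈ s ∧ V_ κ.rank ∈ s ∧ x ∈ s := by
    obtain ⟨e, hn, k, a, hk, ha, hb, hfl⟩ := e7.exists
    exact ⟨(hn.emb.mem hk ha).1 hfl.2.1, (hn.emb.mem (hn.V hk) ha).1 hfl.2.2.1,
      (hn.emb.mem hb ha).1 hfl.2.2.2.1⟩
  have hN : Nf κ s x R := by
    refine Nf.proj' W hW ?_ hst (hylim.trans _ hsy) hκs.2.1 hκs.1 hκs.2.2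
    filter_upwards [e7] with e ⟨hn, k, a, hk, ha, hb, hfl⟩
    exact ⟨k, F k, hk, hb, rfl⟩
  obtain ⟨e, h1, hn, k, a, hk, ha, hb, hfl⟩ := ((refl_fwd hW hylim hsy hκs.1 hκs.2.2 hN).and e7).exists
  exact hfl.2.2.2.2.2.2 (h1 k a (F k) hk ha hb)

end HelpE

section HelpG
universe u
open ZFSet Filter
open scoped ZFSet

theorem Good.const {K T : ZFSet.{u}} {U : Ultrafilter ZFSet.{u}} (h : Good K T U)
    (hK : K.IsTransitive) {x : ZFSet.{u}} (hx : x ∈ K) (F : ZFSet.{u} → ZFSet.{u})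
    (hF : ∀ᶠ e in (U : Filter ZFSet.{u}), F e ∈ x) :
    ∃ c ∈ x, ∀ᶠ e in (U : Filter ZFSet.{u}), F e = c := by
  obtain ⟨z, hz, hE⟩ := h.normal F (by
    filter_upwards [h.emb, h.fix x hx, hF] with e h1 h2 h3
    exact h1.dom h2 h3)
  have hzx : z ∈ x := by
    obtain ⟨e, h1, h2, h3, h4⟩ := (h.emb.and ((h.fix x hx).and (hF.and hE))).exists
    exact (h1.mem h4 h2).1 h3
  refine ⟨z, hzx, ?_⟩
  filter_upwards [h.emb, hE, h.fix z (hK _ hx hzx)] with e h1 h2 h3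
  exact h1.inj h2 h3

/-- Numerals. -/
noncomputable def numZ (n : ℕ) : ZFSet.{u} := ((n : Ordinal.{u})).toZFSet

theorem numZ_mem_omega (n : ℕ) : numZ.{u} n ∈ Ordinal.omega0.{u}.toZFSet :=
  Ordinal.toZFSet_mem_toZFSet_iff.2 (Ordinal.natCast_lt_omega0 n)

theorem numZ_inj {m n : ℕ} (h : numZ.{u} m = numZ n) : m = n := by
  have := Ordinal.toZFSet_injective h
  exact_mod_cast this

theorem Good.complete {K T : ZFSet.{u}} {U : Ultrafilter ZFSet.{u}} (h : Good K T U)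
    (hK : K.IsTransitive) (hw : Ordinal.omega0.{u}.toZFSet ∈ K) (P : ℕ → ZFSet.{u} → Prop)
    (hP : ∀ n, ∀ᶠ e in (U : Filter ZFSet.{u}), P n e) :
    ∀ᶠ e in (U : Filter ZFSet.{u}), ∀ n, P n e := by
  classical
  by_contra hc
  rw [← Ultrafilter.eventually_not] at hc
  let N : ZFSet.{u} → ℕ := fun e => if H : ∃ n, ¬ P n e then H.choose else 0
  have hN : ∀ᶠ e in (U : Filter ZFSet.{u}), ¬ P (N e) e := by
    filter_upwards [hc] with e he
    push Not at he
    simp only [N, dif_pos he]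
    exact he.choose_spec
  obtain ⟨c, _, hcc⟩ := h.const hK hw (fun e => numZ (N e))
    (Eventually.of_forall fun e => numZ_mem_omega _)
  obtain ⟨e0, he0⟩ := hcc.exists
  obtain ⟨e, h1, h2, h3⟩ := (hcc.and (hN.and (hP (N e0)))).exists
  have : N e = N e0 := numZ_inj (h1.trans he0.symm)
  rw [this] at h2
  exact h2 h3

theorem Good.collapse {K T : ZFSet.{u}} {U : Ultrafilter ZFSet.{u}} (h : Good K T U)
    (hK : K.IsTransitive) (hw : Ordinal.omega0.{u}.toZFSet ∈ K) :
    ∃ P : (ZFSet.{u} → ZFSet.{u}) → ZFSet.{u},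
      (∀ F y, y ∈ P F ↔ ∃ H, (∀ᶠ e in (U : Filter ZFSet.{u}), H e ∈ F e) ∧ P H = y) ∧
      (∀ F G, P F = P G ↔ ∀ᶠ e in (U : Filter ZFSet.{u}), F e = G e) ∧
      (∀ F G, P F ∈ P G ↔ ∀ᶠ e in (U : Filter ZFSet.{u}), F e ∈ G e) := by
  classical
  let E : Germ (U : Filter ZFSet.{u}) ZFSet.{u} → Germ (U : Filter ZFSet.{u}) ZFSet.{u} → Prop :=
    Germ.LiftRel (· ∈ ·)
  have hE : ∀ F G : ZFSet.{u} → ZFSet.{u}, E (F : Germ (U : Filter ZFSet.{u}) ZFSet.{u}) G ↔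
      ∀ᶠ e in (U : Filter ZFSet.{u}), F e ∈ G e := fun F G => Germ.liftRel_coe
  have wf : WellFounded E := by
    rw [wellFounded_iff_isEmpty_descending_chain]
    constructor
    rintro ⟨s, hs⟩
    have : ∀ n, ∃ F : ZFSet.{u} → ZFSet.{u}, (F : Germ (U : Filter ZFSet.{u}) ZFSet.{u}) = s n :=
      fun n => Quotient.exists_rep (s n)
    choose F hF using this
    have hh : ∀ n, ∀ᶠ e in (U : Filter ZFSet.{u}), F (n+1) e ∈ F n e := by
      intro n
      rw [← hE, hF, hF]
      exact hs n
    obtain ⟨e, he⟩ := (h.complete hK hw _ hh).exists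
    have := (wellFounded_iff_isEmpty_descending_chain (r := fun a b : ZFSet.{u} => a ∈ b)).1 ZFSet.mem_wf
    exact this.false ⟨fun n => F n e, he⟩
  have sm : ∀ g, Small.{u} {h // E h g} := by
    intro g
    induction g using Germ.inductionOn with
    | _ G =>
    let D := ZFSet.powerset (ZFSet.prod K T)
    have hD : ∀ᶠ e in (U : Filter ZFSet.{u}), e ∈ D := by
      filter_upwards [h.emb] with e he
      rw [ZFSet.mem_powerset]
      intro p hp
      obtain ⟨a, ha, z, hz, rfl⟩ := he.sub p hp
      exact ZFSet.pair_mem_prod.2 ⟨ha, hz⟩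
    let Φ : ((d : {d // d ∈ D}) → {z // z ∈ insert ∅ (G d.1)}) →
        Germ (U : Filter ZFSet.{u}) ZFSet.{u} :=
      fun φ => ((fun d => if hd : d ∈ D then (φ ⟨d, hd⟩).1 else ∅ : ZFSet.{u} → ZFSet.{u}) :
        Germ (U : Filter ZFSet.{u}) ZFSet.{u})
    have h1 : Small.{u} (Set.range Φ) := small_range _
    refine small_subset (t := {h | E h G}) (s := Set.range Φ) ?_
    intro hh
    induction hh using Germ.inductionOn with
    | _ H =>
    intro hHG
    have hHG' : ∀ᶠ e in (U : Filter ZFSet.{u}), H e ∈ G e := (hE _ _).1 hHG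
    refine ⟨fun d => if hd : H d.1 ∈ G d.1 then ⟨H d.1, by simp [hd]⟩ else ⟨∅, by simp⟩, ?_⟩
    refine Germ.coe_eq.2 ?_
    filter_upwards [hD, hHG'] with d hd hd'
    simp [hd, hd']
  let pi : Germ (U : Filter ZFSet.{u}) ZFSet.{u} → ZFSet.{u} :=
    wf.fix (fun g rec => ZFSet.range (fun h : {h // E h g} => rec h.1 h.2))
  have hpi : ∀ g y, y ∈ pi g ↔ ∃ h, E h g ∧ pi h = y := by
    intro g y
    have : pi g = ZFSet.range (fun h : {h // E h g} => pi h.1) := by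
      simp only [pi]
      rw [wf.fix_eq]
    rw [this, ZFSet.mem_range]
    constructor
    · rintro ⟨⟨h, hh⟩, rfl⟩
      exact ⟨h, hh, rfl⟩
    · rintro ⟨h, hh, rfl⟩
      exact ⟨⟨h, hh⟩, rfl⟩
  have inj : ∀ g h, pi g = pi h → g = h := by
    intro g
    induction g using wf.induction with
    | _ g ih =>
    intro h hgh
    induction g using Germ.inductionOn with
    | _ G =>
    induction h using Germ.inductionOn with
    | _ H =>
    refine Germ.coe_eq.2 ?_
    by_contra hc
    have hc' : ∀ᶠ e in (U : Filter ZFSet.{u}), ¬ (G e = H e) := Ultrafilter.eventually_not.2 hc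
    have : ∀ᶠ e in (U : Filter ZFSet.{u}), (∃ x ∈ G e, x ∉ H e) ∨ (∃ x ∈ H e, x ∉ G e) := by
      filter_upwards [hc'] with e he
      by_contra hn
      push Not at hn
      exact he (ZFSet.ext fun z => ⟨hn.1 z, hn.2 z⟩)
    rw [Ultrafilter.eventually_or] at this
    rcases this with h1 | h1
    · obtain ⟨X, hX⟩ := h1.choice
      have hXG : E (X : Germ (U : Filter ZFSet.{u}) ZFSet.{u}) G :=
        (hE _ _).2 (hX.mono fun e he => he.1)
      have : pi X ∈ pi H := by rw [← hgh, hpi]; exact ⟨_, hXG, rfl⟩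
      rw [hpi] at this
      obtain ⟨Y, hY, hYX⟩ := this
      have := ih _ hXG _ hYX.symm
      rw [← this, hE] at hY
      obtain ⟨e, h2, h3⟩ := (hY.and hX).exists
      exact h3.2 h2
    · obtain ⟨X, hX⟩ := h1.choice
      have hXG : E (X : Germ (U : Filter ZFSet.{u}) ZFSet.{u}) H :=
        (hE _ _).2 (hX.mono fun e he => he.1)
      have : pi X ∈ pi G := by rw [hgh, hpi]; exact ⟨_, hXG, rfl⟩
      rw [hpi] at this
      obtain ⟨Y, hY, hYX⟩ := this
      have := ih _ hY _ hYX
      rw [this, hE] at hY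
      obtain ⟨e, h2, h3⟩ := (hY.and hX).exists
      exact h3.2 h2
  refine ⟨fun F => pi F, ?_, ?_, ?_⟩
  · intro F y
    rw [hpi]
    constructor
    · rintro ⟨g, hg, hy⟩
      induction g using Germ.inductionOn with
      | _ G => exact ⟨G, (hE _ _).1 hg, hy⟩
    · rintro ⟨H, hH, hy⟩
      exact ⟨H, (hE _ _).2 hH, hy⟩
  · intro F G
    constructor
    · intro hh
      exact Germ.coe_eq.1 (inj _ _ hh)
    · intro hh
      exact congrArg pi (Germ.coe_eq.2 hh)
  · intro F G
    rw [hpi]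
    constructor
    · rintro ⟨g, hg, hy⟩
      have := inj _ _ hy
      subst this
      exact (hE _ _).1 hg
    · intro hH
      exact ⟨_, (hE _ _).2 hH, rfl⟩

theorem los {U : Ultrafilter ZFSet.{u}} {P : (ZFSet.{u} → ZFSet.{u}) → ZFSet.{u}}
    (hEq : ∀ F G, P F = P G ↔ ∀ᶠ e in (U : Filter ZFSet.{u}), F e = G e)
    (hMem : ∀ F G, P F ∈ P G ↔ ∀ᶠ e in (U : Filter ZFSet.{u}), F e ∈ G e) {n : ℕ} (φ : Fml n) :
    ∀ v : Fin n → ZFSet.{u} → ZFSet.{u},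
    (Fml.Realize (Set.range P) φ (fun i => P (v i)) ↔
      ∀ᶠ e in (U : Filter ZFSet.{u}), Fml.Realize Set.univ φ (fun i => v i e)) := by
  induction φ with
  | mem i j => intro v; exact hMem _ _
  | eq i j => intro v; exact hEq _ _
  | not φ ih =>
    intro v
    simp only [Fml.Realize]
    rw [ih, Ultrafilter.eventually_not]
  | and φ ψ ih1 ih2 =>
    intro v
    simp only [Fml.Realize]
    rw [ih1, ih2, eventually_and]
  | @ex n φ ih =>
    intro v
    have s1 : ∀ H : ZFSet.{u} → ZFSet.{u}, (Fin.snoc (fun i => P (v i)) (P H) : Fin (n+1) → ZFSet.{u}) =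
        fun i => P ((Fin.snoc v H : Fin (n+1) → ZFSet.{u} → ZFSet.{u}) i) := by
      intro H
      funext i
      refine Fin.lastCases ?_ (fun i => ?_) i <;> simp
    have s2 : ∀ (H : ZFSet.{u} → ZFSet.{u}) e, (Fin.snoc (fun i => v i e) (H e) : Fin (n+1) → ZFSet.{u}) =
        fun i => (Fin.snoc v H : Fin (n+1) → ZFSet.{u} → ZFSet.{u}) i e := by
      intro H e
      funext i
      refine Fin.lastCases ?_ (fun i => ?_) i <;> simp
    simp only [Fml.Realize]
    constructor
    · rintro ⟨_, ⟨H, rfl⟩, hr⟩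
      rw [s1, ih] at hr
      filter_upwards [hr] with e he
      exact ⟨H e, trivial, by rw [s2]; exact he⟩
    · intro hr
      obtain ⟨H, hH⟩ := hr.choice
      refine ⟨P H, ⟨H, rfl⟩, ?_⟩
      rw [s1, ih]
      filter_upwards [hH] with e he
      rw [← s2]
      exact he.2

end HelpG

section HelpH
universe u
open ZFSet Filter
open scoped ZFSet

theorem IsOrd.toIsOrdinal {x : ZFSet.{u}} (h : IsOrd x) : x.IsOrdinal :=
  ZFSet.isOrdinal_iff_forall_mem_isTransitive.2 h

theorem isOrd_of {x : ZFSet.{u}} (h : x.IsOrdinal) : IsOrd x :=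
  ZFSet.isOrdinal_iff_forall_mem_isTransitive.1 h

theorem Emb.ord_mem {κ T e a o : ZFSet.{u}} (he : Emb (V_ κ.rank) T e) (hκ : IsOrd κ)
    (ho : IsOrd o) (ha : EE e a o) : a ∈ κ := by
  have h1 : IsOrd a := by
    refine ⟨he.trans_of ha ho.1, ?_⟩
    intro a' ha'
    obtain ⟨z, hz, hE⟩ := (he.mem_iff ha).1 ha'
    exact he.trans_of hE (ho.2 _ hz)
  have h2 := he.left ha
  rw [mem_vonNeumann] at h2
  exact (ZFSet.IsOrdinal.rank_lt_iff_mem h1.toIsOrdinal hκ.toIsOrdinal).1 h2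

theorem measurable_of {α t : ZFSet.{u}} (hα : IsOrd α) (hαt : α ∈ t) (hP : PP α t) :
    MeasurableIn Set.univ α := by
  obtain ⟨U, h⟩ := hP
  let U' := ZFSet.sep (fun X => ∀ᶠ e in (U : Filter ZFSet.{u}), ∃ a ∈ X, EE e a α) (ZFSet.powerset α)
  have hU' : ∀ X, X ∈ U' ↔ X ⊆ α ∧ ∀ᶠ e in (U : Filter ZFSet.{u}), ∃ a ∈ X, EE e a α := by
    intro X
    simp [U']
  have hfull : ∀ᶠ e in (U : Filter ZFSet.{u}), ∃ a ∈ α, EE e a α := by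
    filter_upwards [h.emb, h.fine α hαt] with e he ⟨a, ha⟩
    exact ⟨a, he.ord_mem hα hα ha, ha⟩
  have hdich : ∀ (Q : ZFSet.{u} → Prop), ¬ (∀ᶠ e in (U : Filter ZFSet.{u}), ∃ a ∈ α, Q a ∧ EE e a α) →
      ∀ᶠ e in (U : Filter ZFSet.{u}), ∃ a ∈ α, ¬ Q a ∧ EE e a α := by
    intro Q hQ
    rw [← Ultrafilter.eventually_not] at hQ
    filter_upwards [hfull, hQ] with e ⟨a, ha, hE⟩ hn
    exact ⟨a, ha, fun hq => hn ⟨a, ha, hq, hE⟩, hE⟩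
  refine ⟨U', trivial, ?_, ?_, ?_, ?_, ?_, ?_, ?_⟩
  · intro x hx
    exact ((hU' x).1 hx).1
  · exact (hU' _).2 ⟨fun _ h => h, hfull⟩
  · intro hh
    obtain ⟨e, a, ha, _⟩ := ((hU' _).1 hh).2.exists
    exact ZFSet.notMem_empty _ ha
  · intro x hx y _ hy hxy
    refine (hU' _).2 ⟨hy, ?_⟩
    filter_upwards [((hU' _).1 hx).2] with e ⟨a, ha, hE⟩
    exact ⟨a, hxy ha, hE⟩
  · intro x _ hx
    by_cases hc : ∀ᶠ e in (U : Filter ZFSet.{u}), ∃ a ∈ α, a ∈ x ∧ EE e a α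
    · left
      refine (hU' _).2 ⟨hx, ?_⟩
      filter_upwards [hc] with e ⟨a, _, h2, h3⟩
      exact ⟨a, h2, h3⟩
    · right
      refine (hU' _).2 ⟨fun y hy => (ZFSet.mem_sep.1 hy).1, ?_⟩
      filter_upwards [hdich _ hc] with e ⟨a, h1, h2, h3⟩
      exact ⟨a, ZFSet.mem_sep.2 ⟨h1, h2⟩, h3⟩
  · intro β hβ g _ hg hgU
    refine (hU' _).2 ⟨fun y hy => (ZFSet.mem_sep.1 hy).1, ?_⟩
    by_cases hc : ∀ᶠ e in (U : Filter ZFSet.{u}), ∃ a ∈ α,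
        (∀ p q : ZFSet, p.pair q ∈ g → a ∈ q) ∧ EE e a α
    · filter_upwards [hc] with e ⟨a, h1, h2, h3⟩
      exact ⟨a, ZFSet.mem_sep.2 ⟨h1, h2⟩, h3⟩
    · exfalso
      have h2 : ∀ᶠ e in (U : Filter ZFSet.{u}), ∃ p, p ∈ β ∧ ∃ a q, p.pair q ∈ g ∧ a ∉ q ∧ EE e a α := by
        filter_upwards [hdich _ hc] with e ⟨a, h1, h2, h3⟩
        push Not at h2
        obtain ⟨p, q, hpq, haq⟩ := h2
        refine ⟨p, ?_, a, q, hpq, haq, h3⟩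
        obtain ⟨a', b', ha', hh⟩ := hg.1 _ hpq
        rw [ZFSet.pair_inj] at hh
        rw [hh.1]; exact ha'
      obtain ⟨F, hF⟩ := h2.choice
      have hβV : β ∈ V_ α.rank := by
        rw [mem_vonNeumann]; exact rank_lt_of_mem hβ
      obtain ⟨c, hc, hFc⟩ := h.const (isTransitive_vonNeumann _) hβV F (hF.mono fun e he => he.1)
      obtain ⟨q, hq, huq⟩ := hg.2 c hc
      have hqU := ((hU' q).1 (hgU _ _ hq)).2
      obtain ⟨e, h1, ⟨_, a, q', h2, h3, h4⟩, h5, b, hb, hEb⟩ :=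
        (hFc.and (hF.and (h.emb.and hqU))).exists
      rw [h1] at h2
      have := huq _ h2
      subst this
      rw [h5.inj h4 hEb] at h3
      exact h3 hb
  · intro ξ hξ hh
    have hξV : ξ ∈ V_ α.rank := by
      rw [mem_vonNeumann]; exact rank_lt_of_mem hξ
    obtain ⟨e, h1, h2, a, ha, hE⟩ := (h.emb.and ((h.fix ξ hξV).and ((hU' _).1 hh).2)).exists
    have := (ZFSet.mem_sep.1 ha).2
    subst this
    have := h1.fn hE h2
    rw [this] at hξ
    exact ZFSet.mem_irrefl _ hξ

theorem Good.output {κ T : ZFSet.{u}} {U : Ultrafilter ZFSet.{u}} (h : Good (V_ κ.rank) T U)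
    (hT : T.IsTransitive) (hκ : IsOrd κ) (hw : Ordinal.omega0.{u}.toZFSet ∈ V_ κ.rank) (hκT : κ ∈ T)
    {lam x f : ZFSet.{u}} (hlam : IsOrd lam) (hlamT : lam ∈ T) (hxT : x ∈ T)
    (hf : ∀ᶠ d in (U : Filter ZFSet.{u}), ∃ a b, EE d a κ ∧ EE d b x ∧ ZFSet.pair a b ∈ f) :
    ∃ M : Set ZFSet.{u}, TransClass M ∧ ∃ j : ElemEmb Set.univ M,
      IsCrit j κ ∧ lam ∈ j.toFun κ ∧ SeqClosed M lam ∧ κ.pair x ∈ j.toFun f := by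
  classical
  obtain ⟨P, hP, hEq, hMem⟩ := h.collapse (isTransitive_vonNeumann _) hw
  let inv : ZFSet.{u} → ZFSet.{u} → ZFSet.{u} := fun z e =>
    if H : ∃ a, EE e a z then H.choose else ∅
  have hinv : ∀ z ∈ T, ∀ᶠ e in (U : Filter ZFSet.{u}), EE e (inv z e) z := by
    intro z hz
    filter_upwards [h.fine z hz] with e he
    simp only [inv, dif_pos he]
    exact he.choose_spec
  have hnorm : ∀ z ∈ T, ∀ F : ZFSet.{u} → ZFSet.{u}, (∀ᶠ e in (U : Filter ZFSet.{u}), F e ∈ inv z e) →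
      ∃ w ∈ z, ∀ᶠ e in (U : Filter ZFSet.{u}), F e = inv w e := by
    intro z hz F hF
    obtain ⟨w, hw, hE⟩ := h.normal F (by
      filter_upwards [h.emb, hinv z hz, hF] with e h1 h2 h3
      exact h1.dom h2 h3)
    refine ⟨w, ?_, ?_⟩
    · obtain ⟨e, h1, h2, h3, h4⟩ := (h.emb.and ((hinv z hz).and (hF.and hE))).exists
      exact (h1.mem h4 h2).1 h3
    · filter_upwards [h.emb, hE, hinv w hw] with e h1 h2 h3
      exact h1.inj h2 h3
  have hTl : ∀ z, z ∈ T → P (inv z) = z := by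
    intro z
    induction z using ZFSet.inductionOn with
    | _ z ih =>
    intro hz
    ext y
    rw [hP]
    constructor
    · rintro ⟨F, hF, rfl⟩
      obtain ⟨w, hw, hE⟩ := hnorm z hz F hF
      rw [(hEq _ _).2 hE, ih w hw (hT _ hz hw)]
      exact hw
    · intro hy
      refine ⟨inv y, ?_, ih y hy (hT _ hz hy)⟩
      filter_upwards [h.emb, hinv z hz, hinv y (hT _ hz hy)] with e h1 h2 h3
      exact (h1.mem h3 h2).2 hy
  have hKT : ∀ y ∈ V_ κ.rank, P (fun _ => y) = y := by
    intro y hy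
    have hyT : y ∈ T := by
      obtain ⟨e, h1, h2⟩ := (h.emb.and (h.fix y hy)).exists
      exact h1.right h2
    rw [← hTl y hyT]
    rw [hEq, hTl y hyT]
    filter_upwards [h.emb, h.fix y hy, hinv y hyT] with e h1 h2 h3
    exact h1.inj h2 h3
  have hord : ∀ o ∈ T, IsOrd o → o ∈ P (fun _ => κ) := by
    intro o ho hoo
    rw [← hTl o ho, hMem]
    filter_upwards [h.emb, hinv o ho] with e h1 h2
    exact h1.ord_mem hκ hoo h2
  have hup : ∀ F G, P (fun e => {F e, G e}) = {P F, P G} := by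
    intro F G
    ext y
    rw [hP]
    simp only [ZFSet.mem_pair]
    constructor
    · rintro ⟨H, hH, rfl⟩
      rw [Ultrafilter.eventually_or] at hH
      rw [hEq, hEq]
      exact hH
    · rintro (rfl | rfl)
      · exact ⟨F, Eventually.of_forall fun e => Or.inl rfl, rfl⟩
      · exact ⟨G, Eventually.of_forall fun e => Or.inr rfl, rfl⟩
  have hpr : ∀ F G, P (fun e => ZFSet.pair (F e) (G e)) = ZFSet.pair (P F) (P G) := by
    intro F G
    have h1 : P (fun e => {F e}) = {P F} := by
      have := hup F F
      simpa only [ZFSet.pair_eq_singleton] using this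
    exact (hup (fun e => {F e}) (fun e => {F e, G e})).trans (by rw [h1, hup F G]; rfl)
  refine ⟨Set.range P, ?_, ⟨fun y => P (fun _ => y), fun y _ => ⟨_, rfl⟩, ?_⟩, ⟨hκ, ?_, ?_⟩, ?_, ?_, ?_⟩
  · rintro _ ⟨F, rfl⟩ y hy
    obtain ⟨H, _, rfl⟩ := (hP _ _).1 hy
    exact ⟨H, rfl⟩
  · intro n φ v _
    rw [los hEq hMem φ (fun i _ => v i)]
    simp
  · intro hh
    have := hord κ hκT hκ
    simp only at hh
    rw [hh] at this
    exact ZFSet.mem_irrefl _ this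
  · intro α hα
    exact hKT α (by rw [mem_vonNeumann]; exact rank_lt_of_mem hα)
  · exact hord lam hlamT hlam
  · intro g _ hg hgM
    have : ∀ ξ : ZFSet.{u}, ∃ H, ξ ∈ lam → ZFSet.pair ξ (P H) ∈ g := by
      intro ξ
      by_cases hξ : ξ ∈ lam
      · obtain ⟨b, hb, _⟩ := hg.2 ξ hξ
        obtain ⟨H, rfl⟩ := hgM _ _ hb
        exact ⟨H, fun _ => hb⟩
      · exact ⟨id, fun hh => absurd hh hξ⟩
    choose Hs hHs using this
    let fwd : ZFSet.{u} → ZFSet.{u} → ZFSet.{u} := fun e b =>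
      if H : ∃ z, EE e b z then H.choose else ∅
    have hfwd : ∀ e b z, Emb (V_ κ.rank) T e → EE e b z → fwd e b = z := by
      intro e b z he hb
      have H : ∃ z, EE e b z := ⟨z, hb⟩
      simp only [fwd, dif_pos H]
      exact he.fn H.choose_spec hb
    let G : ZFSet.{u} → ZFSet.{u} := fun e =>
      ZFSet.range (fun b : {b // b ∈ inv lam e} => ZFSet.pair b.1 (Hs (fwd e b.1) e))
    have hG : ∀ e y, y ∈ G e ↔ ∃ b ∈ inv lam e, y = ZFSet.pair b (Hs (fwd e b) e) := by
      intro e y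
      simp only [G, ZFSet.mem_range]
      constructor
      · rintro ⟨⟨b, hb⟩, rfl⟩
        exact ⟨b, hb, rfl⟩
      · rintro ⟨b, hb, rfl⟩
        exact ⟨⟨b, hb⟩, rfl⟩
    refine ⟨G, ?_⟩
    ext y
    rw [hP]
    constructor
    · rintro ⟨H, hH, rfl⟩
      have h1 : ∀ᶠ e in (U : Filter ZFSet.{u}), ∃ b, b ∈ inv lam e ∧ H e = ZFSet.pair b (Hs (fwd e b) e) := by
        filter_upwards [hH] with e he
        exact (hG _ _).1 he
      obtain ⟨B, hB⟩ := h1.choice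
      obtain ⟨ξ, hξ, hE⟩ := hnorm lam hlamT B (hB.mono fun e he => he.1)
      have hξT := hT _ hlamT hξ
      have : P H = ZFSet.pair ξ (P (Hs ξ)) := by
        have e1 : P H = P (fun e => ZFSet.pair (inv ξ e) (Hs ξ e)) := by
          rw [hEq]
          filter_upwards [hB, hE, hinv ξ hξT, h.emb] with e h1 h2 h3 h4
          rw [h1.2, h2, hfwd e _ ξ h4 h3]
        rw [e1, hpr, hTl ξ hξT]
      rw [this]
      exact hHs ξ hξ
    · intro hy
      obtain ⟨ξ, b, hξ, rfl⟩ := hg.1 y hy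
      have hξT := hT _ hlamT hξ
      have hb : b = P (Hs ξ) := (hg.2 ξ hξ).unique hy (hHs ξ hξ)
      refine ⟨fun e => ZFSet.pair (inv ξ e) (Hs ξ e), ?_, by rw [hpr, hTl ξ hξT, hb]⟩
      filter_upwards [hinv ξ hξT, hinv lam hlamT, h.emb] with e h1 h2 h3
      rw [hG]
      exact ⟨inv ξ e, (h3.mem h1 h2).2 hξ, by rw [hfwd e _ ξ h3 h1]⟩
  · change _ ∈ P (fun _ => f)
    rw [← hTl κ hκT, ← hTl x hxT, ← hpr, hMem]
    filter_upwards [hf, hinv κ hκT, hinv x hxT, h.emb] with e ⟨a, b, ha, hb, hab⟩ h2 h3 h4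
    rw [h4.inj h2 ha, h4.inj h3 hb]
    exact hab

end HelpH

section HelpI
universe u
open ZFSet Filter
open scoped ZFSet

theorem realize_rename (C : Set ZFSet.{u}) {n : ℕ} (φ : Fml n) : ∀ {m : ℕ} (f : Fin n → Fin m)
    (v : Fin m → ZFSet.{u}), Fml.Realize C (Fml.rename f φ) v ↔ Fml.Realize C φ (fun i => v (f i)) := by
  induction φ with
  | mem i j => intro m f v; rfl
  | eq i j => intro m f v; rfl
  | not φ ih => intro m f v; simp only [Fml.rename, Fml.Realize, ih]
  | and φ ψ ih1 ih2 => intro m f v; simp only [Fml.rename, Fml.Realize, ih1, ih2]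
  | @ex n φ ih =>
    intro m f v
    simp only [Fml.rename, Fml.Realize, ih]
    have : ∀ x, (fun i => (Fin.snoc v x : Fin (m+1) → ZFSet.{u})
        ((Fin.snoc (fun i => (f i).castSucc) (Fin.last m) : Fin (n+1) → Fin (m+1)) i)) =
        (Fin.snoc (fun i => v (f i)) x : Fin (n+1) → ZFSet.{u}) := by
      intro x
      funext i
      refine Fin.lastCases ?_ (fun i => ?_) i <;> simp
    simp only [this]

/-- Predicates absolutely definable over transitive classes. -/
def Abs {n : ℕ} (R : (Fin n → ZFSet.{u}) → Prop) : Prop :=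
  ∃ φ : Fml n, ∀ C : Set ZFSet.{u}, TransClass C → ∀ v, (∀ i, v i ∈ C) → (Fml.Realize C φ v ↔ R v)

theorem Abs.mem {n : ℕ} (i j : Fin n) : Abs (fun v : Fin n → ZFSet.{u} => v i ∈ v j) :=
  ⟨.mem i j, fun _ _ _ _ => Iff.rfl⟩

theorem Abs.eq {n : ℕ} (i j : Fin n) : Abs (fun v : Fin n → ZFSet.{u} => v i = v j) :=
  ⟨.eq i j, fun _ _ _ _ => Iff.rfl⟩

theorem Abs.not {n : ℕ} {R : (Fin n → ZFSet.{u}) → Prop} (h : Abs R) : Abs (fun v => ¬ R v) := by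
  obtain ⟨φ, h⟩ := h
  exact ⟨.not φ, fun C hC v hv => not_congr (h C hC v hv)⟩

theorem Abs.and {n : ℕ} {R S : (Fin n → ZFSet.{u}) → Prop} (h : Abs R) (h' : Abs S) :
    Abs (fun v => R v ∧ S v) := by
  obtain ⟨φ, h⟩ := h
  obtain ⟨ψ, h'⟩ := h'
  exact ⟨.and φ ψ, fun C hC v hv => and_congr (h C hC v hv) (h' C hC v hv)⟩

theorem Abs.congr {n : ℕ} {R S : (Fin n → ZFSet.{u}) → Prop} (h : Abs R) (h' : ∀ v, R v ↔ S v) :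
    Abs S := by
  obtain ⟨φ, h⟩ := h
  exact ⟨φ, fun C hC v hv => (h C hC v hv).trans (h' v)⟩

theorem Abs.or {n : ℕ} {R S : (Fin n → ZFSet.{u}) → Prop} (h : Abs R) (h' : Abs S) :
    Abs (fun v => R v ∨ S v) :=
  (h.not.and h'.not).not.congr fun v => by tauto

theorem Abs.imp {n : ℕ} {R S : (Fin n → ZFSet.{u}) → Prop} (h : Abs R) (h' : Abs S) :
    Abs (fun v => R v → S v) :=
  (h.and h'.not).not.congr fun v => by tauto

theorem Abs.iff {n : ℕ} {R S : (Fin n → ZFSet.{u}) → Prop} (h : Abs R) (h' : Abs S) :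
    Abs (fun v => R v ↔ S v) :=
  ((h.imp h').and (h'.imp h)).congr fun v => by tauto

theorem Abs.bex {n : ℕ} (i : Fin n) {R : (Fin n → ZFSet.{u}) → ZFSet.{u} → Prop}
    (h : Abs (fun w : Fin (n+1) → ZFSet.{u} => R (fun k => w k.castSucc) (w (Fin.last n)))) :
    Abs (fun v => ∃ x ∈ v i, R v x) := by
  obtain ⟨φ, h⟩ := h
  refine ⟨.ex (.and (.mem (Fin.last n) i.castSucc) φ), fun C hC v hv => ?_⟩
  simp only [Fml.Realize, Fin.snoc_last, Fin.snoc_castSucc]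
  have key : ∀ x ∈ C, (Fml.Realize C φ (Fin.snoc v x : Fin (n+1) → ZFSet.{u}) ↔ R v x) := by
    intro x hx
    rw [h C hC _ (by
      intro k
      refine Fin.lastCases ?_ (fun k => ?_) k
      · simpa using hx
      · simpa using hv k)]
    simp
  constructor
  · rintro ⟨x, hx, h1, h2⟩
    exact ⟨x, h1, (key x hx).1 h2⟩
  · rintro ⟨x, h1, h2⟩
    have hx := hC _ (hv i) _ h1
    exact ⟨x, hx, h1, (key x hx).2 h2⟩

theorem Abs.ball {n : ℕ} (i : Fin n) {R : (Fin n → ZFSet.{u}) → ZFSet.{u} → Prop}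
    (h : Abs (fun w : Fin (n+1) → ZFSet.{u} => R (fun k => w k.castSucc) (w (Fin.last n)))) :
    Abs (fun v => ∀ x ∈ v i, R v x) :=
  (Abs.bex i (R := fun v x => ¬ R v x) h.not).not.congr fun v => by push Not; rfl

theorem Abs.ren {n m : ℕ} {R : (Fin n → ZFSet.{u}) → Prop} (h : Abs R) (f : Fin n → Fin m) :
    Abs (fun v : Fin m → ZFSet.{u} => R (fun i => v (f i))) := by
  obtain ⟨φ, h⟩ := h
  exact ⟨Fml.rename f φ, fun C hC v hv => (realize_rename C φ f v).trans (h C hC _ fun i => hv _)⟩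

theorem upair_iff {p a b : ZFSet.{u}} : p = {a, b} ↔ a ∈ p ∧ b ∈ p ∧ ∀ x ∈ p, x = a ∨ x = b := by
  constructor
  · rintro rfl
    simp
  · rintro ⟨h1, h2, h3⟩
    ext x
    rw [ZFSet.mem_pair]
    constructor
    · exact h3 x
    · rintro (rfl | rfl) <;> assumption

theorem Abs.upair {n : ℕ} (p a b : Fin n) : Abs (fun v : Fin n → ZFSet.{u} => v p = {v a, v b}) := by
  refine Abs.congr (R := fun v => v a ∈ v p ∧ v b ∈ v p ∧ ∀ x ∈ v p, x = v a ∨ x = v b) ?_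
    fun v => upair_iff.symm
  exact (Abs.mem _ _).and ((Abs.mem _ _).and (Abs.ball _ ((Abs.eq _ _).or (Abs.eq _ _))))

theorem Abs.pair {n : ℕ} (p a b : Fin n) :
    Abs (fun v : Fin n → ZFSet.{u} => v p = ZFSet.pair (v a) (v b)) := by
  refine Abs.congr (R := fun v => ∃ q ∈ v p, ∃ r ∈ v p, q = {v a, v a} ∧ r = {v a, v b} ∧
    v p = {q, r}) ?_ fun v => ?_
  · exact Abs.bex _ (Abs.bex _ ((Abs.upair _ _ _).and ((Abs.upair _ _ _).and (Abs.upair _ _ _))))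
  · constructor
    · rintro ⟨q, _, r, _, rfl, rfl, h⟩
      rw [h, ZFSet.pair_eq_singleton]; rfl
    · intro h
      refine ⟨{v a}, ?_, {v a, v b}, ?_, ?_, rfl, h⟩
      · rw [h]; simp [ZFSet.pair]
      · rw [h]; simp [ZFSet.pair]
      · rw [ZFSet.pair_eq_singleton]

theorem Abs.EE {n : ℕ} (e a b : Fin n) :
    Abs (fun v : Fin n → ZFSet.{u} => EE (v e) (v a) (v b)) := by
  refine Abs.congr (R := fun v => ∃ p ∈ v e, p = ZFSet.pair (v a) (v b)) ?_ fun v => ?_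
  · exact Abs.bex _ (Abs.pair _ _ _)
  · simp [WSC.EE]

/-- A bundled class embedding. -/
structure CE (M : Set ZFSet.{u}) (J : ZFSet.{u} → ZFSet.{u}) : Prop where
  tr : TransClass M
  maps : ∀ x, J x ∈ M
  elem : ∀ {n : ℕ} (φ : Fml n) (v : Fin n → ZFSet.{u}),
    (Fml.Realize Set.univ φ v ↔ Fml.Realize M φ (fun i => J (v i)))

theorem trans_univ : TransClass (Set.univ : Set ZFSet.{u}) := fun _ _ _ _ => trivial

variable {M : Set ZFSet.{u}} {J : ZFSet.{u} → ZFSet.{u}}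

theorem CE.abs (hJ : CE M J) {n : ℕ} {R : (Fin n → ZFSet.{u}) → Prop} (h : Abs R)
    (v : Fin n → ZFSet.{u}) : R v ↔ R (fun i => J (v i)) := by
  obtain ⟨φ, h⟩ := h
  rw [← h Set.univ trans_univ v (fun _ => trivial), hJ.elem, h M hJ.tr _ fun i => hJ.maps _]

theorem CE.all (hJ : CE M J) {n : ℕ} {R : (Fin n → ZFSet.{u}) → ZFSet.{u} → Prop}
    (h : Abs (fun w : Fin (n+1) → ZFSet.{u} => R (fun k => w k.castSucc) (w (Fin.last n))))
    (v : Fin n → ZFSet.{u}) (H : ∀ x, R v x) : ∀ x ∈ M, R (fun i => J (v i)) x := by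
  obtain ⟨φ, h⟩ := h
  have h1 : Fml.Realize Set.univ (.not (.ex (.not φ))) v := by
    simp only [Fml.Realize]
    rintro ⟨x, _, hx⟩
    rw [h _ trans_univ _ fun _ => trivial] at hx
    simp [H] at hx
  rw [hJ.elem] at h1
  simp only [Fml.Realize] at h1
  intro x hx
  by_contra hc
  refine h1 ⟨x, hx, ?_⟩
  rw [h M hJ.tr]
  · simpa using hc
  · intro k
    refine Fin.lastCases ?_ (fun k => ?_) k
    · simpa using hx
    · simpa using hJ.maps _

/-- Closure of `M` under a definable operation. -/
theorem CE.clos (hJ : CE M J) {R : ZFSet.{u} → ZFSet.{u} → ZFSet.{u} → Prop}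
    (h : Abs (fun w : Fin 3 → ZFSet.{u} => R (w 0) (w 1) (w 2)))
    (H : ∀ x y, ∃ z, R x y z) : ∀ x ∈ M, ∀ y ∈ M, ∃ z ∈ M, R x y z := by
  obtain ⟨φ, h⟩ := h
  have h1 : Fml.Realize Set.univ (.not (.ex (.ex (.not (.ex φ))))) (![] : Fin 0 → ZFSet.{u}) := by
    simp only [Fml.Realize]
    rintro ⟨x, _, y, _, hx⟩
    obtain ⟨z, hz⟩ := H x y
    refine hx ⟨z, trivial, ?_⟩
    rw [h _ trans_univ _ fun _ => trivial]
    exact hz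
  rw [hJ.elem] at h1
  simp only [Fml.Realize] at h1
  intro x hx y hy
  by_contra hc
  refine h1 ⟨x, hx, y, hy, ?_⟩
  rintro ⟨z, hz, hr⟩
  refine hc ⟨z, hz, ?_⟩
  rw [h M hJ.tr] at hr
  · exact hr
  · intro k
    fin_cases k
    · exact hx
    · exact hy
    · exact hz

end HelpI

section HelpJ
universe u
open ZFSet Filter
open scoped ZFSet

variable {M : Set ZFSet.{u}} {J : ZFSet.{u} → ZFSet.{u}}

theorem CE.mem (hJ : CE M J) {x y : ZFSet.{u}} : x ∈ y ↔ J x ∈ J y :=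
  hJ.abs (Abs.mem 0 1) ![x, y]

theorem CE.inj (hJ : CE M J) {x y : ZFSet.{u}} : x = y ↔ J x = J y :=
  hJ.abs (Abs.eq 0 1) ![x, y]

theorem CE.upair (hJ : CE M J) (a b : ZFSet.{u}) : J {a, b} = {J a, J b} :=
  (hJ.abs (Abs.upair 0 1 2) ![{a, b}, a, b]).1 rfl

theorem CE.pair (hJ : CE M J) (a b : ZFSet.{u}) : J (ZFSet.pair a b) = ZFSet.pair (J a) (J b) :=
  (hJ.abs (Abs.pair 0 1 2) ![ZFSet.pair a b, a, b]).1 rfl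

theorem CE.rel (hJ : CE M J) {e a b : ZFSet.{u}} : EE e a b ↔ EE (J e) (J a) (J b) :=
  hJ.abs (Abs.EE 0 1 2) ![e, a, b]

theorem CE.sub (hJ : CE M J) {a b : ZFSet.{u}} (h : a ⊆ b) : J a ⊆ J b :=
  (hJ.abs (R := fun v => ∀ x ∈ v 0, x ∈ v 1) (Abs.ball _ (Abs.mem _ _)) ![a, b]).1 @h

theorem CE.empty (hJ : CE M J) : J ∅ = ∅ := by
  have := (hJ.abs (R := fun v => ∀ x ∈ v 0, ¬ x = x) (Abs.ball _ (Abs.eq _ _).not) ![∅]).1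
    (fun x hx => absurd hx (ZFSet.notMem_empty x))
  rw [ZFSet.eq_empty]
  intro y hy
  exact this y hy rfl

theorem CE.trans (hJ : CE M J) {a : ZFSet.{u}} (h : a.IsTransitive) : (J a).IsTransitive := by
  have := (hJ.abs (R := fun v => ∀ x ∈ v 0, ∀ y ∈ x, y ∈ v 0)
    (Abs.ball _ (Abs.ball _ (Abs.mem _ _))) ![a]).1 (fun x hx y hy => h x hx hy)
  intro x hx y hy
  exact this x hx y hy

theorem CE.pairM (hJ : CE M J) {a b : ZFSet.{u}} (ha : a ∈ M) (hb : b ∈ M) : ZFSet.pair a b ∈ M := by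
  obtain ⟨z, hz, rfl⟩ := hJ.clos (R := fun a b z => z = ZFSet.pair a b) (Abs.pair 2 0 1)
    (fun a b => ⟨_, rfl⟩) a ha b hb
  exact hz

theorem CE.ranM (hJ : CE M J) {f Z : ZFSet.{u}} (hf : f ∈ M) (hZ : ∀ b, b ∈ Z ↔ ∃ a, EE f a b) :
    Z ∈ M := by
  have key : ∀ f Z : ZFSet.{u}, ((∀ p ∈ f, ∀ q ∈ p, ∀ a ∈ q, ∀ b ∈ q, p = ZFSet.pair a b → b ∈ Z) ∧
      (∀ b ∈ Z, ∃ p ∈ f, ∃ q ∈ p, ∃ a ∈ q, p = ZFSet.pair a b)) ↔ ∀ b, b ∈ Z ↔ ∃ a, EE f a b := by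
    intro f Z
    constructor
    · rintro ⟨h1, h2⟩ b
      constructor
      · intro hb
        obtain ⟨p, hp, q, hq, a, ha, rfl⟩ := h2 b hb
        exact ⟨a, hp⟩
      · rintro ⟨a, ha⟩
        exact h1 _ ha {a, b} (by simp [ZFSet.pair]) a (by simp) b (by simp) rfl
    · intro h
      constructor
      · rintro p hp q hq a ha b hb rfl
        exact (h b).2 ⟨a, hp⟩
      · intro b hb
        obtain ⟨a, ha⟩ := (h b).1 hb
        exact ⟨_, ha, {a, b}, by simp [ZFSet.pair], a, by simp, rfl⟩
  obtain ⟨z, hz, hR⟩ := hJ.clos (R := fun f _ Z =>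
      (∀ p ∈ f, ∀ q ∈ p, ∀ a ∈ q, ∀ b ∈ q, p = ZFSet.pair a b → b ∈ Z) ∧
      (∀ b ∈ Z, ∃ p ∈ f, ∃ q ∈ p, ∃ a ∈ q, p = ZFSet.pair a b))
    ((Abs.ball _ (Abs.ball _ (Abs.ball _ (Abs.ball _ ((Abs.pair _ _ _).imp (Abs.mem _ _)))))).and
      (Abs.ball _ (Abs.bex _ (Abs.bex _ (Abs.bex _ (Abs.pair _ _ _))))))
    (by
      intro f _
      refine ⟨ZFSet.sep (fun b => ∃ a, EE f a b) (ZFSet.sUnion (ZFSet.sUnion f)), (key _ _).2 ?_⟩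
      intro b
      rw [ZFSet.mem_sep]
      constructor
      · exact fun h => h.2
      · rintro ⟨a, ha⟩
        refine ⟨?_, a, ha⟩
        rw [ZFSet.mem_sUnion]
        refine ⟨{a, b}, ?_, by simp⟩
        rw [ZFSet.mem_sUnion]
        exact ⟨_, ha, by simp [ZFSet.pair]⟩) f hf f hf
  have : z = Z := by
    ext b
    rw [(key _ _).1 hR, hZ]
  rwa [← this]

theorem mem_image' {X : ZFSet.{u}} {h : ZFSet.{u} → ZFSet.{u}} {y : ZFSet.{u}} :
    y ∈ ZFSet.range (fun x : {x // x ∈ X} => h x.1) ↔ ∃ x ∈ X, y = h x := by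
  rw [ZFSet.mem_range]
  constructor
  · rintro ⟨⟨x, hx⟩, rfl⟩
    exact ⟨x, hx, rfl⟩
  · rintro ⟨x, hx, rfl⟩
    exact ⟨⟨x, hx⟩, rfl⟩

/-- The graph of `h` on `X`. -/
noncomputable def graphZ (X : ZFSet.{u}) (h : ZFSet.{u} → ZFSet.{u}) : ZFSet.{u} :=
  ZFSet.range (fun x : {x // x ∈ X} => ZFSet.pair x.1 (h x.1))

theorem mem_graphZ {X y : ZFSet.{u}} {h : ZFSet.{u} → ZFSet.{u}} :
    y ∈ graphZ X h ↔ ∃ x ∈ X, y = ZFSet.pair x (h x) :=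
  mem_image' (h := fun x => ZFSet.pair x (h x))

theorem EE_graphZ {X a b : ZFSet.{u}} {h : ZFSet.{u} → ZFSet.{u}} :
    EE (graphZ X h) a b ↔ a ∈ X ∧ b = h a := by
  unfold WSC.EE
  rw [mem_graphZ]
  constructor
  · rintro ⟨x, hx, he⟩
    rw [ZFSet.pair_inj] at he
    rw [he.1, he.2]; exact ⟨hx, rfl⟩
  · rintro ⟨h1, rfl⟩
    exact ⟨a, h1, rfl⟩

theorem isFuncOn_graphZ (X : ZFSet.{u}) (h : ZFSet.{u} → ZFSet.{u}) : IsFuncOn X (graphZ X h) := by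
  constructor
  · intro p hp
    obtain ⟨x, hx, rfl⟩ := mem_graphZ.1 hp
    exact ⟨x, h x, hx, rfl⟩
  · intro a ha
    exact ⟨h a, EE_graphZ.2 ⟨ha, rfl⟩, fun b hb => (EE_graphZ.1 hb).2⟩

theorem CE.closM (hJ : CE M J) {lam : ZFSet.{u}} (hcl : SeqClosed M lam) {Z : ZFSet.{u}}
    (h : ZFSet.{u} → ZFSet.{u}) (hh : ∀ ξ ∈ lam, h ξ ∈ M) (hZ : ∀ y, y ∈ Z ↔ ∃ ξ ∈ lam, y = h ξ) :
    Z ∈ M := by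
  have h1 : graphZ lam h ∈ M := by
    refine hcl _ trivial (isFuncOn_graphZ _ _) ?_
    intro x y hxy
    obtain ⟨hx, rfl⟩ := EE_graphZ.1 hxy
    exact hh _ hx
  refine hJ.ranM h1 ?_
  intro b
  rw [hZ]
  simp only [EE_graphZ]

/-- Images of sets injecting into `lam` belong to `M`. -/
theorem CE.imgM (hJ : CE M J) {lam : ZFSet.{u}} (hcl : SeqClosed M lam) {T Z : ZFSet.{u}}
    (c : ZFSet.{u} → ZFSet.{u}) (hc : ∀ z ∈ T, c z ∈ lam)
    (hci : ∀ z ∈ T, ∀ w ∈ T, c z = c w → z = w)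
    (X : ZFSet.{u}) (hXT : X ⊆ T)
    (h : ZFSet.{u} → ZFSet.{u}) (hh : ∀ x ∈ X, h x ∈ M) (hZ : ∀ y, y ∈ Z ↔ ∃ x ∈ X, y = h x) :
    Z ∈ M := by
  classical
  by_cases hX : ∃ x0, x0 ∈ X
  · obtain ⟨x0, hx0⟩ := hX
    refine hJ.closM hcl (fun ξ => if H : ∃ x ∈ X, c x = ξ then h H.choose else h x0) ?_ ?_
    · intro ξ _
      by_cases H : ∃ x ∈ X, c x = ξ
      · simp only [dif_pos H]
        exact hh _ H.choose_spec.1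
      · simp only [dif_neg H]
        exact hh _ hx0
    · intro y
      rw [hZ]
      constructor
      · rintro ⟨x, hx, rfl⟩
        refine ⟨c x, hc _ (hXT hx), ?_⟩
        have H : ∃ x' ∈ X, c x' = c x := ⟨x, hx, rfl⟩
        simp only [dif_pos H]
        rw [hci _ (hXT H.choose_spec.1) _ (hXT hx) H.choose_spec.2]
      · rintro ⟨ξ, hξ, rfl⟩
        by_cases H : ∃ x ∈ X, c x = ξ
        · simp only [dif_pos H]
          exact ⟨_, H.choose_spec.1, rfl⟩
        · simp only [dif_neg H]
          exact ⟨_, hx0, rfl⟩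
  · have : Z = ∅ := by
      rw [ZFSet.eq_empty]
      intro y hy
      obtain ⟨x, hx, _⟩ := (hZ y).1 hy
      exact hX ⟨x, hx⟩
    rw [this, ← hJ.empty]
    exact hJ.maps _

theorem CE.subM (hJ : CE M J) {lam : ZFSet.{u}} (hcl : SeqClosed M lam) {T : ZFSet.{u}}
    (hT : T.IsTransitive) (c : ZFSet.{u} → ZFSet.{u}) (hc : ∀ z ∈ T, c z ∈ lam)
    (hci : ∀ z ∈ T, ∀ w ∈ T, c z = c w → z = w) : ∀ z, z ∈ T → z ∈ M := by
  intro z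
  induction z using ZFSet.inductionOn with
  | _ z ih =>
  intro hz
  refine hJ.imgM hcl c hc hci z (hT _ hz) id (fun x hx => ih x hx (hT _ hz hx)) ?_
  simp

/-- Rank witnesses. -/
def Wit (r : ZFSet.{u}) : Prop :=
  ∀ p ∈ r, ∀ q ∈ p, ∀ z ∈ q, ∀ c ∈ q, p = ZFSet.pair z c → ∀ w ∈ z, ∃ d ∈ c, EE r w d

theorem Abs.wit {n : ℕ} (i : Fin n) : Abs (fun v : Fin n → ZFSet.{u} => Wit (v i)) := by
  unfold Wit
  exact Abs.ball _ (Abs.ball _ (Abs.ball _ (Abs.ball _ ((Abs.pair _ _ _).imp (Abs.ball _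
    (Abs.bex _ (Abs.EE _ _ _)))))))

theorem Wit.rank_le {r : ZFSet.{u}} (h : Wit r) : ∀ z c, EE r z c → z.rank ≤ c.rank := by
  intro z
  induction z using ZFSet.inductionOn with
  | _ z ih =>
  intro c hc
  rw [rank_le_iff]
  intro w hw
  obtain ⟨d, hd, hE⟩ := h _ hc {z, c} (by simp [ZFSet.pair]) z (by simp) c (by simp) rfl w hw
  exact (ih w hw d hE).trans_lt (rank_lt_of_mem hd)

/-- Canonical rank witness. -/
noncomputable def rkZ (X : ZFSet.{u}) : ZFSet.{u} := graphZ X (fun z => z.rank.toZFSet)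

theorem wit_rkZ {X : ZFSet.{u}} (hX : X.IsTransitive) : Wit (rkZ X) := by
  rintro p hp q hq z hz c hc rfl w hw
  obtain ⟨h1, rfl⟩ := EE_graphZ.1 hp
  refine ⟨w.rank.toZFSet, ?_, EE_graphZ.2 ⟨hX _ h1 hw, rfl⟩⟩
  rw [← ZFSet.IsOrdinal.rank_lt_iff_mem (ZFSet.isOrdinal_toZFSet _) (ZFSet.isOrdinal_toZFSet _)]
  simpa using rank_lt_of_mem hw

theorem toZFSet_mem_of {κ : ZFSet.{u}} (hκ : IsOrd κ) {o : Ordinal.{u}} (h : o < κ.rank) :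
    o.toZFSet ∈ κ := by
  rw [← ZFSet.IsOrdinal.rank_lt_iff_mem (ZFSet.isOrdinal_toZFSet _) hκ.toIsOrdinal]
  simpa using h

theorem CE.fixV (hJ : CE M J) {κ : ZFSet.{u}} (hκ : IsOrd κ) (hfix : ∀ α ∈ κ, J α = α) :
    ∀ x, x.rank < κ.rank → J x = x := by
  have hrk : ∀ x, x.rank < κ.rank → (J x).rank ≤ x.rank := by
    intro x hx
    have h1 : Wit (J (rkZ (V_ κ.rank))) :=
      (hJ.abs (Abs.wit 0) ![rkZ (V_ κ.rank)]).1 (wit_rkZ (isTransitive_vonNeumann _))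
    have h2 : WSC.EE (rkZ (V_ κ.rank)) x x.rank.toZFSet :=
      EE_graphZ.2 ⟨mem_vonNeumann.2 hx, rfl⟩
    rw [hJ.rel, hfix _ (toZFSet_mem_of hκ hx)] at h2
    simpa using h1.rank_le _ _ h2
  have : ∀ o : Ordinal.{u}, ∀ x, x.rank = o → x.rank < κ.rank → J x = x := by
    intro o
    induction o using WellFoundedLT.induction with
    | _ o ih =>
    rintro x rfl hx
    ext y
    constructor
    · intro hy
      have hlt : y.rank < x.rank := (rank_lt_of_mem hy).trans_le (hrk x hx)
      have := ih _ hlt y rfl (hlt.trans hx)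
      rw [← this, ← hJ.mem] at hy
      exact hy
    · intro hy
      have hlt : y.rank < x.rank := rank_lt_of_mem hy
      have := ih _ hlt y rfl (hlt.trans hx)
      rw [← this, ← hJ.mem]
      exact hy
  intro x hx
  exact this _ x rfl hx

end HelpJ

section HelpK
universe u
open ZFSet Filter
open scoped ZFSet

variable {M : Set ZFSet.{u}} {J : ZFSet.{u} → ZFSet.{u}}

/-- The derived ultrafilter. -/
theorem CE.exists_uf (hJ : CE M J) {D s : ZFSet.{u}} (hs : s ∈ J D) :
    ∃ U : Ultrafilter ZFSet.{u}, ∀ Q : ZFSet.{u} → Prop,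
      (∀ᶠ d in (U : Filter ZFSet.{u}), Q d) ↔ s ∈ J (ZFSet.sep Q D) := by
  let f : Filter ZFSet.{u} :=
    { sets := {X | s ∈ J (ZFSet.sep (fun d => d ∈ X) D)}
      univ_sets := by
        have : ZFSet.sep (fun d => d ∈ (Set.univ : Set ZFSet.{u})) D = D := by
          ext x; simp
        simp only [Set.mem_setOf_eq]
        rw [this]
        exact hs
      sets_of_superset := by
        intro X Y hX hXY
        refine hJ.sub ?_ hX
        intro d hd
        rw [ZFSet.mem_sep] at *
        exact ⟨hd.1, hXY hd.2⟩
      inter_sets := by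
        intro X Y hX hY
        have := (hJ.abs (R := fun v => ∀ x ∈ v 0, x ∈ v 1 → x ∈ v 2)
          (Abs.ball _ ((Abs.mem _ _).imp (Abs.mem _ _)))
          ![ZFSet.sep (fun d => d ∈ X) D, ZFSet.sep (fun d => d ∈ Y) D,
            ZFSet.sep (fun d => d ∈ X ∩ Y) D]).1 (by
              intro x hx hy
              have h1 := ZFSet.mem_sep.1 hx
              have h2 := ZFSet.mem_sep.1 hy
              exact ZFSet.mem_sep.2 ⟨h1.1, h1.2, h2.2⟩)
        exact this s hX hY }
  have hf : ∀ X : Set ZFSet.{u}, X ∈ f ↔ s ∈ J (ZFSet.sep (fun d => d ∈ X) D) := fun X => Iff.rfl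
  refine ⟨Ultrafilter.ofComplNotMemIff f ?_, ?_⟩
  · intro X
    rw [hf, hf]
    have h1 := (hJ.abs (R := fun v => ∀ x ∈ v 0, x ∈ v 1 ∨ x ∈ v 2)
      (Abs.ball _ ((Abs.mem _ _).or (Abs.mem _ _)))
      ![D, ZFSet.sep (fun d => d ∈ X) D, ZFSet.sep (fun d => d ∈ Xᶜ) D]).1 (by
        intro x hx
        by_cases h : x ∈ X
        · exact Or.inl (ZFSet.mem_sep.2 ⟨hx, h⟩)
        · exact Or.inr (ZFSet.mem_sep.2 ⟨hx, h⟩)) s hs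
    have h2 := (hJ.abs (R := fun v => ∀ x ∈ v 0, ¬ x ∈ v 1)
      (Abs.ball _ (Abs.mem _ _).not)
      ![ZFSet.sep (fun d => d ∈ X) D, ZFSet.sep (fun d => d ∈ Xᶜ) D]).1 (by
        intro x hx hy
        have h1 := ZFSet.mem_sep.1 hx
        have h2 := ZFSet.mem_sep.1 hy
        exact h2.2 h1.2) s
    exact ⟨fun h => h1.resolve_right h, h2⟩
  · intro Q
    exact hf {d | Q d}

/-- Łoś for the derived ultrafilter, one direction. -/
theorem CE.der (hJ : CE M J) {D s : ZFSet.{u}} (hs : s ∈ J D) {n : ℕ}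
    {R : (Fin n → ZFSet.{u}) → ZFSet.{u} → Prop}
    (h : Abs (fun w : Fin (n+1) → ZFSet.{u} => R (fun k => w k.castSucc) (w (Fin.last n))))
    (p : Fin n → ZFSet.{u}) (hR : R (fun i => J (p i)) s) : s ∈ J (ZFSet.sep (R p) D) := by
  have hA : Abs (fun v : Fin (n+2) → ZFSet.{u} => ∀ d ∈ v (Fin.last (n+1)),
      R (fun k => v k.castSucc.castSucc) d → d ∈ v (Fin.last n).castSucc) := by
    refine Abs.ball _ (Abs.imp ?_ (Abs.mem _ _))
    exact h.ren (Fin.lastCases (Fin.last (n+2)) (fun k => k.castSucc.castSucc.castSucc)) |>.congr (by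
      intro v
      simp)
  have := (hJ.abs hA (Fin.snoc (Fin.snoc p (ZFSet.sep (R p) D) : Fin (n+1) → ZFSet.{u}) D)).1 (by
    intro d hd hr
    simp only [Fin.snoc_last, Fin.snoc_castSucc] at *
    exact ZFSet.mem_sep.2 ⟨hd, hr⟩)
  simp only [Fin.snoc_last, Fin.snoc_castSucc] at this
  exact this s hs hR

theorem CE.der' (hJ : CE M J) {D s : ZFSet.{u}} (hs : s ∈ J D) {n : ℕ}
    {R : (Fin n → ZFSet.{u}) → ZFSet.{u} → Prop}
    (h : Abs (fun w : Fin (n+1) → ZFSet.{u} => R (fun k => w k.castSucc) (w (Fin.last n))))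
    (p : Fin n → ZFSet.{u}) (hR : s ∈ J (ZFSet.sep (R p) D)) : R (fun i => J (p i)) s := by
  by_contra hc
  have h1 := hJ.der hs (R := fun v x => ¬ R v x) h.not p hc
  exact (hJ.abs (R := fun v => ∀ x ∈ v 0, ¬ x ∈ v 1)
      (Abs.ball _ (Abs.mem _ _).not)
      ![ZFSet.sep (R p) D, ZFSet.sep (fun d => ¬ R p d) D]).1 (by
        intro x hx hy
        have hx1 : x ∈ ZFSet.sep (R p) D := hx
        have hy1 : x ∈ ZFSet.sep (fun d => ¬ R p d) D := hy
        have h1 := ZFSet.mem_sep.1 hx1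
        have h2 := ZFSet.mem_sep.1 hy1
        exact h2.2 h1.2) s hR h1

/-- Bounded form of `Emb`. -/
def EmbB (K T e : ZFSet.{u}) : Prop :=
  (∀ p ∈ e, ∃ a ∈ K, ∃ z ∈ T, p = ZFSet.pair a z) ∧
  (∀ a ∈ K, ∀ z ∈ T, ∀ z' ∈ T, EE e a z → EE e a z' → z = z') ∧
  (∀ a ∈ K, ∀ a' ∈ K, ∀ z ∈ T, EE e a z → EE e a' z → a = a') ∧
  (∀ a ∈ K, ∀ a' ∈ K, ∀ z ∈ T, ∀ z' ∈ T, EE e a z → EE e a' z' → (a ∈ a' ↔ z ∈ z')) ∧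
  (∀ a ∈ K, ∀ z ∈ T, ∀ a' ∈ a, EE e a z → ∃ z' ∈ T, EE e a' z')

theorem EmbB.emb {K T e : ZFSet.{u}} (h : EmbB K T e) : Emb K T e := by
  obtain ⟨h1, h2, h3, h4, h5⟩ := h
  have hl : ∀ {a z}, EE e a z → a ∈ K ∧ z ∈ T := by
    intro a z ha
    obtain ⟨a', ha', z', hz', hp⟩ := h1 _ ha
    rw [ZFSet.pair_inj] at hp
    rw [hp.1, hp.2]; exact ⟨ha', hz'⟩
  refine ⟨h1, ?_, ?_, ?_, ?_⟩
  · intro a z z' h h'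
    exact h2 a (hl h).1 z (hl h).2 z' (hl h').2 h h'
  · intro a a' z h h'
    exact h3 a (hl h).1 a' (hl h').1 z (hl h).2 h h'
  · intro a a' z z' h h'
    exact h4 a (hl h).1 a' (hl h').1 z (hl h).2 z' (hl h').2 h h'
  · intro a a' z h h'
    obtain ⟨z', _, hz'⟩ := h5 a (hl h).1 z (hl h).2 a' h' h
    exact ⟨z', hz'⟩

theorem Abs.embB {n : ℕ} (i j k : Fin n) :
    Abs (fun v : Fin n → ZFSet.{u} => EmbB (v i) (v j) (v k)) := by
  unfold EmbB
  refine Abs.and ?_ (Abs.and ?_ (Abs.and ?_ (Abs.and ?_ ?_)))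
  · exact Abs.ball _ (Abs.bex _ (Abs.bex _ (Abs.pair _ _ _)))
  · exact Abs.ball _ (Abs.ball _ (Abs.ball _ ((Abs.EE _ _ _).imp ((Abs.EE _ _ _).imp (Abs.eq _ _)))))
  · exact Abs.ball _ (Abs.ball _ (Abs.ball _ ((Abs.EE _ _ _).imp ((Abs.EE _ _ _).imp (Abs.eq _ _)))))
  · exact Abs.ball _ (Abs.ball _ (Abs.ball _ (Abs.ball _ ((Abs.EE _ _ _).imp ((Abs.EE _ _ _).imp
      ((Abs.mem _ _).iff (Abs.mem _ _)))))))
  · exact Abs.ball _ (Abs.ball _ (Abs.ball _ ((Abs.EE _ _ _).imp (Abs.bex _ (Abs.EE _ _ _)))))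

theorem CE.derive (hJ : CE M J) {κ lam : ZFSet.{u}} (hκ : IsOrd κ) (hfix : ∀ α ∈ κ, J α = α)
    (hlam : IsOrd lam) (hlamκ : lam ∈ J κ) (hcl : SeqClosed M lam) {o : Ordinal.{u}}
    (hκo : κ.rank < o) (ho : o ≤ lam.rank) (c : ZFSet.{u} → ZFSet.{u})
    (hc : ∀ z ∈ V_ o, c z ∈ lam) (hci : ∀ z ∈ V_ o, ∀ w ∈ V_ o, c z = c w → z = w) :
    PP κ (V_ o) := by
  have hTt : (V_ o).IsTransitive := isTransitive_vonNeumann o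
  have hTM := hJ.subM hcl hTt c hc hci
  have hfixV := hJ.fixV hκ hfix
  have hJκt : (J κ).IsTransitive := hJ.trans hκ.1
  have hordM : ∀ x ∈ V_ o, x.rank.toZFSet ∈ J κ := by
    intro x hx
    exact hJκt _ hlamκ (toZFSet_mem_of hlam ((mem_vonNeumann.1 hx).trans_le ho))
  have hTK : ∀ z ∈ V_ o, z ∈ J (V_ κ.rank) := by
    have hr : rkZ (V_ o) ∈ M := by
      refine hJ.imgM hcl c hc hci (V_ o) (fun _ h => h)
        (fun z => ZFSet.pair z z.rank.toZFSet) ?_ (fun y => mem_graphZ)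
      intro x hx
      exact hJ.pairM (hTM _ hx) (hJ.tr _ (hJ.maps _) _ (hordM x hx))
    have := hJ.all (R := fun (v : Fin 2 → ZFSet.{u}) r => Wit r → ∀ p ∈ r, ∀ q ∈ p, ∀ z ∈ q, ∀ c ∈ q,
        p = ZFSet.pair z c → c ∈ v 0 → z ∈ v 1)
      ((Abs.wit _).imp (Abs.ball _ (Abs.ball _ (Abs.ball _ (Abs.ball _ ((Abs.pair _ _ _).imp
        ((Abs.mem _ _).imp (Abs.mem _ _))))))))
      ![κ, V_ κ.rank] (by
        rintro r hr p hp q hq z hz c hc rfl hcκ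
        change z ∈ V_ κ.rank
        rw [mem_vonNeumann]
        exact (hr.rank_le _ _ hp).trans_lt (rank_lt_of_mem hcκ))
    intro z hz
    exact this _ hr (wit_rkZ hTt) _ (EE_graphZ.2 ⟨hz, rfl⟩) {z, z.rank.toZFSet}
      (by simp [ZFSet.pair]) z (by simp) z.rank.toZFSet (by simp) rfl (hordM z hz)
  let s := graphZ (V_ o) J
  have hsM : s ∈ M := by
    refine hJ.imgM hcl c hc hci (V_ o) (fun _ h => h)
        (fun z => ZFSet.pair z (J z)) ?_ (fun y => mem_graphZ)
    intro x hx
    exact hJ.pairM (hTM _ hx) (hJ.maps _)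
  let D := ZFSet.powerset (ZFSet.prod (V_ κ.rank) (V_ o))
  have hsub : ∀ p ∈ s, ∃ a ∈ J (V_ κ.rank), ∃ z ∈ J (V_ o), p = ZFSet.pair a z := by
    intro p hp
    obtain ⟨z, hz, rfl⟩ := mem_graphZ.1 hp
    exact ⟨z, hTK z hz, J z, hJ.mem.1 hz, rfl⟩
  have hsD : s ∈ J D := by
    have := hJ.all (R := fun (v : Fin 3 → ZFSet.{u}) d =>
        (∀ p ∈ d, ∃ a ∈ v 0, ∃ z ∈ v 1, p = ZFSet.pair a z) → d ∈ v 2)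
      ((Abs.ball _ (Abs.bex _ (Abs.bex _ (Abs.pair _ _ _)))).imp (Abs.mem _ _))
      ![V_ κ.rank, V_ o, D] (by
        intro d hd
        change d ∈ D
        rw [ZFSet.mem_powerset]
        intro p hp
        obtain ⟨a, ha, z, hz, rfl⟩ := hd p hp
        exact ZFSet.pair_mem_prod.2 ⟨ha, hz⟩)
    exact this s hsM hsub
  have hsE : ∀ {a b}, WSC.EE s a b ↔ a ∈ V_ o ∧ b = J a := EE_graphZ
  obtain ⟨U, hU⟩ := hJ.exists_uf hsD
  refine ⟨U, ⟨?_, ?_, ?_, ?_⟩⟩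
  · have : ∀ᶠ d in (U : Filter ZFSet.{u}), EmbB (V_ κ.rank) (V_ o) d := by
      rw [hU]
      refine hJ.der hsD (R := fun v d => EmbB (v 0) (v 1) d) (Abs.embB _ _ _) ![V_ κ.rank, V_ o] ?_
      refine ⟨hsub, ?_, ?_, ?_, ?_⟩
      · intro a _ z _ z' _ h h'
        rw [(hsE.1 h).2, (hsE.1 h').2]
      · intro a _ a' _ z _ h h'
        rw [hJ.inj, ← (hsE.1 h).2, ← (hsE.1 h').2]
      · intro a _ a' _ z _ z' _ h h'
        rw [(hsE.1 h).2, (hsE.1 h').2, ← hJ.mem]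
      · intro a _ z _ a' ha' h
        have := hTt _ (hsE.1 h).1 ha'
        exact ⟨J a', hJ.mem.1 this, hsE.2 ⟨this, rfl⟩⟩
    exact this.mono fun e he => he.emb
  · intro z hz
    have : ∀ᶠ d in (U : Filter ZFSet.{u}), ∃ a ∈ V_ κ.rank, EE d a z := by
      rw [hU]
      refine hJ.der hsD (R := fun v d => ∃ a ∈ v 0, EE d a (v 1)) (Abs.bex _ (Abs.EE _ _ _))
        ![V_ κ.rank, z] ?_
      exact ⟨z, hTK z hz, hsE.2 ⟨hz, rfl⟩⟩
    exact this.mono fun e ⟨a, _, ha⟩ => ⟨a, ha⟩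
  · intro x hx
    rw [hU]
    refine hJ.der hsD (R := fun v d => EE d (v 0) (v 0)) (Abs.EE _ _ _) ![x] ?_
    change EE s (J x) (J x)
    rw [mem_vonNeumann] at hx
    rw [hfixV x hx, hsE]
    exact ⟨mem_vonNeumann.2 (hx.trans hκo), (hfixV x hx).symm⟩
  · intro F hF
    let Fs := graphZ D F
    have hemb : ∀ᶠ d in (U : Filter ZFSet.{u}), d ∈ D := by
      rw [hU]
      have : ZFSet.sep (fun d => d ∈ D) D = D := by ext x; simp
      rw [this]
      exact hsD
    have h1 : ∀ᶠ d in (U : Filter ZFSet.{u}), ∃ a ∈ V_ κ.rank, ∃ z ∈ V_ o, EE Fs d a ∧ EE d a z := by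
      filter_upwards [hF, hemb] with d ⟨z, hz⟩ hd
      have := ZFSet.mem_powerset.1 hd hz
      rw [ZFSet.pair_mem_prod] at this
      exact ⟨F d, this.1, z, this.2, EE_graphZ.2 ⟨hd, rfl⟩, hz⟩
    rw [hU] at h1
    obtain ⟨a, ha, z, hz, hsa, haz⟩ := hJ.der' hsD
      (R := fun v d => ∃ a ∈ v 0, ∃ z ∈ v 1, EE (v 2) d a ∧ EE d a z)
      (Abs.bex _ (Abs.bex _ ((Abs.EE _ _ _).and (Abs.EE _ _ _)))) ![V_ κ.rank, V_ o, Fs] h1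
    have haz' := hsE.1 haz
    refine ⟨a, haz'.1, ?_⟩
    have h2 : ∀ᶠ d in (U : Filter ZFSet.{u}), ∃ b ∈ V_ κ.rank, EE Fs d b ∧ EE d b a := by
      rw [hU]
      refine hJ.der hsD (R := fun v d => ∃ b ∈ v 0, EE (v 1) d b ∧ EE d b (v 2))
        (Abs.bex _ ((Abs.EE _ _ _).and (Abs.EE _ _ _))) ![V_ κ.rank, Fs, a] ?_
      exact ⟨a, ha, hsa, hsE.2 ⟨haz'.1, rfl⟩⟩
    refine h2.mono ?_
    rintro d ⟨b, _, hb, hE⟩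
    rw [(EE_graphZ.1 hb).2] at hE
    exact hE

end HelpK

section HelpL
universe u
open ZFSet Filter
open scoped ZFSet

variable {M : Set ZFSet.{u}} {J : ZFSet.{u} → ZFSet.{u}}

theorem succ_iff {C b : ZFSet.{u}} : C = insert b b ↔
    b ∈ C ∧ (∀ x ∈ b, x ∈ C) ∧ ∀ x ∈ C, x = b ∨ x ∈ b := by
  constructor
  · rintro rfl
    refine ⟨by simp, fun x hx => by simp [hx], fun x hx => by simpa using hx⟩
  · rintro ⟨h1, h2, h3⟩
    ext x
    rw [ZFSet.mem_insert_iff]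
    constructor
    · exact h3 x
    · rintro (rfl | h)
      · exact h1
      · exact h2 x h

theorem Abs.succ {n : ℕ} (C b : Fin n) :
    Abs (fun v : Fin n → ZFSet.{u} => v C = insert (v b) (v b)) := by
  refine Abs.congr (R := fun v => v b ∈ v C ∧ (∀ x ∈ v b, x ∈ v C) ∧ ∀ x ∈ v C, x = v b ∨ x ∈ v b) ?_
    fun v => succ_iff.symm
  exact (Abs.mem _ _).and ((Abs.ball _ (Abs.mem _ _)).and (Abs.ball _ ((Abs.eq _ _).or (Abs.mem _ _))))

theorem CE.succ (hJ : CE M J) (b : ZFSet.{u}) : J (insert b b) = insert (J b) (J b) :=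
  (hJ.abs (Abs.succ 0 1) ![insert b b, b]).1 rfl

theorem CE.nat (hJ : CE M J) (n : ℕ) : J (n : Ordinal.{u}).toZFSet = (n : Ordinal.{u}).toZFSet := by
  induction n with
  | zero => simp [Ordinal.toZFSet_zero, hJ.empty]
  | succ n ih =>
    have : ((n + 1 : ℕ) : Ordinal.{u}).toZFSet
        = insert (n : Ordinal.{u}).toZFSet (n : Ordinal.{u}).toZFSet := by
      push_cast
      exact Ordinal.toZFSet_add_one _
    rw [this, hJ.succ, ih]

theorem CE.om (hJ : CE M J) : J Ordinal.omega0.{u}.toZFSet = Ordinal.omega0.{u}.toZFSet := by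
  set w := Ordinal.omega0.{u}.toZFSet with hw
  have hmem : ∀ x, x ∈ w ↔ ∃ n : ℕ, x = (n : Ordinal.{u}).toZFSet := by
    intro x
    rw [hw, Ordinal.mem_toZFSet_iff]
    constructor
    · rintro ⟨a, ha, rfl⟩
      obtain ⟨n, rfl⟩ := Ordinal.lt_omega0.1 ha
      exact ⟨n, rfl⟩
    · rintro ⟨n, rfl⟩
      exact ⟨n, Ordinal.natCast_lt_omega0 n, rfl⟩
  have hsucc : ∀ y ∈ w, insert y y ∈ w := by
    intro y hy
    obtain ⟨n, rfl⟩ := (hmem y).1 hy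
    refine (hmem _).2 ⟨n + 1, ?_⟩
    push_cast
    exact (Ordinal.toZFSet_add_one _).symm
  have he : ∅ ∈ w := (hmem _).2 ⟨0, by simp [Ordinal.toZFSet_zero]⟩
  have h1 : ∀ x ∈ J w, (∀ y ∈ x, ¬ y = y) ∨ ∃ y ∈ x, x = insert y y :=
    (hJ.abs (R := fun v => ∀ x ∈ v 0, (∀ y ∈ x, ¬ y = y) ∨ ∃ y ∈ x, x = insert y y)
      (Abs.ball _ ((Abs.ball _ (Abs.eq _ _).not).or (Abs.bex _ (Abs.succ _ _)))) ![w]).1 (by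
        intro x hx
        obtain ⟨n, rfl⟩ := (hmem x).1 hx
        cases n with
        | zero => left; simp [Ordinal.toZFSet_zero]
        | succ n =>
          right
          have : ((n + 1 : ℕ) : Ordinal.{u}).toZFSet
              = insert (n : Ordinal.{u}).toZFSet (n : Ordinal.{u}).toZFSet := by
            push_cast
            exact Ordinal.toZFSet_add_one _
          exact ⟨(n : Ordinal.{u}).toZFSet, by rw [this]; simp, this⟩)
  have htr : (J w).IsTransitive := hJ.trans (ZFSet.isOrdinal_toZFSet _).isTransitive
  have h2 : ∀ x, x ∈ J w → x ∈ w := by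
    intro x
    induction x using ZFSet.inductionOn with
    | _ x ih =>
      intro hx
      rcases h1 x hx with h | ⟨y, hy, h⟩
      · have : x = ∅ := (ZFSet.eq_empty x).2 fun y hy => h y hy rfl
        rw [this]; exact he
      · rw [h]; exact hsucc y (ih y hy (htr x hx hy))
  ext x
  constructor
  · exact h2 x
  · intro hx
    have := hJ.mem.1 hx
    obtain ⟨n, rfl⟩ := (hmem x).1 hx
    rwa [hJ.nat] at this

theorem CE.crit_gt (hJ : CE M J) {κ : ZFSet.{u}} (hκ : IsOrd κ) (hne : J κ ≠ κ) :
    Ordinal.omega0 < κ.rank := by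
  by_contra hc
  apply hne
  have hk : κ.rank.toZFSet = κ := hκ.toIsOrdinal.toZFSet_rank_eq
  rcases (not_lt.1 hc).lt_or_eq with h | h
  · obtain ⟨n, hn⟩ := Ordinal.lt_omega0.1 h
    rw [← hk, hn, hJ.nat]
  · rw [← hk, h, hJ.om]

theorem ElemEmb.ce (j : ElemEmb (Set.univ : Set ZFSet.{u}) M) (hM : TransClass M) : CE M j.toFun :=
  ⟨hM, fun x => j.maps x trivial, fun φ v => j.elem φ v (fun _ => trivial)⟩

theorem card_add {δ : ZFSet.{u}} (h : IsCard δ) (hw : Ordinal.omega0 < δ.rank) :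
    ∀ o < δ.rank, o + Ordinal.omega0 < δ.rank := by
  have hd : δ.rank.toZFSet = δ := h.1.toIsOrdinal.toZFSet_rank_eq
  have hc : δ.rank.card.ord = δ.rank := by
    refine le_antisymm (Cardinal.ord_card_le _) ?_
    by_contra hlt
    push Not at hlt
    set c := δ.rank.card.ord with hcd
    refine h.2 c.toZFSet ?_ ?_
    · rw [← hd]; exact Ordinal.toZFSet_mem_toZFSet_iff.2 hlt
    · have : Cardinal.mk (Set.Iio δ.rank) = Cardinal.mk (Set.Iio c) := by
        rw [Cardinal.mk_Iio_ordinal, Cardinal.mk_Iio_ordinal, hcd, Cardinal.card_ord]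
      obtain ⟨e⟩ := Cardinal.eq.1 this
      classical
      let f : ZFSet.{u} → ZFSet.{u} := fun x =>
        if hx : x.rank < δ.rank then (e ⟨x.rank, hx⟩).1.toZFSet else ∅
      refine ⟨graphZ δ f, trivial, isFuncOn_graphZ _ _, ?_, ?_⟩
      · intro x y hxy
        obtain ⟨hx, rfl⟩ := EE_graphZ.1 hxy
        have hr := ZFSet.rank_lt_of_mem hx
        simp only [f, hr, dif_pos]
        exact Ordinal.toZFSet_mem_toZFSet_iff.2 (e ⟨x.rank, hr⟩).2
      · intro x x' y hxy hxy'
        obtain ⟨hx, rfl⟩ := EE_graphZ.1 hxy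
        obtain ⟨hx', he⟩ := EE_graphZ.1 hxy'
        have hr := ZFSet.rank_lt_of_mem hx
        have hr' := ZFSet.rank_lt_of_mem hx'
        simp only [f, hr, hr', dif_pos] at he
        have he2 := e.injective (Subtype.ext (Ordinal.toZFSet_injective he))
        have he3 : x.rank = x'.rank := congrArg Subtype.val he2
        exact ZFSet.IsOrdinal.rank_inj (h.1.toIsOrdinal.mem hx) (h.1.toIsOrdinal.mem hx') |>.1 he3
  intro o ho
  have hinf : Cardinal.aleph0 ≤ δ.rank.card := by
    rw [← Cardinal.ord_le_ord, hc, Cardinal.ord_aleph0]; exact hw.le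
  rw [← hc] at ho hw ⊢
  exact Ordinal.isPrincipal_add_ord hinf ho hw

theorem exists_LtSC {δ : ZFSet.{u}} (h : Vopenka δ) (hadd : ∀ o < δ.rank, o + Ordinal.omega0 < δ.rank)
    {ζ : ZFSet.{u}} (hζ : ζ ∈ δ) : ∃ κ ∈ δ, LtSupercompact κ δ ∧ ζ ∈ κ := by
  obtain ⟨κ, hκδ, hκ⟩ := h.2 ({ζ, ζ} : ZFSet.{u}) trivial (by
    intro x hx
    have : x = ζ := by simpa using hx
    rw [this]; exact ZFSet.rank_lt_of_mem hζ)
  have hδ := h.1.1.toIsOrdinal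
  have hoκ := hδ.mem hκδ
  have hoζ := hδ.mem hζ
  refine ⟨κ, hκδ, ?_, ?_⟩
  · intro lam h1 h2
    obtain ⟨M, a, b, j, c, d, e, _⟩ := hκ lam h1 h2
    exact ⟨M, a, b, j, c, d, e⟩
  · by_contra hc
    have hle : κ ∈ ζ ∨ κ = ζ := by
      rcases ZFSet.IsOrdinal.mem_trichotomous hoκ hoζ with h | h | h
      · exact Or.inl h
      · exact Or.inr h
      · exact absurd h hc
    have hs : insert ζ ζ = (ζ.rank + 1).toZFSet := by
      rw [Ordinal.toZFSet_add_one, hoζ.toZFSet_rank_eq]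
    have hsδ : insert ζ ζ ∈ δ := by
      rw [hs]
      apply toZFSet_mem_of h.1.1
      refine lt_of_le_of_lt ?_ (hadd _ (ZFSet.rank_lt_of_mem hζ))
      gcongr
      exact Ordinal.one_lt_omega0.le
    obtain ⟨M, _, hM, j, hcr, hl, _, hag⟩ := hκ (insert ζ ζ) (Or.inl (by
      rw [ZFSet.mem_insert_iff]; tauto)) hsδ
    have hJ := j.ce hM
    have h1 := (hag ζ trivial (ZFSet.rank_lt_of_mem (by simp))).1 (by simp)
    rw [hJ.upair] at h1
    have h2 : ζ = j.toFun ζ := by simpa using h1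
    rcases hle with h3 | h3
    · have h4 := hJ.mem.1 h3
      rw [← h2] at h4
      have h5 := hoζ.isTransitive _ h4 hl
      have h6 : ζ ∈ (insert ζ ζ : ZFSet.{u}) := by simp
      exact ZFSet.mem_asymm h5 h6
    · rw [← h3] at h2
      exact hcr.2.1 h2.symm

theorem CE.inj_of (hJ : CE M J) {κ : ZFSet.{u}} (hκ : IsOrd κ) (hfix : ∀ α ∈ κ, J α = α)
    (hκJ : κ ∈ J κ) {ζ : Ordinal.{u}} (hζ : ζ < κ.rank) :
    ∃ c : ZFSet.{u} → ZFSet.{u}, (∀ z ∈ V_ ζ, c z ∈ κ) ∧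
      ∀ z ∈ V_ ζ, ∀ w ∈ V_ ζ, c z = c w → z = w := by
  classical
  rcases Function.Embedding.total {x // x ∈ V_ ζ} {x // x ∈ κ} with ⟨⟨e, he⟩⟩ | ⟨⟨e, he⟩⟩
  · refine ⟨fun z => if hz : z ∈ V_ ζ then (e ⟨z, hz⟩).1 else ∅, ?_, ?_⟩
    · intro z hz
      simp only [hz, dif_pos]
      exact (e ⟨z, hz⟩).2
    · intro z hz w hw h
      simp only [hz, hw, dif_pos] at h
      exact congrArg Subtype.val (he (Subtype.ext h))
  · exfalso
    let h : ZFSet.{u} → ZFSet.{u} := fun z => if hz : z ∈ κ then (e ⟨z, hz⟩).1 else ∅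
    have hv : ∀ z ∈ κ, h z ∈ V_ ζ := by
      intro z hz
      simp only [h, hz, dif_pos]
      exact (e ⟨z, hz⟩).2
    have hi : ∀ z ∈ κ, ∀ w ∈ κ, h z = h w → z = w := by
      intro z hz w hw h1
      simp only [h, hz, hw, dif_pos] at h1
      exact congrArg Subtype.val (he (Subtype.ext h1))
    set g := graphZ κ h
    set Y := ZFSet.sep (fun y => ∃ a ∈ κ, y = h a) (V_ ζ) with hY
    have hYr : Y.rank < κ.rank := by
      refine lt_of_le_of_lt (ZFSet.rank_mono (x := Y) (y := V_ ζ) (ZFSet.sep_subset)) ?_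
      rw [ZFSet.rank_vonNeumann]; exact hζ
    have hJY : J Y = Y := hJ.fixV hκ hfix _ hYr
    have h1 := (hJ.abs (R := fun v => ∀ a ∈ v 0, ∃ y ∈ v 1, EE (v 2) a y)
      (Abs.ball _ (Abs.bex _ (Abs.EE _ _ _))) ![κ, Y, g]).1 (by
        intro a ha
        have hm : h a ∈ Y := ZFSet.mem_sep.2 ⟨hv a ha, a, ha, rfl⟩
        exact ⟨h a, hm, EE_graphZ.2 ⟨ha, rfl⟩⟩)
    have h2 := (hJ.abs (R := fun v => ∀ a ∈ v 0, ∀ b ∈ v 0, ∀ y ∈ v 1, EE (v 2) a y → EE (v 2) b y → a = b)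
      (Abs.ball _ (Abs.ball _ (Abs.ball _ ((Abs.EE _ _ _).imp ((Abs.EE _ _ _).imp (Abs.eq _ _))))))
      ![κ, Y, g]).1 (by
        intro a ha b hb y hy h1 h2
        have e1 := EE_graphZ.1 h1
        have e2 := EE_graphZ.1 h2
        exact hi a ha b hb (e1.2.symm.trans e2.2))
    obtain ⟨y, hy, hE⟩ := h1 κ hκJ
    have hyY : y ∈ Y := by rw [← hJY]; exact hy
    obtain ⟨hyV, a, ha, hya⟩ := ZFSet.mem_sep.1 hyY
    have hE2 : EE g a y := EE_graphZ.2 ⟨ha, hya⟩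
    have hyr : y.rank < κ.rank := (ZFSet.rank_lt_of_mem hyY).trans hYr
    have hE3 := hJ.rel.1 hE2
    rw [hfix a ha, hJ.fixV hκ hfix y hyr] at hE3
    have haJ : a ∈ J κ := by have := hJ.mem.1 ha; rwa [hfix a ha] at this
    have : κ = a := h2 κ hκJ a haJ y hy hE hE3
    rw [this] at ha
    exact ZFSet.mem_irrefl _ (this ▸ ha)

theorem derive_LtSC {δ : ZFSet.{u}} (h : Vopenka δ)
    (hadd : ∀ o < δ.rank, o + Ordinal.omega0 < δ.rank) {κ : ZFSet.{u}} (hκδ : κ ∈ δ)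
    (hκ : LtSupercompact κ δ) {o : Ordinal.{u}} (ho : o < δ.rank) (hκo : κ.rank < o) :
    PP κ (V_ o) := by
  have hδ := h.1.1.toIsOrdinal
  obtain ⟨μ, hμδ, hμ, hoμ⟩ := exists_LtSC h hadd (toZFSet_mem_of h.1.1 ho)
  have hμo := isOrd_of (hδ.mem hμδ)
  have horank : o < μ.rank := by simpa using ZFSet.rank_lt_of_mem hoμ
  have hc : ∃ c : ZFSet.{u} → ZFSet.{u}, (∀ z ∈ V_ o, c z ∈ μ) ∧
      ∀ z ∈ V_ o, ∀ w ∈ V_ o, c z = c w → z = w := by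
    obtain ⟨M, _, hM, j, hcr, hl, _⟩ := hμ μ (Or.inr rfl) hμδ
    exact (j.ce hM).inj_of hcr.1 hcr.2.2 hl horank
  obtain ⟨c, hc1, hc2⟩ := hc
  have hκμ : κ ∈ μ := by
    rw [← (hδ.mem hκδ).rank_lt_iff_mem hμo.toIsOrdinal]
    exact hκo.trans horank
  obtain ⟨M, _, hM, j, hcr, hl, hcl⟩ := hκ μ (Or.inl hκμ) hμδ
  exact (j.ce hM).derive hcr.1 hcr.2.2 hμo hl hcl hκo horank.le c hc1 hc2

end HelpL

section HelpM
open ZFSet Filter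
open scoped ZFSet
theorem laver_main (δ : ZFSet) (h : Vopenka δ) :
    ∃ f : ZFSet, IsFuncOn δ f ∧ (∀ x y : ZFSet, x.pair y ∈ f → VMem δ y) ∧
      (∀ κ : ZFSet, κ ∈ δ → LtSupercompact κ δ →
        ∀ x lam : ZFSet, VMem δ x → lam ∈ δ → InH lam x →
          ∃ M : Set ZFSet, TransClass M ∧ ∃ j : ElemEmb Set.univ M,
            IsCrit j κ ∧ lam ∈ j.toFun κ ∧ SeqClosed M lam ∧ κ.pair x ∈ j.toFun f) ∧
      (∀ α y : ZFSet, α.pair y ∈ f →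
        (LtSupercompact α δ ∨ ¬ MeasurableIn Set.univ α) → y = ∅) := by
  have hδ := h.1.1.toIsOrdinal
  have hgt : ∀ κ ∈ δ, LtSupercompact κ δ → Ordinal.omega0 < κ.rank := by
    intro κ hκδ hκ
    obtain ⟨M, _, hM, j, hcr, _⟩ := hκ κ (Or.inr rfl) hκδ
    exact (j.ce hM).crit_gt hcr.1 hcr.2.1
  have hw : Ordinal.omega0 < δ.rank := by
    obtain ⟨κ, hκδ, hκ⟩ := h.2 ∅ trivial (by intro x hx; exact absurd hx (ZFSet.notMem_empty x))
    refine lt_trans (hgt κ hκδ ?_) (ZFSet.rank_lt_of_mem hκδ)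
    intro lam h1 h2
    obtain ⟨M, a, b, j, c, d, e, _⟩ := hκ lam h1 h2
    exact ⟨M, a, b, j, c, d, e⟩
  have hadd := card_add h.1 hw
  obtain ⟨F, hF1, hF2, hF3, hF4⟩ := laver_comb δ.rank hadd (fun κ => κ ∈ δ ∧ LtSupercompact κ δ)
    (fun κ hκ o ho hκo => derive_LtSC h hadd hκ.1 hκ.2 ho hκo) (lt_trans Ordinal.omega0_pos hw)
  refine ⟨graphZ δ F, isFuncOn_graphZ _ _, ?_, ?_, ?_⟩
  · intro x y hxy
    obtain ⟨_, rfl⟩ := EE_graphZ.1 hxy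
    exact hF1 x
  · intro κ hκδ hκ x lam hx hlam _
    have hκo := isOrd_of (hδ.mem hκδ)
    have hlo := isOrd_of (hδ.mem hlam)
    set θ := max (max κ.rank lam.rank) x.rank + Ordinal.omega0 with hθ
    have hθδ : θ < δ.rank := hadd _ (max_lt (max_lt (ZFSet.rank_lt_of_mem hκδ)
      (ZFSet.rank_lt_of_mem hlam)) hx)
    have hlt : max (max κ.rank lam.rank) x.rank < θ := by
      rw [hθ]; exact lt_add_of_pos_right _ Ordinal.omega0_pos
    have hkt : κ.rank < θ := lt_of_le_of_lt ((le_max_left _ _).trans (le_max_left _ _)) hlt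
    have hlt' : lam.rank < θ := lt_of_le_of_lt ((le_max_right _ _).trans (le_max_left _ _)) hlt
    have hxt : x.rank < θ := lt_of_le_of_lt (le_max_right _ _) hlt
    have hT : (V_ θ).IsTransitive := ZFSet.isTransitive_vonNeumann θ
    have hκT : κ ∈ V_ θ := ZFSet.mem_vonNeumann.2 hkt
    have hlT : lam ∈ V_ θ := ZFSet.mem_vonNeumann.2 hlt'
    have hxT : x ∈ V_ θ := ZFSet.mem_vonNeumann.2 hxt
    obtain ⟨U, hU, hev⟩ := hF4 κ ⟨hκδ, hκ⟩ (V_ θ) x hT hκT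
      (ZFSet.mem_vonNeumann.2 (by rw [ZFSet.rank_vonNeumann]; exact hkt)) hxT
      (by rw [ZFSet.rank_vonNeumann]; exact hθδ)
    refine hU.output hT hκo (ZFSet.mem_vonNeumann.2 (by
      rw [Ordinal.rank_toZFSet]; exact hgt κ hκδ hκ)) hκT hlo hlT hxT ?_
    filter_upwards [hev, hU.emb] with d hd hemb
    obtain ⟨a, b, ha, hb, hab⟩ := hd
    refine ⟨a, b, ha, hb, EE_graphZ.2 ⟨?_, hab⟩⟩
    exact hδ.isTransitive κ hκδ (hemb.ord_mem hκo hκo ha)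
  · intro α y hαy hor
    obtain ⟨hα, rfl⟩ := EE_graphZ.1 hαy
    rcases hor with h1 | h1
    · exact hF2 α ⟨hα, h1⟩
    · by_contra hne
      obtain ⟨t, _, hαt, _, hP⟩ := hF3 α hne
      exact h1 (measurable_of (isOrd_of (hδ.mem hα)) hαt hP)

end HelpM

/-- **Lemma (universal Laver function).**  If `δ` is Vopěnka, there is a function
`f : δ → V_δ` such that whenever `κ < δ` is `<δ`-supercompact, `f ↾ κ` is a
Laver function for `κ`: for every `x ∈ V_δ` and `lam < δ` with `x ∈ H_lam`,
there is a `lam`-supercompactness embedding `j` with critical point `κ` and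
`(j f)(κ) = x`.  Moreover `f` may be chosen with `f α = ∅` whenever `α` is
`<δ`-supercompact or not measurable. -/
theorem universal_laver_function (δ : ZFSet) (h : Vopenka δ) :
    ∃ f : ZFSet, IsFuncOn δ f ∧ (∀ x y : ZFSet, x.pair y ∈ f → VMem δ y) ∧
      (∀ κ : ZFSet, κ ∈ δ → LtSupercompact κ δ →
        ∀ x lam : ZFSet, VMem δ x → lam ∈ δ → InH lam x →
          ∃ M : Set ZFSet, TransClass M ∧ ∃ j : ElemEmb Set.univ M,
            IsCrit j κ ∧ lam ∈ j.toFun κ ∧ SeqClosed M lam ∧ κ.pair x ∈ j.toFun f) ∧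
      (∀ α y : ZFSet, α.pair y ∈ f →
        (LtSupercompact α δ ∨ ¬ MeasurableIn Set.univ α) → y = ∅) := by
  exact laver_main δ h

end WSC
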